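/- Every triangulation T of a set S of N points in the plane in general position contains a set F of ps-flippable edges with |F| ≥ N/2 − 2. -/

import Mathlib

open scoped Classical

noncomputable section

/-- Points of the plane. -/
abbrev Pt : Type := ℝ × ℝ

/-- A finite point set is in general position if no three of its points are collinear. -/
def GenPos (S : Finset Pt) : Prop :=
  ∀ p ∈ S, ∀ q ∈ S, ∀ r ∈ S, p ≠ q → p ≠ r → q ≠ r →
    ¬ Collinear ℝ ({p, q, r} : Set Pt)

/-- The closed straight segment spanned by an unordered pair of points. -/
def seg2 (e : Sym2 Pt) : Set Pt :=
  Sym2.lift ⟨fun p q => segment ℝ p q, fun p q => segment_symm ℝ p q⟩ e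

/-- A crossing-free straight-edge graph (plane graph) on the point set `S`:
its edges are straight segments between points of `S`, any two of which
meet only at shared endpoints. -/
structure PlaneGraph (S : Finset Pt) where
  edges : Finset (Sym2 Pt)
  endpoint_mem : ∀ e ∈ edges, ∀ p, p ∈ e → p ∈ S
  not_isDiag : ∀ e ∈ edges, ¬ e.IsDiag
  noncrossing : ∀ e₁ ∈ edges, ∀ e₂ ∈ edges, e₁ ≠ e₂ →
    ∀ x ∈ seg2 e₁ ∩ seg2 e₂, x ∈ e₁ ∧ x ∈ e₂

/-- A triangulation of `S` is a maximal plane graph on `S`. -/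
def IsTriangulation {S : Finset Pt} (T : PlaneGraph S) : Prop :=
  ∀ G : PlaneGraph S, T.edges ⊆ G.edges → G.edges = T.edges

/-- `tr S`: the number of triangulations of `S`. -/
def triCount (S : Finset Pt) : ℕ :=
  Nat.card {T : PlaneGraph S // IsTriangulation T}

/-- A plane graph is a spanning cycle of `S` if its edges form a Hamiltonian
cycle on `S`. -/
def IsSpanningCycle {S : Finset Pt} (G : PlaneGraph S) : Prop :=
  3 ≤ S.card ∧ ∃ f : Fin S.card ≃ {p : Pt // p ∈ S},
    G.edges =
      Finset.image (fun i : Fin S.card => s(((f i : Pt)), ((f (finRotate S.card i) : Pt)))) Finset.univ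

/-- `sc S`: the number of crossing-free straight-edge spanning cycles of `S`. -/
def scCount (S : Finset Pt) : ℕ :=
  Nat.card {G : PlaneGraph S // IsSpanningCycle G}

/-- A plane graph is a perfect matching of `S` if every point of `S` is incident
to exactly one edge. -/
def IsPerfectMatching {S : Finset Pt} (G : PlaneGraph S) : Prop :=
  ∀ p ∈ S, ∃! e, e ∈ G.edges ∧ p ∈ e

/-- `pm S`: the number of crossing-free straight-edge perfect matchings of `S`. -/
def pmCount (S : Finset Pt) : ℕ :=
  Nat.card {G : PlaneGraph S // IsPerfectMatching G}

/-- The support of a plane graph `G` on `S`: the number of triangulations of `S`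
containing all edges of `G`. -/
def supp {S : Finset Pt} (G : PlaneGraph S) : ℕ :=
  Nat.card {T : PlaneGraph S // IsTriangulation T ∧ G.edges ⊆ T.edges}

/-- A finite set of points is in (strictly) convex position. -/
def InConvexPosition (Q : Finset Pt) : Prop :=
  ∀ p ∈ Q, p ∉ convexHull ℝ (↑(Q.erase p) : Set Pt)

/-- `p q` is an edge of the convex hull boundary of `Q`. -/
def IsHullEdgeOf (Q : Finset Pt) (p q : Pt) : Prop :=
  p ∈ Q ∧ q ∈ Q ∧ p ≠ q ∧
    segment ℝ p q ⊆ frontier (convexHull ℝ (Q : Set Pt))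

/-- `e` is a diagonal of the convex polygon with vertex set `Q`. -/
def IsDiagonalOf (Q : Finset Pt) (e : Sym2 Pt) : Prop :=
  ∃ p ∈ Q, ∃ q ∈ Q, e = s(p, q) ∧
    openSegment ℝ p q ⊆ interior (convexHull ℝ (Q : Set Pt))

/-- `F` is a set of ps-flippable (pseudo-simultaneously flippable) edges of the
triangulation `T`: the edges of `F` are diagonals of pairwise interior-disjoint
(empty) convex polygons whose boundary edges all belong to `T`. -/
def IsPsFlippable {S : Finset Pt} (T : PlaneGraph S) (F : Finset (Sym2 Pt)) : Prop :=
  F ⊆ T.edges ∧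
  ∃ 𝒬 : Finset (Finset Pt),
    (∀ Q ∈ 𝒬, ↑Q ⊆ (S : Set Pt) ∧ 3 ≤ Q.card ∧ InConvexPosition Q ∧
      (∀ p q, IsHullEdgeOf Q p q → s(p, q) ∈ T.edges) ∧
      (∀ p ∈ S, p ∉ interior (convexHull ℝ (Q : Set Pt)))) ∧
    (∀ Q ∈ 𝒬, ∀ Q' ∈ 𝒬, Q ≠ Q' →
      interior (convexHull ℝ (Q : Set Pt)) ∩ interior (convexHull ℝ (Q' : Set Pt)) = ∅) ∧
    (∀ e ∈ F, ∃ Q ∈ 𝒬, IsDiagonalOf Q e)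

/-- The drawing of a plane graph: the union of its (closed) edge segments and
its vertex set. -/
def drawing {S : Finset Pt} (G : PlaneGraph S) : Set Pt :=
  (⋃ e ∈ G.edges, seg2 e) ∪ (S : Set Pt)

/-- A convex decomposition of `S`: a plane graph containing all convex hull
boundary edges, whose bounded faces are all convex, and with no isolated
vertices. -/
def IsConvexDecomposition {S : Finset Pt} (D : PlaneGraph S) : Prop :=
  (∀ p q, IsHullEdgeOf S p q → s(p, q) ∈ D.edges) ∧
  (∀ x ∉ drawing D, Bornology.IsBounded (connectedComponentIn (drawing D)ᶜ x) →
    Convex ℝ (connectedComponentIn (drawing D)ᶜ x)) ∧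
  (∀ p ∈ S, ∃ e ∈ D.edges, p ∈ e)

/-- `p` is an interior vertex of `S` (not on the convex hull boundary). -/
def InteriorVtx (S : Finset Pt) (p : Pt) : Prop :=
  p ∈ S ∧ p ∉ frontier (convexHull ℝ (S : Set Pt))

/-- `p` has a valid triple of edges in `G`. -/
def IsValidAt {S : Finset Pt} (G : PlaneGraph S) (p : Pt) : Prop :=
  ∃ a ∈ S, ∃ b ∈ S, ∃ c ∈ S,
    p ∈ convexHull ℝ ({a, b, c} : Set Pt) ∧
    s(p, a) ∈ G.edges ∧ s(p, b) ∈ G.edges ∧ s(p, c) ∈ G.edges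

/-- The degree of a point in a plane graph. -/
def degree {S : Finset Pt} (G : PlaneGraph S) (p : Pt) : ℕ :=
  (G.edges.filter (fun e => p ∈ e)).card

/-- `a b c` span a triangular face of the triangulation `T`. -/
def IsTriFace {S : Finset Pt} (T : PlaneGraph S) (a b c : Pt) : Prop :=
  a ∈ S ∧ b ∈ S ∧ c ∈ S ∧
  s(a, b) ∈ T.edges ∧ s(b, c) ∈ T.edges ∧ s(a, c) ∈ T.edges ∧
  ∀ p ∈ S, p ∉ interior (convexHull ℝ ({a, b, c} : Set Pt))

/-- An edge of a triangulation is flippable if its two incident triangles form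
a convex quadrilateral. -/
def IsFlippable {S : Finset Pt} (T : PlaneGraph S) (e : Sym2 Pt) : Prop :=
  e ∈ T.edges ∧ ∃ a b c d : Pt, e = s(a, b) ∧ c ≠ d ∧
    IsTriFace T a b c ∧ IsTriFace T a b d ∧
    (openSegment ℝ a b ∩ openSegment ℝ c d).Nonempty

/-- `flip T`: the number of flippable edges of `T`. -/
def flipCount {S : Finset Pt} (T : PlaneGraph S) : ℕ :=
  (T.edges.filter (fun e => IsFlippable T e)).card

/-- `v3 T`: the number of interior vertices of degree 3 in `T`. -/
def v3 {S : Finset Pt} (T : PlaneGraph S) : ℕ :=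
  (S.filter (fun p => p ∉ frontier (convexHull ℝ (S : Set Pt)) ∧ degree T p = 3)).card

/-- The number of vertices of `S` on its convex hull boundary. -/
def hullVtxCount (S : Finset Pt) : ℕ :=
  (S.filter (fun p => p ∈ frontier (convexHull ℝ (S : Set Pt)))).card

/-- Twice the signed area of the triangle `a b c`. -/
def ori (a b c : Pt) : ℝ := (b.1 - a.1) * (c.2 - a.2) - (b.2 - a.2) * (c.1 - a.1)

lemma ori_cyc (a b c : Pt) : ori b c a = ori a b c := by unfold ori; ring
lemma ori_cyc2 (a b c : Pt) : ori c a b = ori a b c := by unfold ori; ring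
lemma ori_swap (a b c : Pt) : ori b a c = - ori a b c := by unfold ori; ring
lemma ori_swap2 (a b c : Pt) : ori a c b = - ori a b c := by unfold ori; ring
@[simp] lemma ori_left (a b : Pt) : ori a b a = 0 := by unfold ori; ring
@[simp] lemma ori_right (a b : Pt) : ori a b b = 0 := by unfold ori; ring
@[simp] lemma ori_same (a b : Pt) : ori a a b = 0 := by unfold ori; ring

lemma ori_comb (a b x y : Pt) (s t : ℝ) (h : s + t = 1) :
    ori a b (s • x + t • y) = s * ori a b x + t * ori a b y := by
  have ht : t = 1 - s := by linarith
  subst ht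
  simp only [ori, Prod.fst_add, Prod.snd_add, Prod.smul_fst, Prod.smul_snd, smul_eq_mul]
  ring

lemma ori_sum (a b c x : Pt) : ori a b x + ori b c x + ori c a x = ori a b c := by
  unfold ori; ring

lemma convex_ori (a b : Pt) : Convex ℝ {x : Pt | 0 ≤ ori a b x} := by
  intro x hx y hy s t hs ht hst
  simp only [Set.mem_ofPred_eq] at *
  rw [ori_comb _ _ _ _ _ _ hst]; positivity

lemma cont_ori (a b : Pt) : Continuous (fun x : Pt => ori a b x) := by
  unfold ori; fun_prop

lemma hull_ori {Q : Set Pt} {p q x : Pt} (h : ∀ r ∈ Q, 0 ≤ ori p q r)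
    (hx : x ∈ convexHull ℝ Q) : 0 ≤ ori p q x :=
  (convexHull_min (fun r hr => h r hr) (convex_ori p q)) hx

lemma ori_ne_left {a b c : Pt} (h : ori a b c ≠ 0) : a ≠ b := by
  rintro rfl; simp at h
lemma ori_ne_right {a b c : Pt} (h : ori a b c ≠ 0) : b ≠ c := by
  rintro rfl; simp at h
lemma ori_ne_mid {a b c : Pt} (h : ori a b c ≠ 0) : a ≠ c := by
  rintro rfl; simp at h

/-- a point on the line `p q` -/
lemma ori_eq_zero_param {p q r : Pt} (hpq : p ≠ q) (h : ori p q r = 0) :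
    ∃ t : ℝ, r = (1 - t) • p + t • q := by
  have hD : 0 < (q.1 - p.1)^2 + (q.2 - p.2)^2 := by
    by_contra hc
    have h1 : q.1 - p.1 = 0 := by nlinarith [sq_nonneg (q.1-p.1), sq_nonneg (q.2-p.2)]
    have h2 : q.2 - p.2 = 0 := by nlinarith [sq_nonneg (q.1-p.1), sq_nonneg (q.2-p.2)]
    exact hpq (Prod.ext (by linarith) (by linarith))
  refine ⟨((r.1-p.1)*(q.1-p.1) + (r.2-p.2)*(q.2-p.2)) / ((q.1 - p.1)^2 + (q.2 - p.2)^2), ?_⟩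
  unfold ori at h
  have hD' := hD.ne'
  ext
  · simp only [Prod.fst_add, Prod.smul_fst, smul_eq_mul]
    field_simp
    linear_combination (-(q.2 - p.2)) * h
  · simp only [Prod.snd_add, Prod.smul_snd, smul_eq_mul]
    field_simp
    linear_combination ((q.1 - p.1)) * h

lemma GenPos.ori_ne {S : Finset Pt} (hS : GenPos S) {p q r : Pt} (hp : p ∈ S) (hq : q ∈ S)
    (hr : r ∈ S) (hpq : p ≠ q) (hpr : p ≠ r) (hqr : q ≠ r) : ori p q r ≠ 0 := by
  intro h
  apply hS p hp q hq r hr hpq hpr hqr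
  rw [collinear_iff_of_mem (p₀ := p) (by simp)]
  obtain ⟨t, ht⟩ := ori_eq_zero_param hpq h
  refine ⟨q - p, ?_⟩
  intro x hx
  simp only [Set.mem_insert_iff, Set.mem_singleton_iff] at hx
  rcases hx with rfl | rfl | rfl
  · exact ⟨0, by simp⟩
  · exact ⟨1, by simp⟩
  · refine ⟨t, ?_⟩
    rw [ht]; ext <;> simp <;> ring

lemma convex3 {C : Set Pt} (hC : Convex ℝ C) {a b c : Pt} (ha : a ∈ C) (hb : b ∈ C) (hc : c ∈ C)
    {u v w : ℝ} (hu : 0 ≤ u) (hv : 0 ≤ v) (hw : 0 ≤ w) (h : u + v + w = 1) :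
    u • a + v • b + w • c ∈ C := by
  have := hC.sum_mem (t := Finset.univ) (w := ![u, v, w]) (z := ![a, b, c])
    (by intro i _; fin_cases i <;> simpa)
    (by simpa [Fin.sum_univ_three] using h)
    (by intro i _; fin_cases i <;> simpa)
  simpa [Fin.sum_univ_three] using this

lemma mem_tri {C : Set Pt} (hC : Convex ℝ C) {a b c x : Pt} (ha : a ∈ C) (hb : b ∈ C) (hc : c ∈ C)
    (hD : 0 < ori a b c) (h1 : 0 ≤ ori a b x) (h2 : 0 ≤ ori b c x) (h3 : 0 ≤ ori c a x) :
    x ∈ C := by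
  have key := convex3 hC ha hb hc (u := ori b c x / ori a b c) (v := ori c a x / ori a b c)
    (w := ori a b x / ori a b c) (by positivity) (by positivity) (by positivity)
    (by rw [← add_div, ← add_div]; rw [div_eq_one_iff_eq hD.ne']; linarith [ori_sum a b c x])
  convert key
  have hD' := hD.ne'
  ext
  · simp only [Prod.fst_add, Prod.smul_fst, smul_eq_mul]
    field_simp
    unfold ori; ring
  · simp only [Prod.snd_add, Prod.smul_snd, smul_eq_mul]
    field_simp
    unfold ori; ring

lemma tri_interior {C : Set Pt} (hC : Convex ℝ C) {a b c x : Pt} (ha : a ∈ C) (hb : b ∈ C)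
    (hc : c ∈ C) (h1 : 0 < ori a b x) (h2 : 0 < ori b c x) (h3 : 0 < ori c a x) :
    x ∈ interior C := by
  have hD : 0 < ori a b c := by linarith [ori_sum a b c x]
  rw [mem_interior]
  refine ⟨{y | 0 < ori a b y} ∩ {y | 0 < ori b c y} ∩ {y | 0 < ori c a y}, ?_, ?_, ⟨⟨h1, h2⟩, h3⟩⟩
  · rintro y ⟨⟨k1, k2⟩, k3⟩
    exact mem_tri hC ha hb hc hD (le_of_lt k1) (le_of_lt k2) (le_of_lt k3)
  · exact ((isOpen_lt continuous_const (cont_ori _ _)).inter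
      (isOpen_lt continuous_const (cont_ori _ _))).inter (isOpen_lt continuous_const (cont_ori _ _))

lemma diag_interior {C : Set Pt} (hC : Convex ℝ C) {p q r s : Pt} (hp : p ∈ C) (hq : q ∈ C)
    (hr : r ∈ C) (hs : s ∈ C) (h1 : 0 < ori p q r) (h2 : ori p q s < 0) :
    openSegment ℝ p q ⊆ interior C := by
  rintro x ⟨a, b, ha, hb, hab, rfl⟩
  rw [mem_interior]
  refine ⟨({y | 0 < ori q r y} ∩ {y | 0 < ori r p y}) ∩ ({y | 0 < ori p s y} ∩ {y | 0 < ori s q y}),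
    ?_, ?_, ⟨⟨?_, ?_⟩, ⟨?_, ?_⟩⟩⟩
  · rintro y ⟨⟨k1, k2⟩, ⟨k3, k4⟩⟩
    simp only [Set.mem_ofPred_eq] at k1 k2 k3 k4
    by_cases hy : 0 ≤ ori p q y
    · exact mem_tri hC hp hq hr h1 hy k1.le k2.le
    · refine mem_tri hC hq hp hs (a := q) (b := p) (c := s) ?_ ?_ k3.le k4.le
      · rw [ori_swap]; linarith
      · rw [ori_swap]; linarith
  · exact ((isOpen_lt continuous_const (cont_ori _ _)).inter
      (isOpen_lt continuous_const (cont_ori _ _))).inter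
      ((isOpen_lt continuous_const (cont_ori _ _)).inter (isOpen_lt continuous_const (cont_ori _ _)))
  all_goals simp only [Set.mem_ofPred_eq]
  · rw [ori_comb _ _ _ _ _ _ hab, ori_left, ori_cyc]; nlinarith
  · rw [ori_comb _ _ _ _ _ _ hab, ori_right, ori_cyc2]; nlinarith
  · rw [ori_comb _ _ _ _ _ _ hab, ori_left, ori_swap2]; nlinarith
  · rw [ori_comb _ _ _ _ _ _ hab, ori_right, ← ori_cyc, ori_swap]; nlinarith

@[simp] lemma seg2_mk (p q : Pt) : seg2 s(p, q) = segment ℝ p q := rfl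

lemma seg_ori {p q x a b : Pt} (hx : x ∈ segment ℝ p q) (hp : 0 ≤ ori a b p) (hq : 0 ≤ ori a b q) :
    0 ≤ ori a b x := by
  obtain ⟨s, t, hs, ht, hst, rfl⟩ := hx
  rw [ori_comb _ _ _ _ _ _ hst]; positivity

lemma seg_line {p q x : Pt} (hx : x ∈ segment ℝ p q) : ori p q x = 0 := by
  obtain ⟨s, t, hs, ht, hst, rfl⟩ := hx
  rw [ori_comb _ _ _ _ _ _ hst]; simp

/-- A point of `S` on a segment spanned by `S` is an endpoint. -/
lemma GenPos.mem_seg {S : Finset Pt} (hS : GenPos S) {p q r : Pt} (hp : p ∈ S) (hq : q ∈ S)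
    (hr : r ∈ S) (hpq : p ≠ q) (h : r ∈ segment ℝ p q) : r = p ∨ r = q := by
  by_contra hc
  push Not at hc
  exact hS.ori_ne hp hq hr hpq hc.1.symm hc.2.symm (seg_line h)

/-- First exit from a triangle given by three half planes. -/
lemma exit_lemma {ι : Type} [Fintype ι] (A B : ι → Pt) {y c : Pt} (hy : ∀ i, 0 ≤ ori (A i) (B i) y)
    (hc : ∃ i, ori (A i) (B i) c < 0) :
    ∃ z ∈ segment ℝ y c, (∀ i, 0 ≤ ori (A i) (B i) z) ∧ z ≠ c ∧
      ∃ i, ori (A i) (B i) z = 0 ∧ ori (A i) (B i) c < 0 := by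
  let f : ι → ℝ := fun i => ori (A i) (B i) y / (ori (A i) (B i) y - ori (A i) (B i) c)
  obtain ⟨i, hi, hmin⟩ := Finset.exists_min_image
    (Finset.univ.filter (fun i => ori (A i) (B i) c < 0)) f
    (by obtain ⟨i, hi⟩ := hc; exact ⟨i, by simpa using hi⟩)
  simp only [Finset.mem_filter, Finset.mem_univ, true_and] at hi hmin
  have hd : 0 < ori (A i) (B i) y - ori (A i) (B i) c := by linarith [hy i]
  have h0 : 0 ≤ f i := div_nonneg (hy i) hd.le
  have h1 : f i < 1 := by rw [div_lt_one hd]; linarith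
  have hs : (1 - f i) + f i = 1 := by ring
  refine ⟨(1 - f i) • y + f i • c, ⟨1 - f i, f i, by linarith, h0, hs, rfl⟩, ?_, ?_, i, ?_, hi⟩
  · intro j
    rw [ori_comb _ _ _ _ _ _ hs]
    by_cases hj : ori (A j) (B j) c < 0
    · have := hmin j hj
      have hdj : 0 < ori (A j) (B j) y - ori (A j) (B j) c := by linarith [hy j]
      have h2 : f i * (ori (A j) (B j) y - ori (A j) (B j) c) ≤ ori (A j) (B j) y := by
        rw [← le_div_iff₀ hdj]; exact this
      linarith
    · have := hy j
      push Not at hj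
      have : 0 ≤ 1 - f i := by linarith
      positivity
  · intro h
    have : ori (A i) (B i) ((1 - f i) • y + f i • c) = ori (A i) (B i) c := by rw [h]
    rw [ori_comb _ _ _ _ _ _ hs] at this
    have : (1 - f i) * (ori (A i) (B i) y - ori (A i) (B i) c) = 0 := by linarith
    have : 0 < (1 - f i) * (ori (A i) (B i) y - ori (A i) (B i) c) := mul_pos (by linarith) hd
    linarith
  · rw [ori_comb _ _ _ _ _ _ hs]
    have : f i * (ori (A i) (B i) y - ori (A i) (B i) c) = ori (A i) (B i) y :=
      div_mul_cancel₀ _ hd.ne'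
    linarith

/-- In a (ccw) triangle, boundary points lie on the corresponding side. -/
lemma tri_side {a b c x : Pt} (hD : 0 < ori a b c) (h1 : ori a b x = 0) (h2 : 0 ≤ ori b c x)
    (h3 : 0 ≤ ori c a x) : x ∈ segment ℝ a b := by
  have hs := ori_sum a b c x
  refine ⟨ori b c x / ori a b c, ori c a x / ori a b c, by positivity, by positivity, ?_, ?_⟩
  · rw [← add_div, div_eq_one_iff_eq hD.ne']; linarith
  · have hD' := hD.ne'
    have e1 : (ori a b c) * x.1 = ori b c x * a.1 + ori c a x * b.1 + ori a b x * c.1 := by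
      unfold ori; ring
    have e2 : (ori a b c) * x.2 = ori b c x * a.2 + ori c a x * b.2 + ori a b x * c.2 := by
      unfold ori; ring
    rw [h1] at e1 e2
    ext
    · simp only [Prod.fst_add, Prod.smul_fst, smul_eq_mul]
      field_simp; linarith
    · simp only [Prod.snd_add, Prod.smul_snd, smul_eq_mul]
      field_simp; linarith

/-- No edge of `T` meets the open segment `x y`. -/
def FreeSeg {S : Finset Pt} (T : PlaneGraph S) (x y : Pt) : Prop :=
  ∀ g ∈ T.edges, ∀ z ∈ openSegment ℝ x y, z ∉ seg2 g

lemma open_of_seg {p q x : Pt} (h : x ∈ segment ℝ p q) (h1 : x ≠ p) (h2 : x ≠ q) :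
    x ∈ openSegment ℝ p q := mem_openSegment_of_ne_left_right h1.symm h2.symm h

lemma add_edge {S : Finset Pt} (hS : GenPos S) {T : PlaneGraph S} (hT : IsTriangulation T)
    {p q : Pt} (hp : p ∈ S) (hq : q ∈ S) (hpq : p ≠ q)
    (h : ∀ g ∈ T.edges, g ≠ s(p, q) → ∀ z ∈ openSegment ℝ p q, z ∉ seg2 g) :
    s(p, q) ∈ T.edges := by
  have key : ∀ e ∈ T.edges, e ≠ s(p, q) → ∀ x ∈ seg2 e ∩ segment ℝ p q, x ∈ e ∧ x ∈ s(p, q) := by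
    intro e he hne x hx
    have hxpq : x = p ∨ x = q := by
      by_contra hc
      push Not at hc
      exact h e he hne x (open_of_seg hx.2 hc.1 hc.2) hx.1
    have hxS : x ∈ S := by rcases hxpq with rfl | rfl <;> assumption
    refine ⟨?_, by simpa using hxpq⟩
    induction e using Sym2.ind with
    | _ a b =>
      have hd : a ≠ b := by simpa using T.not_isDiag _ he
      have := hS.mem_seg (T.endpoint_mem _ he a (by simp)) (T.endpoint_mem _ he b (by simp)) hxS hd hx.1
      simpa using this
  let G : PlaneGraph S :=
    { edges := insert s(p, q) T.edges
      endpoint_mem := by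
        intro e he r hr
        rcases Finset.mem_insert.1 he with rfl | he
        · rcases Sym2.mem_iff.1 hr with rfl | rfl <;> assumption
        · exact T.endpoint_mem e he r hr
      not_isDiag := by
        intro e he
        rcases Finset.mem_insert.1 he with rfl | he
        · simpa using hpq
        · exact T.not_isDiag e he
      noncrossing := by
        intro e₁ h1 e₂ h2 hne x hx
        rcases Finset.mem_insert.1 h1 with rfl | h1 <;> rcases Finset.mem_insert.1 h2 with rfl | h2
        · exact absurd rfl hne
        · exact (key e₂ h2 hne.symm x ⟨hx.2, hx.1⟩).symm
        · exact key e₁ h1 hne x hx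
        · exact T.noncrossing e₁ h1 e₂ h2 hne x hx }
  have := hT G (Finset.subset_insert _ _)
  rw [← this]
  exact Finset.mem_insert_self _ _

lemma seg2_compact (e : Sym2 Pt) : IsCompact (seg2 e) := by
  induction e using Sym2.ind with
  | _ a b =>
    rw [seg2_mk, ← convexHull_pair]
    exact (Set.toFinite _).isCompact_convexHull ℝ

lemma seg2_convex (e : Sym2 Pt) : Convex ℝ (seg2 e) := by
  induction e using Sym2.ind with
  | _ a b => exact convex_segment a b

lemma open_ori_pos {A B x u z : Pt} (hx : ori A B x = 0) (hu : 0 < ori A B u)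
    (hz : z ∈ openSegment ℝ x u) : 0 < ori A B z ∧ ori A B z < ori A B u := by
  obtain ⟨s, t, hs, ht, hst, rfl⟩ := hz
  rw [ori_comb _ _ _ _ _ _ hst, hx]
  constructor
  · nlinarith
  · nlinarith

lemma first_hit {S : Finset Pt} {T : PlaneGraph S} {A B x u : Pt} (hx0 : ori A B x = 0)
    (hu : 0 < ori A B u)
    (hx : ∀ g ∈ T.edges, x ∈ seg2 g → ∀ z ∈ seg2 g, ori A B z ≤ 0) :
    FreeSeg T x u ∨ ∃ g ∈ T.edges, ∃ y ∈ openSegment ℝ x u, y ∈ seg2 g ∧ FreeSeg T x y := by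
  by_cases hF : FreeSeg T x u
  · exact Or.inl hF
  right
  unfold FreeSeg at hF
  push Not at hF
  obtain ⟨g0, hg0, z0, hz0, hzg0⟩ := hF
  let K : Set Pt := (⋃ g ∈ T.edges.filter (fun g => x ∉ seg2 g), seg2 g) ∩ segment ℝ x u
  have hK : IsCompact K := by
    apply IsCompact.inter
    · exact (T.edges.filter (fun g => x ∉ seg2 g)).isCompact_biUnion (fun g _ => seg2_compact g)
    · exact seg2_compact s(x, u)
  have mK : ∀ g ∈ T.edges, ∀ z ∈ openSegment ℝ x u, z ∈ seg2 g → z ∈ K := by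
    intro g hg z hz hzg
    refine ⟨?_, openSegment_subset_segment _ _ _ hz⟩
    simp only [Set.mem_iUnion]
    refine ⟨g, Finset.mem_filter.2 ⟨hg, fun hxg => ?_⟩, hzg⟩
    have := hx g hg hxg z hzg
    linarith [(open_ori_pos hx0 hu hz).1]
  obtain ⟨y, hyK, hmin⟩ := hK.exists_isMinOn ⟨z0, mK g0 hg0 z0 hz0 hzg0⟩ (cont_ori A B).continuousOn
  obtain ⟨hy1, hy2⟩ := hyK
  simp only [Set.mem_iUnion] at hy1
  obtain ⟨g, hg, hyg⟩ := hy1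
  obtain ⟨hgT, hxg⟩ := Finset.mem_filter.1 hg
  have hyx : y ≠ x := by rintro rfl; exact hxg hyg
  have hyu : y ≠ u := by
    rintro rfl
    have h1 := hmin (mK g0 hg0 z0 hz0 hzg0)
    have h2 := (open_ori_pos hx0 hu hz0).2
    simp only [Set.mem_ofPred_eq] at h1
    linarith
  have hyo := open_of_seg hy2 hyx hyu
  refine ⟨g, hgT, y, hyo, hyg, ?_⟩
  intro g' hg' z hz hzg'
  have hyp := (open_ori_pos hx0 hu hyo).1
  have hz' : z ∈ openSegment ℝ x u := by
    obtain ⟨s, t, hs, ht, hst, rfl⟩ := hyo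
    obtain ⟨s', t', hs', ht', hst', rfl⟩ := hz
    refine ⟨s' + t' * s, t' * t, by positivity, by positivity, ?_, ?_⟩
    · nlinarith
    · rw [smul_add, add_smul, smul_smul, smul_smul]; abel
  have h1 := hmin (mK g' hg' z hz' hzg')
  simp only [Set.mem_ofPred_eq] at h1
  have := (open_ori_pos hx0 hyp hz).2
  linarith

lemma tri_exit_aux {a b v y c : Pt} (hD : 0 < ori a b v) (hy : y ∈ convexHull ℝ {a, b, v})
    (hc : 0 < ori a b c) (hc' : c ∉ convexHull ℝ {a, b, v}) :
    ∃ m ∈ segment ℝ y c, m ≠ c ∧ m ∈ convexHull ℝ {a, b, v} ∧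
      (m ∈ segment ℝ a v ∨ m ∈ segment ℝ b v) := by
  have ha : a ∈ convexHull ℝ ({a, b, v} : Set Pt) := subset_convexHull _ _ (by simp)
  have hb : b ∈ convexHull ℝ ({a, b, v} : Set Pt) := subset_convexHull _ _ (by simp)
  have hv : v ∈ convexHull ℝ ({a, b, v} : Set Pt) := subset_convexHull _ _ (by simp)
  have h2 : ori b v a = ori a b v := ori_cyc _ _ _
  have h3 : ori v a b = ori a b v := ori_cyc2 _ _ _
  obtain ⟨m, hm, hall, hmc, i, hi0, hic⟩ := exit_lemma (ι := Fin 3) ![a, b, v] ![b, v, a] (y := y) (c := c)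
    (by
      intro i
      refine hull_ori ?_ hy
      intro r hr
      simp only [Set.mem_insert_iff, Set.mem_singleton_iff] at hr
      fin_cases i <;> rcases hr with rfl | rfl | rfl <;> simp [h2, h3, hD.le])
    (by
      by_contra hcon
      push Not at hcon
      exact hc' (mem_tri (convex_convexHull ℝ _) ha hb hv hD (hcon 0) (hcon 1) (hcon 2)))
  have k0 := hall 0
  have k1 := hall 1
  have k2 := hall 2
  simp at k0 k1 k2
  refine ⟨m, hm, hmc, mem_tri (convex_convexHull ℝ _) ha hb hv hD k0 k1 k2, ?_⟩
  fin_cases i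
  · simp at hi0 hic; linarith
  · simp at hi0 hic
    right
    exact tri_side (by rw [h2]; exact hD) hi0 k2 k0
  · simp at hi0 hic
    left
    rw [segment_symm]
    exact tri_side (by rw [h3]; exact hD) hi0 k0 k1

lemma tri_exit {a b v y c : Pt} (hy : y ∈ convexHull ℝ {a, b, v})
    (hc : 0 < ori a b c * ori a b v) (hc' : c ∉ convexHull ℝ {a, b, v}) :
    ∃ m ∈ segment ℝ y c, m ≠ c ∧ m ∈ convexHull ℝ {a, b, v} ∧
      (m ∈ segment ℝ a v ∨ m ∈ segment ℝ b v) := by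
  rcases lt_trichotomy (ori a b v) 0 with h | h | h
  · have e : ({a, b, v} : Set Pt) = {b, a, v} := Set.insert_comm _ _ _
    rw [e] at hy hc' ⊢
    obtain ⟨m, h1, h2, h3, h4⟩ := tri_exit_aux (a := b) (b := a) (v := v) (by rw [ori_swap]; linarith) hy
      (by rw [ori_swap]; nlinarith) hc'
    exact ⟨m, h1, h2, h3, h4.symm⟩
  · rw [h] at hc; simp at hc
  · exact tri_exit_aux h hy (by nlinarith) hc'

lemma hull_pos {A B x y e z : Pt} (hx : ori A B x = 0) (hy : 0 < ori A B y) (he : 0 < ori A B e)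
    (hz : z ∈ convexHull ℝ {x, y, e}) : 0 < ori A B z ∨ z = x := by
  have hconv : Convex ℝ {z : Pt | 0 < ori A B z ∨ z = x} := by
    rintro p (hp | rfl) q (hq | rfl) s t hs ht hst
    · left; rw [ori_comb _ _ _ _ _ _ hst]
      rcases hs.eq_or_lt with rfl | hs
      · have : t = 1 := by linarith
        subst this; linarith
      · nlinarith [mul_pos hs hp, mul_nonneg ht hq.le]
    · rcases hs.eq_or_lt with rfl | hs
      · have : t = 1 := by linarith
        subst this; right; simp
      · left; rw [ori_comb _ _ _ _ _ _ hst, hx]; nlinarith [mul_pos hs hp]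
    · rcases ht.eq_or_lt with rfl | ht
      · have : s = 1 := by linarith
        subst this; right; simp
      · left; rw [ori_comb _ _ _ _ _ _ hst, hx]; nlinarith [mul_pos ht hq]
    · right; rw [← add_smul, hst, one_smul]
  refine convexHull_min ?_ hconv hz
  rintro r (rfl | rfl | rfl)
  · right; rfl
  · left; exact hy
  · left; exact he

lemma visible_aux {S : Finset Pt} {T : PlaneGraph S} {A B x : Pt} (hx0 : ori A B x = 0)
    (hx : ∀ g ∈ T.edges, x ∈ seg2 g → ∀ z ∈ seg2 g, ori A B z ≤ 0)
    (hgen : ∀ a ∈ S, ∀ b ∈ S, a ≠ b → b ≠ x → 0 < ori A B a → ori a b x ≠ 0) (n : ℕ) :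
    ∀ y e : Pt, ∀ g₀ ∈ T.edges, (S.filter (fun s => s ∈ convexHull ℝ ({x, y, e} : Set Pt))).card ≤ n →
      y ∈ seg2 g₀ → e ∈ g₀ → FreeSeg T x y → 0 < ori A B y → 0 < ori A B e →
      ∃ w ∈ S, w ∈ convexHull ℝ ({x, y, e} : Set Pt) ∧ 0 < ori A B w ∧ FreeSeg T x w := by
  induction n with
  | zero =>
    intro y e g₀ hg₀ hcard hy he hfree hyp hep
    exfalso
    have : e ∈ S.filter (fun s => s ∈ convexHull ℝ ({x, y, e} : Set Pt)) :=
      Finset.mem_filter.2 ⟨T.endpoint_mem g₀ hg₀ e he, subset_convexHull _ _ (by simp)⟩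
    have := Finset.card_pos.2 ⟨e, this⟩
    omega
  | succ n ih =>
    intro y e g₀ hg₀ hcard hy he hfree hyp hep
    have heS := T.endpoint_mem g₀ hg₀ e he
    rcases first_hit hx0 hep hx with hF | ⟨g, hg, z, hz, hzg, hzF⟩
    · exact ⟨e, heS, subset_convexHull _ _ (by simp), hep, hF⟩
    by_cases hye : y = e
    · subst hye; exact ⟨y, heS, subset_convexHull _ _ (by simp), hep, hfree⟩
    have hzp := (open_ori_pos hx0 hep hz).1
    have hxg : x ∉ seg2 g := fun h => by linarith [hx g hg h z hzg]
    have hze : z ≠ e := by rintro rfl; linarith [(open_ori_pos hx0 hep hz).2]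
    have hez : ori x e z = 0 := seg_line (openSegment_subset_segment _ _ _ hz)
    -- y is off the line x e
    have hyoff : ori x e y ≠ 0 := by
      obtain ⟨e', rfl⟩ := Sym2.mem_iff_exists.1 he
      have hd : e ≠ e' := by simpa using T.not_isDiag _ hg₀
      have he'x : e' ≠ x := by
        rintro rfl
        have := hx _ hg₀ (right_mem_segment _ _ _) e (left_mem_segment _ _ _)
        linarith
      have h1 := hgen e heS e' (T.endpoint_mem _ hg₀ e' (by simp)) hd he'x hep
      rw [← ori_cyc2] at h1
      obtain ⟨s, t, hs, ht, hst, rfl⟩ := hy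
      rw [ori_comb _ _ _ _ _ _ hst, ori_right]
      have : t ≠ 0 := by
        rintro rfl
        have : s = 1 := by linarith
        subst this; simp at hye
      intro h0
      have : t * ori x e e' = 0 := by linarith
      rcases mul_eq_zero.1 this with h | h
      · contradiction
      · exact h1 (by rw [ori_cyc2] ; rw [← ori_cyc2]; rw [← ori_cyc] ; rw [← ori_cyc2]; exact h)
    -- endpoints of g are off the line x e
    have hoff : ∀ c d : Pt, g = s(c, d) → ori x e c ≠ 0 := by
      rintro c d rfl h0
      have hcS := T.endpoint_mem _ hg c (by simp)
      have hdS := T.endpoint_mem _ hg d (by simp)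
      have hcd : c ≠ d := by simpa using T.not_isDiag _ hg
      have hcx : c ≠ x := by rintro rfl; exact hxg (left_mem_segment _ _ _)
      have hdx : d ≠ x := by rintro rfl; exact hxg (right_mem_segment _ _ _)
      by_cases hce : c = e
      · subst hce
        obtain ⟨s, t, hs, ht, hst, rfl⟩ := hzg
        rw [ori_comb _ _ _ _ _ _ hst, ori_right] at hez
        have : t ≠ 0 := by
          rintro rfl
          have : s = 1 := by linarith
          subst this; simp at hze
        have h2 : ori x c d = 0 := by
          have : t * ori x c d = 0 := by linarith
          exact (mul_eq_zero.1 this).resolve_left (by assumption)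
        exact hgen c hcS d hdS hcd hdx hep (by rw [ori_cyc]; exact h2)
      · exact hgen e heS c hcS (Ne.symm hce) hcx hep (by rw [ori_cyc]; exact h0)
    obtain ⟨c, d, hgcd, hcy, hdy⟩ : ∃ c d : Pt, g = s(c, d) ∧ 0 < ori x e c * ori x e y ∧
        ori x e d * ori x e y < 0 := by
      induction g using Sym2.ind with
      | _ c d =>
        have h1 := hoff c d rfl
        have h2 := hoff d c Sym2.eq_swap
        obtain ⟨s, t, hs, ht, hst, rfl⟩ := hzg
        rw [ori_comb _ _ _ _ _ _ hst] at hez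
        have hs' : 0 < s := by
          rcases hs.eq_or_lt with rfl | hs
          · have : t = 1 := by linarith
            subst this; simp at hez; exact absurd hez h2
          · exact hs
        have ht' : 0 < t := by
          rcases ht.eq_or_lt with rfl | ht
          · have : s = 1 := by linarith
            subst this; simp at hez; exact absurd hez h1
          · exact ht
        have h3 : s * (ori x e c * ori x e y) + t * (ori x e d * ori x e y) = 0 := by
          linear_combination (ori x e y) * hez
        rcases lt_or_gt_of_ne (mul_ne_zero h1 hyoff) with h | h
        · refine ⟨d, c, Sym2.eq_swap, ?_, h⟩
          by_contra hcon
          push Not at hcon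
          nlinarith [mul_neg_of_pos_of_neg hs' h]
        · refine ⟨c, d, rfl, h, ?_⟩
          by_contra hcon
          push Not at hcon
          nlinarith [mul_pos hs' h]
    subst hgcd
    have hcS := T.endpoint_mem _ hg c (by simp)
    have hcx : c ≠ x := by rintro rfl; exact hxg (left_mem_segment _ _ _)
    have hset : ({x, e, y} : Set Pt) = {x, y, e} := by rw [Set.pair_comm]
    have hsub : segment ℝ x e ⊆ convexHull ℝ ({x, e, y} : Set Pt) :=
      (convex_convexHull ℝ _).segment_subset (subset_convexHull _ _ (by simp)) (subset_convexHull _ _ (by simp))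
    have hzhull : z ∈ convexHull ℝ ({x, e, y} : Set Pt) := hsub (openSegment_subset_segment _ _ _ hz)
    have hgg : s(c, d) ≠ g₀ := by
      rintro rfl
      rcases Sym2.mem_iff.1 he with rfl | rfl
      · simp at hcy
      · simp at hdy
    have hchull : c ∈ convexHull ℝ ({x, e, y} : Set Pt) := by
      by_contra hcon
      obtain ⟨m, hm1, hmc, -, hm3⟩ := tri_exit hzhull hcy hcon
      have hmg : m ∈ seg2 s(c, d) := (seg2_convex _).segment_subset hzg (left_mem_segment _ _ _) hm1
      have hmd : m ≠ d := by
        rintro rfl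
        obtain ⟨s, t, hs, ht, hst, rfl⟩ := hm1
        rw [ori_comb _ _ _ _ _ _ hst, hez] at hdy
        nlinarith
      have hmy : m ∈ seg2 g₀ → False := by
        intro hm
        have := (T.noncrossing _ hg _ hg₀ hgg m ⟨hmg, hm⟩).1
        rcases Sym2.mem_iff.1 this with h | h
        · exact hmc h
        · exact hmd h
      have heg : e ∈ seg2 g₀ := by
        obtain ⟨e', rfl⟩ := Sym2.mem_iff_exists.1 he
        exact left_mem_segment _ _ _
      rcases hm3 with h | h
      · by_cases h1 : m = x
        · subst h1; exact hxg hmg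
        by_cases h2 : m = y
        · subst h2; exact hmy hy
        exact hfree _ hg m (open_of_seg h h1 h2) hmg
      · exact hmy ((seg2_convex _).segment_subset heg hy h)
    have hcp : 0 < ori A B c := by
      rw [hset] at hchull
      exact (hull_pos hx0 hyp hep hchull).resolve_right hcx
    have hsub2 : convexHull ℝ ({x, z, c} : Set Pt) ⊆ convexHull ℝ ({x, y, e} : Set Pt) := by
      rw [← hset]
      refine convexHull_min ?_ (convex_convexHull ℝ _)
      rintro r (rfl | rfl | rfl)
      · exact subset_convexHull _ _ (by simp)
      · exact hzhull
      · exact hchull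
    have henot : e ∉ convexHull ℝ ({x, z, c} : Set Pt) := by
      intro hecon
      obtain ⟨s, t, hs, ht, hst, hzz⟩ := hz
      have h1 : ori z c x = t * ori x e c := by
        rw [← hzz]
        have : s = 1 - t := by linarith
        subst this
        simp only [ori, Prod.fst_add, Prod.snd_add, Prod.smul_fst, Prod.smul_snd, smul_eq_mul]; ring
      have h2 : ori z c e = - (s * ori x e c) := by
        rw [← hzz]
        have : s = 1 - t := by linarith
        subst this
        simp only [ori, Prod.fst_add, Prod.snd_add, Prod.smul_fst, Prod.smul_snd, smul_eq_mul]; ring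
      rcases lt_or_gt_of_ne (hoff c d rfl) with h | h
      · have := hull_ori (p := c) (q := z) (Q := {x, z, c}) (by
          rintro r (rfl | rfl | rfl)
          · rw [ori_swap, h1]; nlinarith
          · simp
          · simp) hecon
        rw [ori_swap, h2] at this
        nlinarith
      · have := hull_ori (p := z) (q := c) (Q := {x, z, c}) (by
          rintro r (rfl | rfl | rfl)
          · rw [h1]; nlinarith
          · simp
          · simp) hecon
        rw [h2] at this
        nlinarith
    have hcard' : (S.filter (fun s => s ∈ convexHull ℝ ({x, z, c} : Set Pt))).card ≤ n := by
      have : (S.filter (fun s => s ∈ convexHull ℝ ({x, z, c} : Set Pt))) ⊂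
          (S.filter (fun s => s ∈ convexHull ℝ ({x, y, e} : Set Pt))) := by
        rw [Finset.ssubset_iff_of_subset]
        · exact ⟨e, Finset.mem_filter.2 ⟨heS, subset_convexHull _ _ (by simp)⟩,
            fun h => henot (Finset.mem_filter.1 h).2⟩
        · intro r hr
          obtain ⟨h1, h2⟩ := Finset.mem_filter.1 hr
          exact Finset.mem_filter.2 ⟨h1, hsub2 h2⟩
      have := Finset.card_lt_card this
      omega
    obtain ⟨w, hw, hwh, hwp, hwF⟩ := ih z c s(c, d) hg hcard' hzg (by simp) hzF hzp hcp
    exact ⟨w, hw, hsub2 hwh, hwp, hwF⟩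

/-- Something is visible from `x` in the open half plane. -/
lemma visible_exists {S : Finset Pt} {T : PlaneGraph S} {A B x u : Pt} (hx0 : ori A B x = 0)
    (hx : ∀ g ∈ T.edges, x ∈ seg2 g → ∀ z ∈ seg2 g, ori A B z ≤ 0)
    (hgen : ∀ a ∈ S, ∀ b ∈ S, a ≠ b → b ≠ x → 0 < ori A B a → ori a b x ≠ 0)
    (hu : u ∈ S) (hup : 0 < ori A B u) : ∃ w ∈ S, 0 < ori A B w ∧ FreeSeg T x w := by
  rcases first_hit hx0 hup hx with hF | ⟨g, hg, y, hy, hyg, hyF⟩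
  · exact ⟨u, hu, hup, hF⟩
  have hyp := (open_ori_pos hx0 hup hy).1
  obtain ⟨e, heg, hep⟩ : ∃ e ∈ g, 0 < ori A B e := by
    induction g using Sym2.ind with
    | _ a b =>
      by_contra hcon
      push Not at hcon
      have h1 := hcon a (by simp)
      have h2 := hcon b (by simp)
      obtain ⟨s, t, hs, ht, hst, rfl⟩ := hyg
      rw [ori_comb _ _ _ _ _ _ hst] at hyp
      nlinarith
  obtain ⟨w, h1, -, h2, h3⟩ := visible_aux hx0 hx hgen _ y e g hg le_rfl hyg heg hyF hyp hep
  exact ⟨w, h1, h2, h3⟩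

lemma convex_ori_mul (a b : Pt) (c : ℝ) : Convex ℝ {z : Pt | 0 < ori a b z * c} := by
  intro p hp q hq s t hs ht hst
  simp only [Set.mem_ofPred_eq] at *
  rw [ori_comb _ _ _ _ _ _ hst]
  rcases hs.eq_or_lt with rfl | hs
  · have : t = 1 := by linarith
    subst this; linarith
  · nlinarith [mul_pos hs hp, mul_nonneg ht hq.le]

lemma convex_ori_mul' (a b : Pt) (c : ℝ) : Convex ℝ {z : Pt | 0 ≤ ori a b z * c} := by
  intro p hp q hq s t hs ht hst
  simp only [Set.mem_ofPred_eq] at *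
  rw [ori_comb _ _ _ _ _ _ hst]
  nlinarith [mul_nonneg hs hp, mul_nonneg ht hq]

lemma sym2_end {P : Pt → Prop} {g : Sym2 Pt} (h : ∀ c d, g = s(c, d) → ¬ P c → P d) :
    ∃ c d, g = s(c, d) ∧ P c := by
  induction g using Sym2.ind with
  | _ c d =>
    by_cases hc : P c
    · exact ⟨c, d, rfl, hc⟩
    · exact ⟨d, c, Sym2.eq_swap, h c d rfl hc⟩

lemma half_apex {S : Finset Pt} (hS : GenPos S) {T : PlaneGraph S} (hT : IsTriangulation T)
    {A B x v v' w : Pt} (hv : v ∈ S) (hvv : v ≠ v') (hedge : s(v, v') ∈ T.edges)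
    (hAv : ori A B v = 0) (hAv' : ori A B v' = 0)
    (hAB : ∀ s ∈ S, ori A B s = 0 → s = v ∨ s = v')
    (hxo : x ∈ openSegment ℝ v v')
    (hx : ∀ g ∈ T.edges, x ∈ seg2 g → ∀ z ∈ seg2 g, ori A B z ≤ 0)
    (hgen : ∀ a ∈ S, ∀ b ∈ S, a ≠ b → 0 < ori A B a → ori a b x ≠ 0)
    (hw : w ∈ S) (hwp : 0 < ori A B w) (hwF : FreeSeg T x w)
    (hmin : ∀ u ∈ S, 0 < ori A B u → FreeSeg T x u → ori A B w ≤ ori A B u) :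
    s(v, w) ∈ T.edges ∧ ∀ s ∈ S, s ∈ convexHull ℝ ({w, v, x} : Set Pt) → 0 < ori A B s → s = w := by
  have hx0 : ori A B x = 0 := by
    obtain ⟨s, t, hs, ht, hst, rfl⟩ := hxo
    rw [ori_comb _ _ _ _ _ _ hst, hAv, hAv']; ring
  have hwv : w ≠ v := by rintro rfl; linarith
  have hψx : ori w v x ≠ 0 := hgen w hw v hv hwv hwp
  have hψxx : 0 < ori w v x * ori w v x := mul_self_pos.2 hψx
  have hv'hull : v' ∉ convexHull ℝ ({w, v, x} : Set Pt) := by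
    intro hcon
    have h1 : 0 ≤ ori w x v' * ori w x v := by
      refine convexHull_min ?_ (convex_ori_mul' w x (ori w x v)) hcon
      rintro r (rfl | rfl | rfl) <;> simp [mul_self_nonneg]
    have h2 : ori w x v ≠ 0 := by rw [ori_swap2]; simpa using hψx
    have h3 : ori w x x = 0 := ori_right _ _
    have h4 : 0 < ori w x v * ori w x v := mul_self_pos.2 h2
    obtain ⟨s, t, hs, ht, hst, hxx⟩ := hxo
    have h5 : s * ori w x v + t * ori w x v' = 0 := by
      rw [← ori_comb _ _ _ _ _ _ hst, hxx, h3]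
    have h6 : s * (ori w x v * ori w x v) + t * (ori w x v' * ori w x v) = 0 := by
      linear_combination (ori w x v) * h5
    nlinarith [mul_pos hs h4, mul_nonneg ht.le h1]
  have hwh : w ∈ convexHull ℝ ({w, v, x} : Set Pt) := subset_convexHull _ _ (by simp)
  have hvh : v ∈ convexHull ℝ ({w, v, x} : Set Pt) := subset_convexHull _ _ (by simp)
  have hxh : x ∈ convexHull ℝ ({w, v, x} : Set Pt) := subset_convexHull _ _ (by simp)
  have hψh : ∀ z ∈ convexHull ℝ ({w, v, x} : Set Pt), 0 ≤ ori w v z * ori w v x := by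
    intro z hz
    refine convexHull_min ?_ (convex_ori_mul' w v (ori w v x)) hz
    rintro r (rfl | rfl | rfl) <;> simp [mul_self_nonneg]
  have hAh : ∀ z ∈ convexHull ℝ ({w, v, x} : Set Pt), 0 ≤ ori A B z := by
    intro z hz
    refine hull_ori ?_ hz
    rintro r (rfl | rfl | rfl)
    · exact hwp.le
    · exact hAv.ge
    · exact hx0.ge
  have hlow : ∀ z ∈ convexHull ℝ ({w, v, x} : Set Pt), z ≠ w → ori A B z < ori A B w := by
    intro z hz hzw
    have key : ∀ z, ori (w + (B - A)) w z = ori A B w - ori A B z := by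
      intro z
      simp only [ori, Prod.fst_add, Prod.snd_add, Prod.fst_sub, Prod.snd_sub]; ring
    have := hull_pos (A := w + (B - A)) (B := w) (x := w) (y := v) (e := x) (by simp)
      (by rw [key]; linarith) (by rw [key]; linarith) hz
    rcases this with h | h
    · rw [key] at h; linarith
    · exact absurd h hzw
  -- ends inside
  have inner : ∀ e f y, s(e, f) ∈ T.edges → y ∈ seg2 s(e, f) → y ∈ convexHull ℝ ({w, v, x} : Set Pt) →
      0 < ori A B y → 0 < ori w v e * ori w v x → y ≠ w → y ≠ v →
      e ∈ convexHull ℝ ({w, v, x} : Set Pt) ∧ 0 < ori A B e := by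
    intro e f y hg hyg hyh hyp hep hyw hyv
    have heh : e ∈ convexHull ℝ ({w, v, x} : Set Pt) := by
      by_contra hcon
      obtain ⟨m, hm1, hme, hmh, hm3⟩ := tri_exit hyh hep hcon
      have hmg : m ∈ seg2 s(e, f) := (seg2_convex _).segment_subset hyg (left_mem_segment _ _ _) hm1
      have hmz : ori w v m = 0 → m = y := by
        intro h0
        obtain ⟨s, t, hs, ht, hst, rfl⟩ := hm1
        rw [ori_comb _ _ _ _ _ _ hst] at h0
        have := hψh y hyh
        have h1 : s * (ori w v y * ori w v x) + t * (ori w v e * ori w v x) = 0 := by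
          linear_combination (ori w v x) * h0
        have h2 : t = 0 := by
          rcases ht.eq_or_lt with h | h
          · exact h.symm
          · nlinarith [mul_pos h hep, mul_nonneg hs this]
        subst h2
        have : s = 1 := by linarith
        subst this; simp
      have hmw : m ≠ w := by
        rintro rfl; exact hyw (hmz (by simp)).symm
      have hmv : m ≠ v := by
        rintro rfl; exact hyv (hmz (by simp)).symm
      rcases hm3 with h | h
      · by_cases h1 : m = x
        · subst h1; linarith [hx _ hg hmg y hyg]
        · have := open_of_seg h hmw h1
          rw [openSegment_symm] at this
          exact hwF _ hg m this hmg
      · have hmvv : m ∈ seg2 s(v, v') :=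
          (convex_segment v v').segment_subset (left_mem_segment _ _ _) (openSegment_subset_segment _ _ _ hxo) h
        have hne : s(e, f) ≠ s(v, v') := by
          intro heq
          rw [heq] at hyg
          obtain ⟨s, t, hs, ht, hst, rfl⟩ := hyg
          rw [ori_comb _ _ _ _ _ _ hst, hAv, hAv'] at hyp
          simp at hyp
        have := (T.noncrossing _ hg _ hedge hne m ⟨hmg, hmvv⟩).2
        rcases Sym2.mem_iff.1 this with rfl | rfl
        · exact hmv rfl
        · exact hv'hull hmh
    refine ⟨heh, ?_⟩
    rcases (hAh e heh).eq_or_lt with h | h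
    · rcases hAB e (T.endpoint_mem _ hg e (by simp)) h.symm with rfl | rfl
      · simp at hep
      · exact absurd heh hv'hull
    · exact h
  have E : ∀ s ∈ S, s ∈ convexHull ℝ ({w, v, x} : Set Pt) → 0 < ori A B s → s = w := by
    intro s hs hsh hsp
    by_contra hsw
    have hsv : s ≠ v := by rintro rfl; linarith
    have hψs : 0 < ori w v s * ori w v x :=
      lt_of_le_of_ne (hψh s hsh) (mul_ne_zero (hS.ori_ne hw hv hs hwv (Ne.symm hsw) (Ne.symm hsv)) hψx).symm
    rcases first_hit hx0 hsp hx with hF | ⟨g, hg, y, hy, hyg, hyF⟩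
    · linarith [hmin s hs hsp hF, hlow s hsh hsw]
    have hyp := (open_ori_pos hx0 hsp hy).1
    have hyh : y ∈ convexHull ℝ ({w, v, x} : Set Pt) :=
      (convex_convexHull ℝ _).segment_subset hxh hsh (openSegment_subset_segment _ _ _ hy)
    have hψy : 0 < ori w v y * ori w v x :=
      (convex_ori_mul w v (ori w v x)).segment_subset hψxx hψs (openSegment_subset_segment _ _ _ hy)
    obtain ⟨e, f, rfl, hep⟩ : ∃ e f, g = s(e, f) ∧ 0 < ori w v e * ori w v x := by
      apply sym2_end (P := fun e => 0 < ori w v e * ori w v x)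
      rintro c d rfl hc
      obtain ⟨s, t, hs, ht, hst, rfl⟩ := hyg
      rw [ori_comb _ _ _ _ _ _ hst] at hψy
      by_contra hd
      push Not at hc hd
      nlinarith [mul_nonneg hs (neg_nonneg.2 hc), mul_nonneg ht (neg_nonneg.2 hd)]
    have hyw : y ≠ w := by rintro rfl; simp at hψy
    have hyv : y ≠ v := by rintro rfl; simp at hψy
    obtain ⟨heh, hep'⟩ := inner e f y hg hyg hyh hyp hep hyw hyv
    obtain ⟨w', h1, h2, h3, h4⟩ := visible_aux hx0 hx (fun a ha b hb hab _ => hgen a ha b hb hab) _ y e _ hg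
      le_rfl hyg (by simp) hyF hyp hep'
    have hw'h : w' ∈ convexHull ℝ ({w, v, x} : Set Pt) := by
      refine convexHull_min ?_ (convex_convexHull ℝ _) h2
      rintro r (rfl | rfl | rfl)
      · exact hxh
      · exact hyh
      · exact heh
    have hψw' : 0 < ori w v w' * ori w v x := by
      refine convexHull_min ?_ (convex_ori_mul w v (ori w v x)) h2
      rintro r (rfl | rfl | rfl)
      · exact hψxx
      · exact hψy
      · exact hep
    have hw'w : w' ≠ w := by rintro rfl; simp at hψw'
    linarith [hmin w' h1 h3 h4, hlow w' hw'h hw'w]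
  refine ⟨?_, E⟩
  refine add_edge hS hT hv hw (Ne.symm hwv) ?_
  intro g hg hne z hz hzg
  have hzh : z ∈ convexHull ℝ ({w, v, x} : Set Pt) :=
      (convex_convexHull ℝ _).segment_subset hvh hwh (openSegment_subset_segment _ _ _ hz)
  have hzp := (open_ori_pos hAv hwp hz)
  have hz0 : ori w v z = 0 := by
    rw [ori_swap, seg_line (openSegment_subset_segment _ _ _ hz), neg_zero]
  have hzw : z ≠ w := by rintro rfl; linarith
  have hzv : z ≠ v := by rintro rfl; linarith
  have hnz : ∀ c d, g = s(c, d) → ori w v c ≠ 0 := by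
    rintro c d rfl h0
    have hcS := T.endpoint_mem _ hg c (by simp)
    have hdS := T.endpoint_mem _ hg d (by simp)
    have hcd : c ≠ d := by simpa using T.not_isDiag _ hg
    have hin : ∀ u ∈ S, ori w v u = 0 → u = w ∨ u = v := by
      intro u hu hu0
      by_contra hcon
      push Not at hcon
      exact hS.ori_ne hw hv hu hwv (Ne.symm hcon.1) (Ne.symm hcon.2) hu0
    have hc := hin c hcS h0
    have hzc : z ≠ c := by rcases hc with rfl | rfl <;> assumption
    have hd0 : ori w v d = 0 := by
      obtain ⟨s, t, hs, ht, hst, rfl⟩ := hzg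
      rw [ori_comb _ _ _ _ _ _ hst, h0] at hz0
      have : t ≠ 0 := by
        rintro rfl
        have : s = 1 := by linarith
        subst this; simp at hzc
      have h2 : t * ori w v d = 0 := by linarith
      exact (mul_eq_zero.1 h2).resolve_left this
    have hd := hin d hdS hd0
    rcases hc with rfl | rfl <;> rcases hd with rfl | rfl
    · exact hcd rfl
    · exact hne Sym2.eq_swap
    · exact hne rfl
    · exact hcd rfl
  obtain ⟨c, d, rfl, hcp⟩ : ∃ e f, g = s(e, f) ∧ 0 < ori w v e * ori w v x := by
    apply sym2_end (P := fun e => 0 < ori w v e * ori w v x)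
    rintro c d rfl hc
    have h1 := mul_ne_zero (hnz c d rfl) hψx
    have h2 := mul_ne_zero (hnz d c Sym2.eq_swap) hψx
    obtain ⟨s, t, hs, ht, hst, rfl⟩ := hzg
    rw [ori_comb _ _ _ _ _ _ hst] at hz0
    by_contra hd
    push Not at hc hd
    have hc' := lt_of_le_of_ne hc h1
    have hd' := lt_of_le_of_ne hd h2
    have h3 : s * (ori w v c * ori w v x) + t * (ori w v d * ori w v x) = 0 := by
      linear_combination (ori w v x) * hz0
    rcases hs.eq_or_lt with rfl | hs
    · have : t = 1 := by linarith
      subst this; linarith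
    · nlinarith [mul_pos hs (neg_pos.2 hc'), mul_nonneg ht (neg_nonneg.2 hd)]
  obtain ⟨hch, hcp'⟩ := inner c d z hg hzg hzh hzp.1 hcp hzw hzv
  have := E c (T.endpoint_mem _ hg c (by simp)) hch hcp'
  subst this
  simp at hcp

lemma generic_point {S : Finset Pt} (hS : GenPos S) {p q : Pt} (hp : p ∈ S) (hq : q ∈ S) (hpq : p ≠ q) :
    ∃ x ∈ openSegment ℝ p q, ∀ a ∈ S, ∀ b ∈ S, a ≠ b → 0 < ori p q a → ori a b x ≠ 0 := by
  let bad : Finset ℝ := (S ×ˢ S).image (fun ab => ori ab.1 ab.2 p / (ori ab.1 ab.2 p - ori ab.1 ab.2 q))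
  have hinf : (Set.Ioo (0:ℝ) 1 \ (bad : Set ℝ)).Nonempty :=
    ((Set.Ioo_infinite (by norm_num : (0:ℝ) < 1)).sdiff bad.finite_toSet).nonempty
  obtain ⟨t, ⟨ht0, ht1⟩, htb⟩ := hinf
  refine ⟨(1 - t) • p + t • q, ⟨1 - t, t, by linarith, ht0, by ring, rfl⟩, ?_⟩
  intro a ha b hb hab hap h0
  rw [ori_comb _ _ _ _ _ _ (by ring)] at h0
  by_cases hd : ori a b p - ori a b q = 0
  · -- both equal hence both zero
    have h1 : ori a b p = 0 := by linear_combination h0 + t * hd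
    have h2 : ori a b q = 0 := by linarith
    have hap' : a ≠ p := by rintro rfl; simp at hap
    have haq' : a ≠ q := by rintro rfl; simp at hap
    by_cases hbp : b = p
    · subst hbp
      rw [ori_cyc2, ← ori_cyc] at h2
      exact hS.ori_ne ha hb hq hab haq' hpq (by rw [ori_cyc, ← ori_cyc2] at h2; exact h2)
    · exact hS.ori_ne ha hb hp hab hap' hbp h1
  · apply htb
    simp only [bad, Finset.coe_image, Set.mem_image, Finset.mem_coe, Finset.mem_product]
    refine ⟨(a, b), ⟨ha, hb⟩, ?_⟩
    rw [div_eq_iff hd]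
    linear_combination h0

lemma apex {S : Finset Pt} (hS : GenPos S) {T : PlaneGraph S} (hT : IsTriangulation T)
    {p q r₀ : Pt} (he : s(p, q) ∈ T.edges) (hr₀ : r₀ ∈ S) (h0 : 0 < ori p q r₀) :
    ∃ r ∈ S, 0 < ori p q r ∧ s(p, r) ∈ T.edges ∧ s(q, r) ∈ T.edges ∧
      ∀ s ∈ S, s ∈ convexHull ℝ ({p, q, r} : Set Pt) → s = p ∨ s = q ∨ s = r := by
  have hp := T.endpoint_mem _ he p (by simp)
  have hq := T.endpoint_mem _ he q (by simp)
  have hpq : p ≠ q := by simpa using T.not_isDiag _ he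
  obtain ⟨x, hxo, hgen⟩ := generic_point hS hp hq hpq
  have hx0 : ori p q x = 0 := seg_line (openSegment_subset_segment _ _ _ hxo)
  have hx : ∀ g ∈ T.edges, x ∈ seg2 g → ∀ z ∈ seg2 g, ori p q z ≤ 0 := by
    intro g hg hxg z hzg
    induction g using Sym2.ind with
    | _ a b =>
      have hab : a ≠ b := by simpa using T.not_isDiag _ hg
      have haS := T.endpoint_mem _ hg a (by simp)
      have hbS := T.endpoint_mem _ hg b (by simp)
      have h1 : ori p q a ≤ 0 := by
        by_contra hcon
        push Not at hcon
        exact hgen a haS b hbS hab hcon (seg_line hxg)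
      have h2 : ori p q b ≤ 0 := by
        by_contra hcon
        push Not at hcon
        refine hgen b hbS a haS hab.symm hcon ?_
        rw [ori_swap, seg_line hxg, neg_zero]
      have := seg_ori hzg (a := q) (b := p) (by rw [ori_swap]; linarith) (by rw [ori_swap]; linarith)
      rw [ori_swap] at this
      linarith
  have hxnS : ∀ a ∈ S, ∀ b ∈ S, a ≠ b → b ≠ x → 0 < ori p q a → ori a b x ≠ 0 :=
    fun a ha b hb hab _ => hgen a ha b hb hab
  obtain ⟨w₀, hw₀, hw₀p, hw₀F⟩ := visible_exists hx0 hx hxnS hr₀ h0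
  obtain ⟨w, hwm, hwmin⟩ := (S.filter (fun u => 0 < ori p q u ∧ FreeSeg T x u)).exists_min_image (fun u => ori p q u)
    ⟨w₀, Finset.mem_filter.2 ⟨hw₀, hw₀p, hw₀F⟩⟩
  obtain ⟨hw, hwp, hwF⟩ := Finset.mem_filter.1 hwm
  have hmin : ∀ u ∈ S, 0 < ori p q u → FreeSeg T x u → ori p q w ≤ ori p q u :=
    fun u hu h1 h2 => hwmin u (Finset.mem_filter.2 ⟨hu, h1, h2⟩)
  have hAB : ∀ s ∈ S, ori p q s = 0 → s = p ∨ s = q := by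
    intro s hs h
    by_contra hcon
    push Not at hcon
    exact hS.ori_ne hp hq hs hpq (Ne.symm hcon.1) (Ne.symm hcon.2) h
  have hP := half_apex hS hT (A := p) (B := q) hp hpq he (by simp) (by simp) hAB hxo hx hgen hw hwp hwF hmin
  have hQ := half_apex hS hT (A := p) (B := q) (v := q) (v' := p) hq hpq.symm (by rw [Sym2.eq_swap]; exact he)
    (by simp) (by simp) (fun s hs h => (hAB s hs h).symm) (by rw [openSegment_symm]; exact hxo) hx hgen hw hwp hwF hmin
  refine ⟨w, hw, hwp, hP.1, hQ.1, ?_⟩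
  intro s hs hsh
  by_contra hcon
  push Not at hcon
  obtain ⟨hsp, hsq, hsw⟩ := hcon
  have hs0 : 0 ≤ ori p q s := by
    refine hull_ori ?_ hsh
    rintro r (rfl | rfl | rfl)
    · simp
    · simp
    · exact hwp.le
  have hs1 : 0 < ori p q s := lt_of_le_of_ne hs0 (hS.ori_ne hp hq hs hpq (Ne.symm hsp) (Ne.symm hsq)).symm
  have b1 : 0 ≤ ori q w s := by
    refine hull_ori ?_ hsh
    rintro r (rfl | rfl | rfl)
    · rw [ori_cyc]; exact hwp.le
    · simp
    · simp
  have b2 : 0 ≤ ori w p s := by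
    refine hull_ori ?_ hsh
    rintro r (rfl | rfl | rfl)
    · simp
    · rw [ori_cyc2]; exact hwp.le
    · simp
  obtain ⟨σ, τ, hσ, hτ, hστ, hxx⟩ := id hxo
  have c1 : ori w p x = τ * ori p q w := by
    rw [← hxx, ori_comb _ _ _ _ _ _ hστ, ori_right, ori_cyc2]; ring
  have c2 : ori q w x = σ * ori p q w := by
    rw [← hxx, ori_comb _ _ _ _ _ _ hστ, ori_left, ori_cyc]; ring
  have hpx : ori p x s = τ * ori p q s := by
    rw [← hxx]
    have : σ = 1 - τ := by linarith
    subst this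
    simp only [ori, Prod.fst_add, Prod.snd_add, Prod.smul_fst, Prod.smul_snd, smul_eq_mul]; ring
  have hxq : ori x q s = σ * ori p q s := by
    rw [← hxx]
    have : τ = 1 - σ := by linarith
    subst this
    simp only [ori, Prod.fst_add, Prod.snd_add, Prod.smul_fst, Prod.smul_snd, smul_eq_mul]; ring
  rcases le_total 0 (ori x w s) with h | h
  · -- in w p x
    refine hsw (hP.2 s hs ?_ hs1)
    refine mem_tri (a := w) (b := p) (c := x) (convex_convexHull ℝ _) (subset_convexHull _ _ (by simp)) (subset_convexHull _ _ (by simp))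
      (subset_convexHull _ _ (by simp)) (by rw [c1]; positivity) b2 (by rw [hpx]; positivity) h
  · refine hsw (hQ.2 s hs ?_ hs1)
    refine mem_tri (a := q) (b := w) (c := x) (convex_convexHull ℝ _) (subset_convexHull _ _ (by simp)) (subset_convexHull _ _ (by simp))
      (subset_convexHull _ _ (by simp)) (by rw [c2]; positivity) b1 (by rw [ori_swap]; linarith) (by rw [hxq]; positivity)

open Topology Filter

/-- `p q` is a counterclockwise oriented side of `Q`. -/
def IsSide (Q : Finset Pt) (p q : Pt) : Prop :=
  p ∈ Q ∧ q ∈ Q ∧ p ≠ q ∧ ∀ r ∈ Q, r ≠ p → r ≠ q → 0 < ori p q r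

/-- `Q` is the vertex set of a convex polygon. -/
def CPoly (Q : Finset Pt) : Prop := 3 ≤ Q.card ∧ ∀ p ∈ Q, ∃ q, IsSide Q p q

lemma IsSide.succ_unique {Q : Finset Pt} {p q q' : Pt} (h : IsSide Q p q) (h' : IsSide Q p q') : q = q' := by
  by_contra hne
  have h1 := h.2.2.2 q' h'.2.1 h'.2.2.1.symm (Ne.symm hne)
  have h2 := h'.2.2.2 q h.2.1 h.2.2.1.symm hne
  rw [ori_swap2] at h2
  linarith

lemma IsSide.pred_unique {Q : Finset Pt} {p p' q : Pt} (h : IsSide Q p q) (h' : IsSide Q p' q) : p = p' := by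
  by_contra hne
  have h1 := h.2.2.2 p' h'.1 (Ne.symm hne) h'.2.2.1
  have h2 := h'.2.2.2 p h.1 hne h.2.2.1
  rw [ori_cyc2, ori_swap] at h1
  rw [ori_cyc, ori_cyc2] at h2
  have := ori_cyc p p' q
  have := ori_swap p' p q
  have := ori_cyc p' q p
  have := ori_cyc p q p'
  unfold ori at *
  linarith

lemma CPoly.pred {Q : Finset Pt} (h : CPoly Q) {q : Pt} (hq : q ∈ Q) : ∃ p, IsSide Q p q := by
  choose f hf using h.2
  let g : {x // x ∈ Q} → {x // x ∈ Q} := fun x => ⟨f x.1 x.2, (hf x.1 x.2).2.1⟩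
  have hg : Function.Injective g := by
    intro x y hxy
    have h1 := hf x.1 x.2
    have h2 := hf y.1 y.2
    have h3 : f x.1 x.2 = f y.1 y.2 := congrArg Subtype.val hxy
    rw [h3] at h1
    exact Subtype.ext (h1.pred_unique h2)
  obtain ⟨x, hx⟩ := Finite.surjective_of_injective hg ⟨q, hq⟩
  refine ⟨x.1, ?_⟩
  have := hf x.1 x.2
  have h3 : f x.1 x.2 = q := congrArg Subtype.val hx
  rwa [h3] at this

lemma CPoly.third {Q : Finset Pt} (h : CPoly Q) (p q : Pt) : ∃ r ∈ Q, r ≠ p ∧ r ≠ q := by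
  by_contra hcon
  push Not at hcon
  have : Q ⊆ {p, q} := by
    intro r hr
    by_cases h1 : r = p
    · simp [h1]
    · simp [hcon r hr h1]
  have h1 := Finset.card_le_card this
  have h2 := Finset.card_le_two (a := p) (b := q)
  have := h.1
  omega

lemma CPoly.not_both {Q : Finset Pt} (h : CPoly Q) {p q : Pt} (h1 : IsSide Q p q) (h2 : IsSide Q q p) : False := by
  obtain ⟨r, hr, hrp, hrq⟩ := h.third p q
  have := h1.2.2.2 r hr hrp hrq
  have := h2.2.2.2 r hr hrq hrp
  rw [ori_swap] at this
  linarith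

lemma IsSide.nonneg {Q : Finset Pt} {p q r : Pt} (h : IsSide Q p q) (hr : r ∈ Q) : 0 ≤ ori p q r := by
  by_cases h1 : r = p
  · simp [h1]
  by_cases h2 : r = q
  · simp [h2]
  exact (h.2.2.2 r hr h1 h2).le

lemma IsSide.hull {Q : Finset Pt} {p q x : Pt} (h : IsSide Q p q) (hx : x ∈ convexHull ℝ (Q : Set Pt)) :
    0 ≤ ori p q x := hull_ori (fun _ hr => h.nonneg hr) hx

/-- Interior points of a set in a half plane are strictly inside. -/
lemma interior_half {C : Set Pt} {p q x : Pt} (hpq : p ≠ q) (hC : ∀ y ∈ C, 0 ≤ ori p q y) (hx : x ∈ interior C) :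
    0 < ori p q x := by
  have h0 := hC x (interior_subset hx)
  by_contra hcon
  have hx0 : ori p q x = 0 := by linarith
  let d : Pt := (q.2 - p.2, -(q.1 - p.1))
  have hd : ∀ t : ℝ, ori p q (x + t • d) = - t * ((q.2 - p.2) ^ 2 + (q.1 - p.1) ^ 2) := by
    intro t
    have : ori p q (x + t • d) = ori p q x - t * ((q.2 - p.2) ^ 2 + (q.1 - p.1) ^ 2) := by
      simp only [ori, d, Prod.fst_add, Prod.snd_add, Prod.smul_fst, Prod.smul_snd, smul_eq_mul]; ring
    rw [this, hx0]; ring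
  have hpos : 0 < (q.2 - p.2) ^ 2 + (q.1 - p.1) ^ 2 := by
    by_contra hle
    apply hpq
    have h1 : (q.2 - p.2) ^ 2 = 0 := by nlinarith [sq_nonneg (q.2 - p.2), sq_nonneg (q.1 - p.1)]
    have h2 : (q.1 - p.1) ^ 2 = 0 := by nlinarith [sq_nonneg (q.2 - p.2), sq_nonneg (q.1 - p.1)]
    have h1' := pow_eq_zero_iff (two_ne_zero) |>.1 h1
    have h2' := pow_eq_zero_iff (two_ne_zero) |>.1 h2
    exact Prod.ext (by linarith) (by linarith)
  have hcont : Tendsto (fun t : ℝ => x + t • d) (𝓝[>] 0) (𝓝 x) := by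
    have : Continuous (fun t : ℝ => x + t • d) := by fun_prop
    have h := this.tendsto 0
    simp only [zero_smul, add_zero] at h
    exact h.mono_left nhdsWithin_le_nhds
  have hev := hcont.eventually (isOpen_interior.mem_nhds hx)
  obtain ⟨t, ht, ht0⟩ := (hev.and self_mem_nhdsWithin).exists
  have := hC _ (interior_subset ht)
  rw [hd] at this
  have ht0' : 0 < t := ht0
  nlinarith [mul_pos ht0' hpos]

lemma CPoly.not_interior {Q : Finset Pt} (h : CPoly Q) {p : Pt} (hp : p ∈ Q) :
    p ∉ interior (convexHull ℝ (Q : Set Pt)) := by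
  intro hcon
  obtain ⟨q, hq⟩ := h.2 p hp
  have := interior_half hq.2.2.1 (fun y hy => hq.hull hy) hcon
  simp at this

lemma CPoly.convexPos {Q : Finset Pt} (h : CPoly Q) : InConvexPosition Q := by
  intro p hp hcon
  obtain ⟨q, hq⟩ := h.2 p hp
  have hconv : Convex ℝ {x : Pt | 0 < ori p q x ∨ x = q} := by
    have h0 : ori p q q = 0 := ori_right _ _
    rintro a (ha | rfl) b (hb | rfl) s t hs ht hst
    · left
      exact (convex_ori_mul p q 1).segment_subset (x := a) (y := b) (by simpa using ha) (by simpa using hb)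
        ⟨s, t, hs, ht, hst, rfl⟩ |> fun h => by simpa using h
    · rcases hs.eq_or_lt with rfl | hs
      · have : t = 1 := by linarith
        subst this; right; simp
      · left; rw [ori_comb _ _ _ _ _ _ hst, h0]; nlinarith [mul_pos hs ha]
    · rcases ht.eq_or_lt with rfl | ht
      · have : s = 1 := by linarith
        subst this; right; simp
      · left; rw [ori_comb _ _ _ _ _ _ hst, h0]; nlinarith [mul_pos ht hb]
    · right; rw [← add_smul, hst, one_smul]
  have := convexHull_min ?_ hconv hcon
  · rcases this with h1 | h1
    · simp at h1
    · exact hq.2.2.1 h1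
  · intro r hr
    have hr' := Finset.mem_erase.1 (Finset.mem_coe.1 hr)
    by_cases h1 : r = q
    · right; exact h1
    · left; exact hq.2.2.2 r hr'.2 hr'.1 h1

lemma hullEdge_side {S Q : Finset Pt} (hS : GenPos S) (hQ : Q ⊆ S) {p q : Pt} (h : IsHullEdgeOf Q p q) :
    IsSide Q p q ∨ IsSide Q q p := by
  obtain ⟨hp, hq, hpq, hf⟩ := h
  by_contra hcon
  push Not at hcon
  obtain ⟨h1, h2⟩ := hcon
  unfold IsSide at h1 h2
  push Not at h1 h2
  obtain ⟨r, hr, hrp, hrq, hr0⟩ := h1 hp hq hpq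
  obtain ⟨r', hr', hrq', hrp', hr0'⟩ := h2 hq hp hpq.symm
  have k1 := hS.ori_ne (hQ hp) (hQ hq) (hQ hr) hpq (Ne.symm hrp) (Ne.symm hrq)
  have k2 := hS.ori_ne (hQ hp) (hQ hq) (hQ hr') hpq (Ne.symm hrp') (Ne.symm hrq')
  rw [ori_swap] at hr0'
  have hr0'' : 0 < ori p q r' := lt_of_le_of_ne (by linarith) k2.symm
  have sub : ∀ x ∈ Q, x ∈ convexHull ℝ (Q : Set Pt) := fun x hx => subset_convexHull _ _ hx
  have := diag_interior (convex_convexHull ℝ (Q : Set Pt)) (sub p hp) (sub q hq) (sub r' hr') (sub r hr) hr0''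
    (lt_of_le_of_ne hr0 k1)
  have hm : ((1/2 : ℝ) • p + (1/2 : ℝ) • q) ∈ openSegment ℝ p q := ⟨1/2, 1/2, by norm_num, by norm_num, by norm_num, rfl⟩
  exact (hf (openSegment_subset_segment _ _ _ hm)).2 (this hm)

/-- cross product -/
def cr (a b : Pt) : ℝ := a.1 * b.2 - a.2 * b.1

lemma ori_cr (a b c : Pt) : ori a b c = cr (b - a) (c - a) := by
  simp only [ori, cr, Prod.fst_sub, Prod.snd_sub]

/-- direction `d` lies strictly inside the (convex) angle `u v w` (counterclockwise from `u` to `w`). -/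
def InSec (v u w d : Pt) : Prop := 0 < cr (u - v) d ∧ 0 < cr d (w - v) ∧ 0 < cr (u - v) (w - v)

lemma InSec.ev {C : Set Pt} (hC : Convex ℝ C) {v u w d : Pt} (hv : v ∈ C) (hu : u ∈ C) (hw : w ∈ C)
    (h : InSec v u w d) : ∀ᶠ ε : ℝ in 𝓝[>] 0, v + ε • d ∈ interior C := by
  obtain ⟨h1, h2, h3⟩ := h
  have hcont : Continuous (fun t : ℝ => ori u w (v + t • d)) := by
    have : Continuous (fun t : ℝ => v + t • d) := by fun_prop
    exact (cont_ori u w).comp this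
  have hev : ∀ᶠ ε : ℝ in 𝓝[>] 0, 0 < ori u w (v + ε • d) := by
    refine (hcont.tendsto 0 |>.mono_left nhdsWithin_le_nhds).eventually (lt_mem_nhds ?_)
    simp only [zero_smul, add_zero]
    have h4 : ori u w v = cr (u - v) (w - v) := by simp only [ori, cr, Prod.fst_sub, Prod.snd_sub]; ring
    rw [h4]; exact h3
  filter_upwards [hev, self_mem_nhdsWithin] with ε he he0
  have he0' : (0:ℝ) < ε := he0
  refine tri_interior hC hv hu hw ?_ he ?_
  · have : ori v u (v + ε • d) = ε * cr (u - v) d := by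
      simp only [ori, cr, Prod.fst_sub, Prod.snd_sub, Prod.fst_add, Prod.snd_add, Prod.smul_fst, Prod.smul_snd, smul_eq_mul]; ring
    rw [this]; positivity
  · have : ori w v (v + ε • d) = ε * cr d (w - v) := by
      simp only [ori, cr, Prod.fst_sub, Prod.snd_sub, Prod.fst_add, Prod.snd_add, Prod.smul_fst, Prod.smul_snd, smul_eq_mul]; ring
    rw [this]; positivity

lemma InSec.overlap {C C' : Set Pt} (hC : Convex ℝ C) (hC' : Convex ℝ C') {v u w u' w' d : Pt}
    (hv : v ∈ C) (hu : u ∈ C) (hw : w ∈ C) (hv' : v ∈ C') (hu' : u' ∈ C') (hw' : w' ∈ C')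
    (h : InSec v u w d) (h' : InSec v u' w' d) : (interior C ∩ interior C').Nonempty := by
  obtain ⟨ε, h1, h2⟩ := ((h.ev hC hv hu hw).and (h'.ev hC' hv' hu' hw')).exists
  exact ⟨_, h1, h2⟩

lemma small_ev {x : ℝ} (y : ℝ) (hx : 0 < x) : ∀ᶠ δ : ℝ in 𝓝[>] 0, 0 < x + δ * y := by
  have hcont : Continuous (fun t : ℝ => x + t * y) := by fun_prop
  refine (hcont.tendsto 0 |>.mono_left nhdsWithin_le_nhds).eventually (lt_mem_nhds ?_)
  simpa using hx

lemma side_overlap {C C' : Set Pt} (hC : Convex ℝ C) (hC' : Convex ℝ C') {p q r r' : Pt}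
    (hp : p ∈ C) (hq : q ∈ C) (hr : r ∈ C) (hp' : p ∈ C') (hq' : q ∈ C') (hr' : r' ∈ C')
    (h : 0 < ori p q r) (h' : 0 < ori p q r') : (interior C ∩ interior C').Nonempty := by
  rw [ori_cr] at h h'
  obtain ⟨δ, hδ, hδ0⟩ := ((small_ev (cr (r - p) (r' - p)) h').and self_mem_nhdsWithin).exists
  have hδ0' : (0:ℝ) < δ := hδ0
  have e1 : cr (q - p) ((q - p) + δ • (r - p)) = δ * cr (q - p) (r - p) := by
    simp only [cr, Prod.fst_sub, Prod.snd_sub, Prod.fst_add, Prod.snd_add, Prod.smul_fst, Prod.smul_snd, smul_eq_mul]; ring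
  have e2 : cr ((q - p) + δ • (r - p)) (r - p) = cr (q - p) (r - p) := by
    simp only [cr, Prod.fst_sub, Prod.snd_sub, Prod.fst_add, Prod.snd_add, Prod.smul_fst, Prod.smul_snd, smul_eq_mul]; ring
  have e3 : cr ((q - p) + δ • (r - p)) (r' - p) = cr (q - p) (r' - p) + δ * cr (r - p) (r' - p) := by
    simp only [cr, Prod.fst_sub, Prod.snd_sub, Prod.fst_add, Prod.snd_add, Prod.smul_fst, Prod.smul_snd, smul_eq_mul]; ring
  refine InSec.overlap hC hC' (d := (q - p) + δ • (r - p)) hp hq hr hp' hq' hr' ⟨?_, ?_, h⟩ ⟨?_, ?_, h'⟩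
  · rw [e1]; positivity
  · rw [e2]; exact h
  · rw [e1]; positivity
  · rw [e3]; exact hδ

lemma line_seg {p q w a c : Pt} (hpq : p ≠ q) (h0 : ori p q w = 0) (h1 : 0 ≤ ori a p w) (h2 : 0 < ori a p q)
    (h3 : 0 ≤ ori q c w) (h4 : 0 < ori q c p) : w ∈ segment ℝ p q := by
  obtain ⟨t, rfl⟩ := ori_eq_zero_param hpq h0
  have e1 : ori a p ((1 - t) • p + t • q) = t * ori a p q := by
    simp only [ori, Prod.fst_sub, Prod.snd_sub, Prod.fst_add, Prod.snd_add, Prod.smul_fst, Prod.smul_snd, smul_eq_mul]; ring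
  have e2 : ori q c ((1 - t) • p + t • q) = (1 - t) * ori q c p := by
    simp only [ori, Prod.fst_sub, Prod.snd_sub, Prod.fst_add, Prod.snd_add, Prod.smul_fst, Prod.smul_snd, smul_eq_mul]; ring
  rw [e1] at h1
  rw [e2] at h3
  have t0 : 0 ≤ t := nonneg_of_mul_nonneg_left h1 h2
  have t1 : 0 ≤ 1 - t := nonneg_of_mul_nonneg_left h3 h4
  refine ⟨1 - t, t, t1, t0, by ring, rfl⟩

/-- triangular faces -/
def IsFace {S : Finset Pt} (T : PlaneGraph S) (Q : Finset Pt) : Prop :=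
  Q ⊆ S ∧ Q.card = 3 ∧ (∀ p ∈ Q, ∀ q ∈ Q, p ≠ q → s(p, q) ∈ T.edges) ∧
    ∀ s ∈ S, s ∈ convexHull ℝ (Q : Set Pt) → s ∈ Q

lemma tri_sides {a b c : Pt} (h : 0 < ori a b c) : IsSide {a, b, c} a b := by
  refine ⟨by simp, by simp, ori_ne_left h.ne', ?_⟩
  intro r hr h1 h2
  simp only [Finset.mem_insert, Finset.mem_singleton] at hr
  rcases hr with rfl | rfl | rfl
  · exact absurd rfl h1
  · exact absurd rfl h2
  · exact h

lemma tri_rot (a b c : Pt) : ({a, b, c} : Finset Pt) = {b, c, a} := by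
  ext x; simp only [Finset.mem_insert, Finset.mem_singleton]; tauto

lemma tri_poly {a b c : Pt} (h : 0 < ori a b c) : CPoly {a, b, c} := by
  constructor
  · rw [Finset.card_eq_three.2 ⟨a, b, c, ori_ne_left h.ne', ori_ne_mid h.ne', ori_ne_right h.ne', rfl⟩]
  · intro p hp
    simp only [Finset.mem_insert, Finset.mem_singleton] at hp
    rcases hp with rfl | rfl | rfl
    · exact ⟨b, tri_sides h⟩
    · refine ⟨c, ?_⟩
      rw [tri_rot]
      exact tri_sides (by rw [ori_cyc]; exact h)
    · refine ⟨a, ?_⟩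
      rw [← tri_rot]
      exact tri_sides (by rw [ori_cyc2]; exact h)

lemma tri_form {S Q : Finset Pt} (hS : GenPos S) (hQ : Q ⊆ S) (hc : Q.card = 3) :
    ∃ a b c, Q = {a, b, c} ∧ 0 < ori a b c := by
  obtain ⟨a, b, c, hab, hac, hbc, rfl⟩ := Finset.card_eq_three.1 hc
  have := hS.ori_ne (hQ (by simp)) (hQ (by simp)) (hQ (by simp)) hab hac hbc
  rcases lt_or_gt_of_ne this with h | h
  · refine ⟨b, a, c, ?_, by rw [ori_swap]; linarith⟩
    ext x; simp only [Finset.mem_insert, Finset.mem_singleton]; tauto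
  · exact ⟨a, b, c, rfl, h⟩

/-- leaving a triangle -/
lemma tri_leave {a b c x y : Pt} (h : 0 < ori a b c) (hx : x ∈ convexHull ℝ (({a, b, c} : Finset Pt) : Set Pt))
    (hy : y ∉ convexHull ℝ (({a, b, c} : Finset Pt) : Set Pt)) :
    ∃ m ∈ segment ℝ x y, m ≠ y ∧ m ∈ convexHull ℝ (({a, b, c} : Finset Pt) : Set Pt) ∧
      ∃ p q, p ∈ ({a, b, c} : Finset Pt) ∧ q ∈ ({a, b, c} : Finset Pt) ∧ p ≠ q ∧ m ∈ segment ℝ p q := by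
  have ha : a ∈ convexHull ℝ (({a, b, c} : Finset Pt) : Set Pt) := subset_convexHull _ _ (by simp)
  have hb : b ∈ convexHull ℝ (({a, b, c} : Finset Pt) : Set Pt) := subset_convexHull _ _ (by simp)
  have hc : c ∈ convexHull ℝ (({a, b, c} : Finset Pt) : Set Pt) := subset_convexHull _ _ (by simp)
  have h2 : ori b c a = ori a b c := ori_cyc _ _ _
  have h3 : ori c a b = ori a b c := ori_cyc2 _ _ _
  obtain ⟨m, hm, hall, hmc, i, hi0, hic⟩ := exit_lemma (ι := Fin 3) ![a, b, c] ![b, c, a] (y := x) (c := y)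
    (by
      intro i
      refine hull_ori ?_ hx
      intro r hr
      simp only [Finset.coe_insert, Finset.coe_singleton, Set.mem_insert_iff, Set.mem_singleton_iff] at hr
      fin_cases i <;> rcases hr with rfl | rfl | rfl <;> simp [h2, h3, h.le])
    (by
      by_contra hcon
      push Not at hcon
      exact hy (mem_tri (convex_convexHull ℝ _) ha hb hc h (hcon 0) (hcon 1) (hcon 2)))
  have k0 := hall 0
  have k1 := hall 1
  have k2 := hall 2
  simp at k0 k1 k2
  refine ⟨m, hm, hmc, mem_tri (convex_convexHull ℝ _) ha hb hc h k0 k1 k2, ?_⟩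
  fin_cases i
  · simp at hi0
    exact ⟨a, b, by simp, by simp, ori_ne_left h.ne', tri_side h hi0 k1 k2⟩
  · simp at hi0
    exact ⟨b, c, by simp, by simp, ori_ne_right h.ne', tri_side (by rw [h2]; exact h) hi0 k2 k0⟩
  · simp at hi0
    exact ⟨c, a, by simp, by simp, (ori_ne_mid h.ne').symm, tri_side (by rw [h3]; exact h) hi0 k0 k1⟩

lemma face_edge_in {S : Finset Pt} (hS : GenPos S) {T : PlaneGraph S} {Q : Finset Pt} (hQ : IsFace T Q) {p q m : Pt}
    (he : s(p, q) ∈ T.edges) (hm : m ∈ segment ℝ p q) (hmi : m ∈ interior (convexHull ℝ (Q : Set Pt))) : p ∈ Q := by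
  obtain ⟨a, b, c, rfl, habc⟩ := tri_form hS hQ.1 hQ.2.1
  have hp := T.endpoint_mem _ he p (by simp)
  have hq := T.endpoint_mem _ he q (by simp)
  have hpq : p ≠ q := by simpa using T.not_isDiag _ he
  by_contra hpQ
  have hph : p ∉ convexHull ℝ (({a, b, c} : Finset Pt) : Set Pt) := fun h => hpQ (hQ.2.2.2 p hp h)
  obtain ⟨z, hz, hzp, hzh, p', q', hp', hq', hpq', hz'⟩ := tri_leave habc (interior_subset hmi) hph
  have hzs : z ∈ seg2 s(p, q) := (convex_segment p q).segment_subset hm (left_mem_segment _ _ _) hz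
  have hne : s(p, q) ≠ s(p', q') := by
    intro heq
    have : p ∈ s(p', q') := by rw [← heq]; simp
    rcases Sym2.mem_iff.1 this with rfl | rfl
    · exact hpQ hp'
    · exact hpQ hq'
  have := (T.noncrossing _ he _ (hQ.2.2.1 p' hp' q' hq' hpq') hne z ⟨hzs, hz'⟩).1
  rcases Sym2.mem_iff.1 this with h | h
  · exact hzp h
  · subst h
    have hmz : m = z := by
      obtain ⟨s, t, hs, ht, hst, rfl⟩ := hm
      obtain ⟨s', t', hs', ht', hst', h⟩ := hz
      have e : (1 - s' * t) • (z - p) = 0 := by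
        have : (1 - s' * t) • (z - p) = z - (s' • (s • p + t • z) + t' • p) := by
          have e1 : s = 1 - t := by linarith
          have e2 : t' = 1 - s' := by linarith
          subst e1 e2
          ext <;> simp <;> ring
        rw [this, h, sub_self]
      have hz0 : z - p ≠ 0 := sub_ne_zero.2 hzp
      have : 1 - s' * t = 0 := (smul_eq_zero.1 e).resolve_right hz0
      have ht1 : t = 1 := by nlinarith
      have hs0 : s = 0 := by linarith
      subst ht1 hs0; simp
    subst hmz
    have := hQ.2.2.2 m hq (interior_subset hmi)
    exact (tri_poly habc).not_interior this hmi

lemma face_disj {S : Finset Pt} (hS : GenPos S) {T : PlaneGraph S} {Q Q' : Finset Pt} (hQ : IsFace T Q)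
    (hQ' : IsFace T Q') (hne : Q ≠ Q') :
    interior (convexHull ℝ (Q : Set Pt)) ∩ interior (convexHull ℝ (Q' : Set Pt)) = ∅ := by
  by_contra hcon
  obtain ⟨x, hx, hx'⟩ := Set.nonempty_iff_ne_empty.2 hcon
  obtain ⟨v, hv', hv⟩ : ∃ v ∈ Q', v ∉ Q := by
    by_contra hcon
    push Not at hcon
    exact hne (Finset.eq_of_subset_of_card_le (s := Q') (t := Q) hcon (by rw [hQ.2.1, hQ'.2.1])).symm
  have hvh : v ∉ convexHull ℝ (Q : Set Pt) := fun h => hv (hQ.2.2.2 v (hQ'.1 hv') h)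
  obtain ⟨a, b, c, rfl, habc⟩ := tri_form hS hQ.1 hQ.2.1
  obtain ⟨m, hm, hmv, hmh, p, q, hp, hq, hpq, hmpq⟩ := tri_leave habc (interior_subset hx) hvh
  have hvh' : v ∈ convexHull ℝ (Q' : Set Pt) := subset_convexHull _ _ hv'
  have hmi : m ∈ interior (convexHull ℝ (Q' : Set Pt)) := by
    by_cases h : m = x
    · rw [h]; exact hx'
    · exact (convex_convexHull ℝ _).openSegment_interior_self_subset_interior hx' hvh' (open_of_seg hm h hmv)
  have he := hQ.2.2.1 p hp q hq hpq
  have h1 := face_edge_in hS hQ' he hmpq hmi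
  have h2 := face_edge_in hS hQ' (p := q) (q := p) (by rw [Sym2.eq_swap]; exact he)
    (by rw [segment_symm]; exact hmpq) hmi
  -- p q is a side line of Q'
  obtain ⟨a', b', c', rfl, habc'⟩ := tri_form hS hQ'.1 hQ'.2.1
  have key : ∀ u v w : Pt, 0 < ori u v w → ∀ Q' : Finset Pt, Q' = {u, v, w} →
      m ∈ interior (convexHull ℝ (Q' : Set Pt)) → m ∈ segment ℝ u v → False := by
    rintro u v w h Q' rfl hmi hs
    have := interior_half (ori_ne_left h.ne') (fun y hy => (tri_sides h).hull hy) hmi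
    rw [seg_line hs] at this
    exact lt_irrefl _ this
  have r1 := tri_rot a' b' c'
  have r2 := (tri_rot c' a' b').symm
  have o1 : 0 < ori b' c' a' := by rw [ori_cyc]; exact habc'
  have o2 : 0 < ori c' a' b' := by rw [ori_cyc2]; exact habc'
  have hmqp : m ∈ segment ℝ q p := by rw [segment_symm]; exact hmpq
  simp only [Finset.mem_insert, Finset.mem_singleton] at h1 h2
  rcases h1 with rfl | rfl | rfl <;> rcases h2 with rfl | rfl | rfl
  · exact hpq rfl
  · exact key _ _ _ habc' _ rfl hmi hmpq
  · exact key _ _ _ o2 _ r2 hmi hmqp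
  · exact key _ _ _ habc' _ rfl hmi hmqp
  · exact hpq rfl
  · exact key _ _ _ o1 _ r1 hmi hmpq
  · exact key _ _ _ o2 _ r2 hmi hmpq
  · exact key _ _ _ o1 _ r1 hmi hmqp
  · exact hpq rfl

/-- the set of all triangular faces -/
def faces {S : Finset Pt} (T : PlaneGraph S) : Finset (Finset Pt) := S.powerset.filter (IsFace T)

lemma mem_faces {S : Finset Pt} {T : PlaneGraph S} {Q : Finset Pt} : Q ∈ faces T ↔ IsFace T Q := by
  unfold faces
  rw [Finset.mem_filter, Finset.mem_powerset]
  exact ⟨fun h => h.2, fun h => ⟨h.1, h⟩⟩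

/-- The state of the merging process. -/
structure PInv {S : Finset Pt} (T : PlaneGraph S) (QQ : Finset (Finset Pt)) (F : Finset (Sym2 Pt)) : Prop where
  poly : ∀ Q ∈ QQ, CPoly Q
  sub : ∀ Q ∈ QQ, Q ⊆ S
  sides : ∀ Q ∈ QQ, ∀ p q, IsSide Q p q → s(p, q) ∈ T.edges
  empt : ∀ Q ∈ QQ, ∀ s ∈ S, s ∈ convexHull ℝ (Q : Set Pt) → s ∈ Q
  disj : ∀ Q ∈ QQ, ∀ Q' ∈ QQ, Q ≠ Q' →
    interior (convexHull ℝ (Q : Set Pt)) ∩ interior (convexHull ℝ (Q' : Set Pt)) = ∅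
  FT : F ⊆ T.edges
  diag : ∀ e ∈ F, ∃ Q ∈ QQ, ∃ p ∈ Q, ∃ q ∈ Q, e = s(p, q) ∧ (∃ r ∈ Q, 0 < ori p q r) ∧ ∃ r ∈ Q, ori p q r < 0
  count : F.card + QQ.card = (faces T).card
  sum : ∑ Q ∈ QQ, Q.card = (faces T).card + 2 * QQ.card
  rev : ∀ Q ∈ QQ, ∀ p q, IsSide Q p q → ∀ r ∈ S, 0 < ori q p r → ∃ Q' ∈ QQ, IsSide Q' q p

lemma apex_face {S : Finset Pt} (hS : GenPos S) {T : PlaneGraph S} (hT : IsTriangulation T)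
    {p q r₀ : Pt} (he : s(p, q) ∈ T.edges) (hr₀ : r₀ ∈ S) (h0 : 0 < ori p q r₀) :
    ∃ r, 0 < ori p q r ∧ IsFace T {p, q, r} := by
  obtain ⟨r, hr, hrp, h1, h2, h3⟩ := apex hS hT he hr₀ h0
  have hp := T.endpoint_mem _ he p (by simp)
  have hq := T.endpoint_mem _ he q (by simp)
  refine ⟨r, hrp, ?_, ?_, ?_, ?_⟩
  · intro x hx
    simp only [Finset.mem_insert, Finset.mem_singleton] at hx
    rcases hx with rfl | rfl | rfl <;> assumption
  · exact Finset.card_eq_three.2 ⟨p, q, r, ori_ne_left hrp.ne', ori_ne_mid hrp.ne', ori_ne_right hrp.ne', rfl⟩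
  · intro x hx y hy hxy
    simp only [Finset.mem_insert, Finset.mem_singleton] at hx hy
    rcases hx with rfl | rfl | rfl <;> rcases hy with rfl | rfl | rfl <;>
      first
      | exact absurd rfl hxy
      | assumption
      | (rw [Sym2.eq_swap]; assumption)
  · intro s hs hsh
    have := h3 s hs (by simpa using hsh)
    simpa using this

lemma inv_start {S : Finset Pt} (hS : GenPos S) {T : PlaneGraph S} (hT : IsTriangulation T) :
    PInv T (faces T) ∅ where
  poly := by
    intro Q hQ
    have := mem_faces.1 hQ
    obtain ⟨a, b, c, rfl, h⟩ := tri_form hS this.1 this.2.1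
    exact tri_poly h
  sub := fun Q hQ => (mem_faces.1 hQ).1
  sides := fun Q hQ p q h => (mem_faces.1 hQ).2.2.1 p h.1 q h.2.1 h.2.2.1
  empt := fun Q hQ => (mem_faces.1 hQ).2.2.2
  disj := fun Q hQ Q' hQ' hne => face_disj hS (mem_faces.1 hQ) (mem_faces.1 hQ') hne
  FT := by simp
  diag := by simp
  count := by simp
  sum := by
    rw [Finset.sum_congr rfl (fun Q hQ => (mem_faces.1 hQ).2.1)]
    simp; ring
  rev := by
    intro Q hQ p q h r hr hr0
    have he := (mem_faces.1 hQ).2.2.1 q h.2.1 p h.1 h.2.2.1.symm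
    obtain ⟨r', hr', hf⟩ := apex_face hS hT he hr hr0
    exact ⟨_, mem_faces.2 hf, tri_sides hr'⟩

lemma PInv.unique {S : Finset Pt} {T : PlaneGraph S} {QQ : Finset (Finset Pt)} {F : Finset (Sym2 Pt)}
    (hI : PInv T QQ F) {Q Q' : Finset Pt} (hQ : Q ∈ QQ) (hQ' : Q' ∈ QQ) {p q r r' : Pt}
    (hp : p ∈ Q) (hq : q ∈ Q) (hr : r ∈ Q) (hp' : p ∈ Q') (hq' : q ∈ Q') (hr' : r' ∈ Q')
    (h : 0 < ori p q r) (h' : 0 < ori p q r') : Q = Q' := by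
  by_contra hne
  have := side_overlap (convex_convexHull ℝ (Q : Set Pt)) (convex_convexHull ℝ (Q' : Set Pt))
    (subset_convexHull ℝ _ hp) (subset_convexHull ℝ _ hq) (subset_convexHull ℝ _ hr)
    (subset_convexHull ℝ _ hp') (subset_convexHull ℝ _ hq') (subset_convexHull ℝ _ hr') h h'
  rw [hI.disj Q hQ Q' hQ' hne] at this
  simp at this

lemma PInv.side_unique {S : Finset Pt} {T : PlaneGraph S} {QQ : Finset (Finset Pt)} {F : Finset (Sym2 Pt)}
    (hI : PInv T QQ F) {Q Q' : Finset Pt} (hQ : Q ∈ QQ) (hQ' : Q' ∈ QQ) {p q : Pt}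
    (h : IsSide Q p q) (h' : IsSide Q' p q) : Q = Q' := by
  obtain ⟨r, hr, h1, h2⟩ := (hI.poly Q hQ).third p q
  obtain ⟨r', hr', h1', h2'⟩ := (hI.poly Q' hQ').third p q
  exact hI.unique hQ hQ' h.1 h.2.1 hr h'.1 h'.2.1 hr' (h.2.2.2 r hr h1 h2) (h'.2.2.2 r' hr' h1' h2')

structure MergeData (S Q Q' : Finset Pt) (p q a b c d : Pt) : Prop where
  hQ : CPoly Q
  hQ' : CPoly Q'
  hpq : IsSide Q p q
  hap : IsSide Q a p
  hqc : IsSide Q q c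
  hqp : IsSide Q' q p
  hpb : IsSide Q' p b
  hdq : IsSide Q' d q
  h1 : 0 < ori a p b
  h2 : 0 < ori d q c

lemma MergeData.symm {S Q Q' : Finset Pt} {p q a b c d : Pt} (h : MergeData S Q Q' p q a b c d) :
    MergeData S Q' Q q p d c b a :=
  ⟨h.hQ', h.hQ, h.hqp, h.hdq, h.hpb, h.hpq, h.hqc, h.hap, h.h2, h.h1⟩

lemma MergeData.facts {S Q Q' : Finset Pt} {p q a b c d : Pt} (h : MergeData S Q Q' p q a b c d) :
    0 < ori p q a ∧ 0 < ori p q c ∧ 0 < ori q p b ∧ 0 < ori q p d := by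
  have n1 : a ≠ q := by rintro rfl; exact h.hQ.not_both h.hpq h.hap
  have n2 : c ≠ p := by rintro rfl; exact h.hQ.not_both h.hpq h.hqc
  have n3 : b ≠ q := by rintro rfl; exact h.hQ'.not_both h.hqp h.hpb
  have n4 : d ≠ p := by rintro rfl; exact h.hQ'.not_both h.hqp h.hdq
  exact ⟨h.hpq.2.2.2 a h.hap.1 h.hap.2.2.1 n1, h.hpq.2.2.2 c h.hqc.2.1 n2 h.hqc.2.2.1.symm,
    h.hqp.2.2.2 b h.hpb.2.1 n3 h.hpb.2.2.1.symm, h.hqp.2.2.2 d h.hdq.1 h.hdq.2.2.1 n4⟩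

lemma MergeData.cone {S Q Q' : Finset Pt} {p q a b c d : Pt} (h : MergeData S Q Q' p q a b c d)
    {r : Pt} (hr : r ∈ Q') (hrp : r ≠ p) (hrq : r ≠ q) : 0 < ori a p r ∧ 0 < ori q c r := by
  obtain ⟨f1, f2, f3, f4⟩ := h.facts
  have k1 := h.hqp.2.2.2 r hr hrq hrp
  have k2 := h.hpb.nonneg hr
  have k3 := h.hdq.nonneg hr
  have g1 := h.h1
  have g2 := h.h2
  constructor
  · have : ori q p b * ori a p r = ori q p r * ori a p b + ori p b r * ori p q a := by
      unfold ori; ring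
    have h3 : 0 < ori q p b * ori a p r := by
      rw [this]
      have := mul_pos k1 g1
      have := mul_nonneg k2 f1.le
      linarith
    exact pos_of_mul_pos_right h3 f3.le
  · have : ori q p d * ori q c r = ori d q r * ori p q c + ori q p r * ori d q c := by
      unfold ori; ring
    have h3 : 0 < ori q p d * ori q c r := by
      rw [this]
      have := mul_pos k1 g2
      have := mul_nonneg k3 f2.le
      linarith
    exact pos_of_mul_pos_right h3 f4.le

lemma cross_seg {p q u r a c : Pt} (hpq : p ≠ q) (hu : 0 < ori p q u) (hr : ori p q r < 0)
    (h2 : 0 < ori a p q) (h4 : 0 < ori q c p) (a1 : 0 ≤ ori a p u) (a2 : 0 ≤ ori a p r)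
    (c1 : 0 ≤ ori q c u) (c2 : 0 ≤ ori q c r) :
    ∃ s t : ℝ, 0 < s ∧ 0 < t ∧ s + t = 1 ∧ s • u + t • r ∈ segment ℝ p q := by
  have hD : 0 < ori p q u - ori p q r := by linarith
  refine ⟨- ori p q r / (ori p q u - ori p q r), ori p q u / (ori p q u - ori p q r),
    div_pos (by linarith) hD, div_pos hu hD, by field_simp; ring, ?_⟩
  have hs1 : - ori p q r / (ori p q u - ori p q r) + ori p q u / (ori p q u - ori p q r) = 1 := by
    field_simp; ring
  have s0 : 0 < - ori p q r / (ori p q u - ori p q r) := div_pos (by linarith) hD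
  have t0 : 0 < ori p q u / (ori p q u - ori p q r) := div_pos hu hD
  refine line_seg (a := a) (c := c) hpq ?_ ?_ h2 ?_ h4
  · rw [ori_comb _ _ _ _ _ _ hs1]; field_simp; ring
  · rw [ori_comb _ _ _ _ _ _ hs1]; positivity
  · rw [ori_comb _ _ _ _ _ _ hs1]; positivity

lemma MergeData.left {S Q Q' : Finset Pt} {p q a b c d : Pt} (h : MergeData S Q Q' p q a b c d)
    {u v : Pt} (huv : IsSide Q u v) (hne : ¬ (u = p ∧ v = q))
    {r : Pt} (hr : r ∈ Q') (hrp : r ≠ p) (hrq : r ≠ q) : 0 < ori u v r := by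
  obtain ⟨f1, f2, f3, f4⟩ := h.facts
  obtain ⟨c1, c2⟩ := h.cone hr hrp hrq
  have hup : u ≠ p := by
    rintro rfl; exact hne ⟨rfl, huv.succ_unique h.hpq⟩
  have hvq : v ≠ q := by
    rintro rfl; exact hne ⟨huv.pred_unique h.hpq, rfl⟩
  by_cases hvp : v = p
  · subst hvp
    rw [huv.pred_unique h.hap]; exact c1
  by_cases huq : u = q
  · subst huq
    rw [huv.succ_unique h.hqc]; exact c2
  have k1 := h.hqp.2.2.2 r hr hrq hrp
  rw [ori_swap] at k1
  obtain ⟨s, t, hs, ht, hst, hm⟩ := cross_seg (a := a) (c := c) (u := u) (r := r) h.hpq.2.2.1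
    (h.hpq.2.2.2 u huv.1 hup huq) (by linarith) (by rw [ori_cyc2]; exact f1) (by rw [ori_cyc]; exact f2)
    (h.hap.nonneg huv.1) c1.le (h.hqc.nonneg huv.1) c2.le
  have m1 := huv.2.2.2 p h.hpq.1 (Ne.symm hup) (Ne.symm hvp)
  have m2 := huv.2.2.2 q h.hpq.2.1 (Ne.symm huq) (Ne.symm hvq)
  have m3 := (convex_ori_mul u v 1).segment_subset (x := p) (y := q) (by simpa using m1) (by simpa using m2) hm
  simp only [Set.mem_ofPred_eq, mul_one] at m3
  rw [ori_comb _ _ _ _ _ _ hst, ori_left] at m3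
  have : 0 < t * ori u v r := by linarith
  exact pos_of_mul_pos_right this ht.le

lemma MergeData.side {S Q Q' : Finset Pt} {p q a b c d : Pt} (h : MergeData S Q Q' p q a b c d)
    {u v : Pt} (huv : IsSide Q u v) (hne : ¬ (u = p ∧ v = q)) : IsSide (Q ∪ Q') u v := by
  refine ⟨Finset.mem_union_left _ huv.1, Finset.mem_union_left _ huv.2.1, huv.2.2.1, ?_⟩
  intro r hr hru hrv
  by_cases hrQ : r ∈ Q
  · exact huv.2.2.2 r hrQ hru hrv
  · have hr' : r ∈ Q' := (Finset.mem_union.1 hr).resolve_left hrQ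
    refine h.left huv hne hr' ?_ ?_
    · rintro rfl; exact hrQ h.hpq.1
    · rintro rfl; exact hrQ h.hpq.2.1

lemma MergeData.side' {S Q Q' : Finset Pt} {p q a b c d : Pt} (h : MergeData S Q Q' p q a b c d)
    {u v : Pt} (huv : IsSide Q' u v) (hne : ¬ (u = q ∧ v = p)) : IsSide (Q ∪ Q') u v := by
  rw [Finset.union_comm]; exact h.symm.side huv hne

lemma MergeData.ex_side {S Q Q' : Finset Pt} {p q a b c d : Pt} (h : MergeData S Q Q' p q a b c d)
    {u : Pt} (hu : u ∈ Q ∪ Q') : ∃ v, IsSide (Q ∪ Q') u v ∧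
      ((IsSide Q u v ∧ ¬ (u = p ∧ v = q)) ∨ (IsSide Q' u v ∧ ¬ (u = q ∧ v = p))) := by
  by_cases hup : u = p
  · subst hup
    have : ¬ (u = q ∧ b = u) := fun h' => h.hpq.2.2.1 h'.1
    exact ⟨b, h.side' h.hpb this, Or.inr ⟨h.hpb, this⟩⟩
  by_cases huq : u = q
  · subst huq
    have : ¬ (u = p ∧ c = u) := fun h' => hup h'.1
    exact ⟨c, h.side h.hqc this, Or.inl ⟨h.hqc, this⟩⟩
  rcases Finset.mem_union.1 hu with hu | hu
  · obtain ⟨v, hv⟩ := h.hQ.2 u hu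
    have : ¬ (u = p ∧ v = q) := fun h' => hup h'.1
    exact ⟨v, h.side hv this, Or.inl ⟨hv, this⟩⟩
  · obtain ⟨v, hv⟩ := h.hQ'.2 u hu
    have : ¬ (u = q ∧ v = p) := fun h' => huq h'.1
    exact ⟨v, h.side' hv this, Or.inr ⟨hv, this⟩⟩

lemma MergeData.side_of {S Q Q' : Finset Pt} {p q a b c d : Pt} (h : MergeData S Q Q' p q a b c d)
    {u v : Pt} (hu : IsSide (Q ∪ Q') u v) :
      ((IsSide Q u v ∧ ¬ (u = p ∧ v = q)) ∨ (IsSide Q' u v ∧ ¬ (u = q ∧ v = p))) := by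
  obtain ⟨v', h1, h2⟩ := h.ex_side hu.1
  rw [hu.succ_unique h1]; exact h2

lemma MergeData.inter {S Q Q' : Finset Pt} {p q a b c d : Pt} (h : MergeData S Q Q' p q a b c d) :
    Q ∩ Q' = {p, q} := by
  ext r
  simp only [Finset.mem_inter, Finset.mem_insert, Finset.mem_singleton]
  constructor
  · rintro ⟨h1, h2⟩
    by_contra hcon
    push Not at hcon
    have k1 := h.hpq.2.2.2 r h1 hcon.1 hcon.2
    have k2 := h.hqp.2.2.2 r h2 hcon.2 hcon.1
    rw [ori_swap] at k2
    linarith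
  · rintro (rfl | rfl)
    · exact ⟨h.hpq.1, h.hpb.1⟩
    · exact ⟨h.hqc.1, h.hqp.1⟩

lemma MergeData.card {S Q Q' : Finset Pt} {p q a b c d : Pt} (h : MergeData S Q Q' p q a b c d) :
    (Q ∪ Q').card + 2 = Q.card + Q'.card := by
  have := Finset.card_union_add_card_inter Q Q'
  rw [h.inter, Finset.card_pair h.hpq.2.2.1] at this
  exact this

lemma MergeData.poly {S Q Q' : Finset Pt} {p q a b c d : Pt} (h : MergeData S Q Q' p q a b c d) :
    CPoly (Q ∪ Q') := by
  constructor
  · exact h.hQ.1.trans (Finset.card_le_card Finset.subset_union_left)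
  · intro u hu
    obtain ⟨v, h1, -⟩ := h.ex_side hu
    exact ⟨v, h1⟩

lemma MergeData.hull {S Q Q' : Finset Pt} {p q a b c d : Pt} (h : MergeData S Q Q' p q a b c d) :
    convexHull ℝ ((Q ∪ Q' : Finset Pt) : Set Pt) ⊆ convexHull ℝ (Q : Set Pt) ∪ convexHull ℝ (Q' : Set Pt) := by
  obtain ⟨f1, f2, f3, f4⟩ := h.facts
  intro z hz
  rw [Finset.coe_union, convexHull_union ⟨p, h.hpq.1⟩ ⟨p, h.hpb.1⟩, mem_convexJoin] at hz
  obtain ⟨u, hu, r, hr, hz⟩ := hz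
  have hsap : IsSide (Q ∪ Q') a p := h.side h.hap (by rintro ⟨rfl, rfl⟩; exact h.hap.2.2.1 rfl)
  have hsqc : IsSide (Q ∪ Q') q c := h.side h.hqc (by rintro ⟨rfl, rfl⟩; exact h.hqc.2.2.1 rfl)
  have hu' : u ∈ convexHull ℝ ((Q ∪ Q' : Finset Pt) : Set Pt) :=
    convexHull_mono (by exact_mod_cast Finset.subset_union_left) hu
  have hr' : r ∈ convexHull ℝ ((Q ∪ Q' : Finset Pt) : Set Pt) :=
    convexHull_mono (by exact_mod_cast Finset.subset_union_right) hr
  have hpQ : p ∈ convexHull ℝ (Q : Set Pt) := subset_convexHull _ _ h.hpq.1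
  have hqQ : q ∈ convexHull ℝ (Q : Set Pt) := subset_convexHull _ _ h.hpq.2.1
  have hpQ' : p ∈ convexHull ℝ (Q' : Set Pt) := subset_convexHull _ _ h.hqp.2.1
  have hqQ' : q ∈ convexHull ℝ (Q' : Set Pt) := subset_convexHull _ _ h.hqp.1
  have u0 := h.hpq.hull hu
  have r0 := h.hqp.hull hr
  rw [ori_swap] at r0
  have ha : 0 < ori a p q := by rw [ori_cyc2]; exact f1
  have hc : 0 < ori q c p := by rw [ori_cyc]; exact f2
  have onl : ∀ w ∈ convexHull ℝ ((Q ∪ Q' : Finset Pt) : Set Pt), ori p q w = 0 → w ∈ segment ℝ p q := by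
    intro w hw h0
    exact line_seg (a := a) (c := c) h.hpq.2.2.1 h0 (hsap.hull hw) ha (hsqc.hull hw) hc
  rcases u0.eq_or_lt with h0 | hup
  · right
    have := onl u hu' h0.symm
    have hu2 := (convex_convexHull ℝ (Q' : Set Pt)).segment_subset hpQ' hqQ' this
    exact (convex_convexHull ℝ (Q' : Set Pt)).segment_subset hu2 hr hz
  rcases (show ori p q r ≤ 0 by linarith).eq_or_lt with h0 | hrn
  · left
    have := onl r hr' h0
    have hr2 := (convex_convexHull ℝ (Q : Set Pt)).segment_subset hpQ hqQ this
    exact (convex_convexHull ℝ (Q : Set Pt)).segment_subset hu hr2 hz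
  obtain ⟨s, t, hs, ht, hst, hm⟩ := cross_seg (a := a) (c := c) (u := u) (r := r) h.hpq.2.2.1 hup hrn ha hc
    (hsap.hull hu') (hsap.hull hr') (hsqc.hull hu') (hsqc.hull hr')
  have m1 := (convex_convexHull ℝ (Q : Set Pt)).segment_subset hpQ hqQ hm
  have m2 := (convex_convexHull ℝ (Q' : Set Pt)).segment_subset hpQ' hqQ' hm
  obtain ⟨σ, τ, hσ, hτ, hστ, rfl⟩ := hz
  rcases le_total τ t with hle | hle
  · left
    refine (convex_convexHull ℝ (Q : Set Pt)).segment_subset hu m1 ⟨1 - τ / t, τ / t, ?_, by positivity, by ring, ?_⟩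
    · have : τ / t ≤ 1 := by rw [div_le_one ht]; exact hle
      linarith
    · have e1 : s = 1 - t := by linarith
      have e2 : σ = 1 - τ := by linarith
      subst e1 e2
      ext <;> simp <;> field_simp <;> ring
  · right
    refine (convex_convexHull ℝ (Q' : Set Pt)).segment_subset m2 hr ⟨σ / s, 1 - σ / s, by positivity, ?_, by ring, ?_⟩
    · have : σ / s ≤ 1 := by rw [div_le_one hs]; linarith
      linarith
    · have e1 : t = 1 - s := by linarith
      have e2 : τ = 1 - σ := by linarith
      subst e1 e2
      ext <;> simp <;> field_simp <;> ring

lemma open_meets {U A B C : Set Pt} (hU : IsOpen U) (hUn : U.Nonempty) (hA : IsClosed A) (h : U ⊆ A ∪ B) (hC : U ⊆ interior C)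
    (h1 : interior A ∩ interior C = ∅) (h2 : interior B ∩ interior C = ∅) : False := by
  obtain ⟨x, hx⟩ := hUn
  by_cases hsub : U ⊆ A
  · have : x ∈ interior A ∩ interior C := ⟨interior_maximal hsub hU hx, hC hx⟩
    rw [h1] at this; exact this
  · obtain ⟨y, hy, hyA⟩ := Set.not_subset.1 hsub
    have hV : IsOpen (U ∩ Aᶜ) := hU.inter hA.isOpen_compl
    have hVB : U ∩ Aᶜ ⊆ B := fun z hz => (h hz.1).resolve_left hz.2
    have : y ∈ interior B ∩ interior C := ⟨interior_maximal hVB hV ⟨hy, hyA⟩, hC hy⟩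
    rw [h2] at this; exact this

lemma hull_closed (Q : Finset Pt) : IsClosed (convexHull ℝ (Q : Set Pt)) :=
  (Q.finite_toSet.isCompact_convexHull ℝ).isClosed

lemma merge {S : Finset Pt} {T : PlaneGraph S} {QQ : Finset (Finset Pt)} {F : Finset (Sym2 Pt)}
    (hI : PInv T QQ F) {Q Q' : Finset Pt} (hQ : Q ∈ QQ) (hQ' : Q' ∈ QQ) {p q a b c d : Pt}
    (h : MergeData S Q Q' p q a b c d) :
    PInv T (insert (Q ∪ Q') ((QQ.erase Q).erase Q')) (insert s(p, q) F) ∧ s(p, q) ∉ F := by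
  obtain ⟨f1, f2, f3, f4⟩ := h.facts
  have hne : Q ≠ Q' := by
    rintro rfl; exact h.hQ.not_both h.hpq h.hqp
  have hRn : Q ∪ Q' ∉ QQ := by
    intro hR
    have : Q = Q ∪ Q' := hI.unique hQ hR h.hpq.1 h.hpq.2.1 h.hap.1 (Finset.mem_union_left _ h.hpq.1)
      (Finset.mem_union_left _ h.hpq.2.1) (Finset.mem_union_left _ h.hap.1) f1 f1
    have hb : b ∈ Q := by rw [this]; exact Finset.mem_union_right _ h.hpb.2.1
    have := h.hpq.nonneg hb
    rw [ori_swap] at f3; linarith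
  have hF : s(p, q) ∉ F := by
    intro hF
    obtain ⟨Q0, hQ0, p', hp', q', hq', he, ⟨r, hr, hr0⟩, r', hr', hr0'⟩ := hI.diag _ hF
    rcases Sym2.eq_iff.1 he with ⟨rfl, rfl⟩ | ⟨rfl, rfl⟩
    · have := hI.unique hQ hQ0 h.hpq.1 h.hpq.2.1 h.hap.1 hp' hq' hr f1 hr0
      subst this
      linarith [h.hpq.nonneg hr']
    · have := hI.unique hQ hQ0 h.hpq.1 h.hpq.2.1 h.hap.1 hq' hp' hr' f1 (by rw [ori_swap]; linarith)
      subst this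
      have := h.hpq.nonneg hr
      rw [ori_swap] at this
      linarith
  have hmem : ∀ {X}, X ∈ insert (Q ∪ Q') ((QQ.erase Q).erase Q') → X = Q ∪ Q' ∨ (X ∈ QQ ∧ X ≠ Q ∧ X ≠ Q') := by
    intro X hX
    rcases Finset.mem_insert.1 hX with rfl | hX
    · exact Or.inl rfl
    · rw [Finset.mem_erase, Finset.mem_erase] at hX
      exact Or.inr ⟨hX.2.2, hX.2.1, hX.1⟩
  have hmem' : ∀ {X}, X ∈ QQ → X ≠ Q → X ≠ Q' → X ∈ insert (Q ∪ Q') ((QQ.erase Q).erase Q') := by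
    intro X hX h1 h2
    exact Finset.mem_insert_of_mem (Finset.mem_erase.2 ⟨h2, Finset.mem_erase.2 ⟨h1, hX⟩⟩)
  have hcE : ((QQ.erase Q).erase Q').card + 2 = QQ.card := by
    have h1 := Finset.card_erase_add_one hQ
    have h2 := Finset.card_erase_add_one (Finset.mem_erase.2 ⟨hne.symm, hQ'⟩)
    omega
  have hRn' : Q ∪ Q' ∉ (QQ.erase Q).erase Q' := fun hc => hRn (Finset.mem_of_mem_erase (Finset.mem_of_mem_erase hc))
  have disjR : ∀ X ∈ QQ, X ≠ Q → X ≠ Q' →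
      interior (convexHull ℝ ((Q ∪ Q' : Finset Pt) : Set Pt)) ∩ interior (convexHull ℝ (X : Set Pt)) = ∅ := by
    intro X hX h1 h2
    by_contra hcon
    refine open_meets (isOpen_interior.inter isOpen_interior) (Set.nonempty_iff_ne_empty.2 hcon) (hull_closed Q)
      (B := convexHull ℝ (Q' : Set Pt)) (C := convexHull ℝ (X : Set Pt)) ?_ Set.inter_subset_right
      (hI.disj Q hQ X hX h1.symm) (hI.disj Q' hQ' X hX h2.symm)
    exact fun z hz => h.hull (interior_subset hz.1)
  refine ⟨?_, hF⟩
  constructor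
  · intro X hX
    rcases hmem hX with rfl | ⟨hX, -, -⟩
    · exact h.poly
    · exact hI.poly X hX
  · intro X hX
    rcases hmem hX with rfl | ⟨hX, -, -⟩
    · exact Finset.union_subset (hI.sub Q hQ) (hI.sub Q' hQ')
    · exact hI.sub X hX
  · intro X hX u v huv
    rcases hmem hX with rfl | ⟨hX, -, -⟩
    · rcases h.side_of huv with ⟨h1, -⟩ | ⟨h1, -⟩
      · exact hI.sides Q hQ u v h1
      · exact hI.sides Q' hQ' u v h1
    · exact hI.sides X hX u v huv
  · intro X hX s hs hsh
    rcases hmem hX with rfl | ⟨hX, -, -⟩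
    · rcases h.hull hsh with h1 | h1
      · exact Finset.mem_union_left _ (hI.empt Q hQ s hs h1)
      · exact Finset.mem_union_right _ (hI.empt Q' hQ' s hs h1)
    · exact hI.empt X hX s hs hsh
  · intro X hX Y hY hXY
    rcases hmem hX with rfl | ⟨hX, h1, h2⟩ <;> rcases hmem hY with rfl | ⟨hY, h3, h4⟩
    · exact absurd rfl hXY
    · exact disjR Y hY h3 h4
    · rw [Set.inter_comm]; exact disjR X hX h1 h2
    · exact hI.disj X hX Y hY hXY
  · intro e he
    rcases Finset.mem_insert.1 he with rfl | he
    · exact hI.sides Q hQ p q h.hpq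
    · exact hI.FT he
  · intro e he
    rcases Finset.mem_insert.1 he with rfl | he
    · refine ⟨Q ∪ Q', Finset.mem_insert_self _ _, p, Finset.mem_union_left _ h.hpq.1, q, Finset.mem_union_left _ h.hpq.2.1,
        rfl, ⟨a, Finset.mem_union_left _ h.hap.1, f1⟩, b, Finset.mem_union_right _ h.hpb.2.1, ?_⟩
      rw [ori_swap] at f3; linarith
    · obtain ⟨X, hX, p', hp', q', hq', he, ⟨r, hr, hr0⟩, r', hr', hr0'⟩ := hI.diag _ he
      by_cases h1 : X = Q ∨ X = Q'
      · have hsub : X ⊆ Q ∪ Q' := by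
          rcases h1 with rfl | rfl
          · exact Finset.subset_union_left
          · exact Finset.subset_union_right
        exact ⟨Q ∪ Q', Finset.mem_insert_self _ _, p', hsub hp', q', hsub hq', he, ⟨r, hsub hr, hr0⟩, r', hsub hr', hr0'⟩
      · push Not at h1
        exact ⟨X, hmem' hX h1.1 h1.2, p', hp', q', hq', he, ⟨r, hr, hr0⟩, r', hr', hr0'⟩
  · rw [Finset.card_insert_of_notMem hF, Finset.card_insert_of_notMem hRn']
    have := hI.count
    omega
  · rw [Finset.sum_insert hRn', Finset.card_insert_of_notMem hRn']
    have h1 := hI.sum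
    have h2 := Finset.add_sum_erase QQ (fun X => X.card) hQ
    have h3 := Finset.add_sum_erase (QQ.erase Q) (fun X => X.card) (Finset.mem_erase.2 ⟨hne.symm, hQ'⟩)
    have h4 := h.card
    omega
  · intro X hX u v huv r hr hr0
    have key : ∀ Y ∈ QQ, IsSide Y v u → ¬ (v = p ∧ u = q) → ¬ (v = q ∧ u = p) →
        ∃ Z ∈ insert (Q ∪ Q') ((QQ.erase Q).erase Q'), IsSide Z v u := by
      intro Y hY hvu n1 n2
      by_cases h1 : Y = Q
      · subst h1
        exact ⟨_, Finset.mem_insert_self _ _, h.side hvu n1⟩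
      by_cases h2 : Y = Q'
      · subst h2
        exact ⟨_, Finset.mem_insert_self _ _, h.side' hvu n2⟩
      exact ⟨Y, hmem' hY h1 h2, hvu⟩
    rcases hmem hX with rfl | ⟨hX, n1, n2⟩
    · rcases h.side_of huv with ⟨h1, h2⟩ | ⟨h1, h2⟩
      · obtain ⟨Y, hY, hvu⟩ := hI.rev Q hQ u v h1 r hr hr0
        refine key Y hY hvu ?_ ?_
        · rintro ⟨rfl, rfl⟩; exact h.hQ.not_both h1 h.hpq
        · rintro ⟨rfl, rfl⟩; exact h2 ⟨rfl, rfl⟩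
      · obtain ⟨Y, hY, hvu⟩ := hI.rev Q' hQ' u v h1 r hr hr0
        refine key Y hY hvu ?_ ?_
        · rintro ⟨rfl, rfl⟩; exact h2 ⟨rfl, rfl⟩
        · rintro ⟨rfl, rfl⟩; exact h.hQ'.not_both h1 h.hqp
    · obtain ⟨Y, hY, hvu⟩ := hI.rev X hX u v huv r hr hr0
      refine key Y hY hvu ?_ ?_
      · rintro ⟨rfl, rfl⟩; exact n2 (hI.side_unique hX hQ' huv h.hqp)
      · rintro ⟨rfl, rfl⟩; exact n1 (hI.side_unique hX hQ huv h.hpq)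

/-- `p q` is reflex at `p`. -/
def Rfx (QQ : Finset (Finset Pt)) (p q : Pt) : Prop :=
  ∃ Q ∈ QQ, ∃ Q' ∈ QQ, ∃ a b, IsSide Q p q ∧ IsSide Q a p ∧ IsSide Q' q p ∧ IsSide Q' p b ∧ ori a p b < 0

/-- `p q` is an interior (directed) edge of the subdivision. -/
def IE (QQ : Finset (Finset Pt)) (p q : Pt) : Prop :=
  (∃ Q ∈ QQ, IsSide Q p q) ∧ ∃ Q' ∈ QQ, IsSide Q' q p

lemma exists_max {S : Finset Pt} (hS : GenPos S) {T : PlaneGraph S} (hT : IsTriangulation T) :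
    ∃ QQ F, PInv T QQ F ∧ ∀ p q, IE QQ p q → Rfx QQ p q ∨ Rfx QQ q p := by
  have hP : ∃ n, ∃ QQ F, PInv T QQ F ∧ QQ.card = n := ⟨_, _, _, inv_start hS hT, rfl⟩
  obtain ⟨QQ, F, hI, hn⟩ := Nat.find_spec hP
  refine ⟨QQ, F, hI, ?_⟩
  rintro p q ⟨⟨Q, hQ, hpq⟩, Q', hQ', hqp⟩
  by_contra hcon
  push Not at hcon
  obtain ⟨n1, n2⟩ := hcon
  obtain ⟨a, hap⟩ := (hI.poly Q hQ).pred hpq.1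
  obtain ⟨c, hqc⟩ := (hI.poly Q hQ).2 q hpq.2.1
  obtain ⟨d, hdq⟩ := (hI.poly Q' hQ').pred hqp.1
  obtain ⟨b, hpb⟩ := (hI.poly Q' hQ').2 p hqp.2.1
  have haq : a ≠ q := by rintro rfl; exact (hI.poly Q hQ).not_both hpq hap
  have hcp : c ≠ p := by rintro rfl; exact (hI.poly Q hQ).not_both hpq hqc
  have hbq : b ≠ q := by rintro rfl; exact (hI.poly Q' hQ').not_both hqp hpb
  have hdp : d ≠ p := by rintro rfl; exact (hI.poly Q' hQ').not_both hqp hdq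
  have f1 := hpq.2.2.2 a hap.1 hap.2.2.1 haq
  have f2 := hpq.2.2.2 c hqc.2.1 hcp hqc.2.2.1.symm
  have f3 := hqp.2.2.2 b hpb.2.1 hbq hpb.2.2.1.symm
  have f4 := hqp.2.2.2 d hdq.1 hdq.2.2.1 hdp
  rw [ori_swap] at f3 f4
  have hab : a ≠ b := by rintro rfl; linarith
  have hdc : d ≠ c := by rintro rfl; linarith
  have hsQ := hI.sub Q hQ
  have hsQ' := hI.sub Q' hQ'
  have g1 : 0 < ori a p b := by
    have := hS.ori_ne (hsQ hap.1) (hsQ hap.2.1) (hsQ' hpb.2.1) hap.2.2.1 hab hpb.2.2.1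
    refine lt_of_le_of_ne ?_ this.symm
    by_contra hlt
    exact n1 ⟨Q, hQ, Q', hQ', a, b, hpq, hap, hqp, hpb, not_le.1 hlt⟩
  have g2 : 0 < ori d q c := by
    have := hS.ori_ne (hsQ' hdq.1) (hsQ' hdq.2.1) (hsQ hqc.2.1) hdq.2.2.1 hdc hqc.2.2.1
    refine lt_of_le_of_ne ?_ this.symm
    by_contra hlt
    exact n2 ⟨Q', hQ', Q, hQ, d, c, hqp, hdq, hpq, hqc, not_le.1 hlt⟩
  have hM : MergeData S Q Q' p q a b c d := ⟨hI.poly Q hQ, hI.poly Q' hQ', hpq, hap, hqc, hqp, hpb, hdq, g1, g2⟩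
  obtain ⟨hI', hF⟩ := merge hI hQ hQ' hM
  have h1 := hI'.count
  have h2 := hI.count
  rw [Finset.card_insert_of_notMem hF] at h1
  exact Nat.find_min hP (m := (insert (Q ∪ Q') ((QQ.erase Q).erase Q')).card) (by omega) ⟨_, _, hI', rfl⟩

lemma PInv.flippable {S : Finset Pt} (hS : GenPos S) {T : PlaneGraph S} {QQ : Finset (Finset Pt)} {F : Finset (Sym2 Pt)}
    (hI : PInv T QQ F) : IsPsFlippable T F := by
  refine ⟨hI.FT, QQ, ?_, hI.disj, ?_⟩
  · intro Q hQ
    refine ⟨by exact_mod_cast hI.sub Q hQ, (hI.poly Q hQ).1, (hI.poly Q hQ).convexPos, ?_, ?_⟩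
    · intro p q hpq
      rcases hullEdge_side hS (hI.sub Q hQ) hpq with h | h
      · exact hI.sides Q hQ p q h
      · rw [Sym2.eq_swap]; exact hI.sides Q hQ q p h
    · intro p hp hpi
      exact (hI.poly Q hQ).not_interior (hI.empt Q hQ p hp (interior_subset hpi)) hpi
  · intro e he
    obtain ⟨Q, hQ, p, hp, q, hq, rfl, ⟨r, hr, h1⟩, r', hr', h2⟩ := hI.diag e he
    refine ⟨Q, hQ, p, hp, q, hq, rfl, ?_⟩
    exact diag_interior (convex_convexHull ℝ _) (subset_convexHull _ _ hp) (subset_convexHull _ _ hq)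
      (subset_convexHull _ _ hr) (subset_convexHull _ _ hr') h1 h2

lemma cr_swap (a b : Pt) : cr b a = - cr a b := by unfold cr; ring

lemma sector_tri {p a b c d : Pt} (h1 : 0 < ori p a b) (h2 : 0 < ori p b c) (h3 : 0 < ori p c a)
    (da : cr (a - p) d ≠ 0) (db : cr (b - p) d ≠ 0) (dc : cr (c - p) d ≠ 0) :
    InSec p a b d ∨ InSec p b c d ∨ InSec p c a d := by
  rw [ori_cr] at h1 h2 h3
  have key : cr (b - p) (c - p) * cr (a - p) d + cr (c - p) (a - p) * cr (b - p) d +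
      cr (a - p) (b - p) * cr (c - p) d = 0 := by
    simp only [cr, Prod.fst_sub, Prod.snd_sub]; ring
  unfold InSec
  rw [cr_swap (b - p) d, cr_swap (c - p) d, cr_swap (a - p) d]
  rcases lt_or_gt_of_ne da with ha | ha
  · rcases lt_or_gt_of_ne dc with hc | hc
    · right; left
      refine ⟨?_, by linarith, h2⟩
      by_contra hb
      push Not at hb
      nlinarith [mul_pos h2 (neg_pos.2 ha), mul_pos h1 (neg_pos.2 hc), mul_nonneg h3.le (neg_nonneg.2 hb)]
    · right; right
      exact ⟨hc, by linarith, h3⟩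
  · rcases lt_or_gt_of_ne db with hb | hb
    · left; exact ⟨ha, by linarith, h1⟩
    · right; left
      refine ⟨hb, ?_, h2⟩
      by_contra hc
      push Not at hc
      nlinarith [mul_pos h2 ha, mul_pos h3 hb, mul_nonneg h1.le (show 0 ≤ cr (c - p) d by linarith)]

/-- sector trichotomy for points -/
lemma sector_pt {S : Finset Pt} (hS : GenPos S) {p a b c q : Pt} (hp : p ∈ S) (ha : a ∈ S) (hb : b ∈ S)
    (hc : c ∈ S) (hq : q ∈ S) (h1 : 0 < ori p a b) (h2 : 0 < ori p b c) (h3 : 0 < ori p c a)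
    (hqp : q ≠ p) (hqa : q ≠ a) (hqb : q ≠ b) (hqc : q ≠ c) :
    (0 < ori p a q ∧ 0 < ori p q b) ∨ (0 < ori p b q ∧ 0 < ori p q c) ∨ (0 < ori p c q ∧ 0 < ori p q a) := by
  have da := hS.ori_ne hp ha hq (ori_ne_left h1.ne') hqp.symm hqa.symm
  have db := hS.ori_ne hp hb hq (ori_ne_left h2.ne') hqp.symm hqb.symm
  have dc := hS.ori_ne hp hc hq (ori_ne_left h3.ne') hqp.symm hqc.symm
  rw [ori_cr] at da db dc
  have := sector_tri h1 h2 h3 da db dc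
  unfold InSec at this
  simp only [ori_cr]
  tauto

section localStructure
variable {S : Finset Pt} {T : PlaneGraph S} {QQ : Finset (Finset Pt)} {F : Finset (Sym2 Pt)}

lemma PInv.corner (hI : PInv T QQ F) {Q : Finset Pt} (hQ : Q ∈ QQ) {p x y : Pt} (h1 : IsSide Q p x)
    (h2 : IsSide Q y p) : 0 < ori p x y := by
  refine h1.2.2.2 y h2.1 h2.2.2.1 ?_
  rintro rfl
  exact (hI.poly Q hQ).not_both h1 h2

lemma PInv.insec_unique (hI : PInv T QQ F) {Q Q' : Finset Pt} (hQ : Q ∈ QQ) (hQ' : Q' ∈ QQ) {v u w u' w' d : Pt}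
    (hv : v ∈ Q) (hu : u ∈ Q) (hw : w ∈ Q) (hv' : v ∈ Q') (hu' : u' ∈ Q') (hw' : w' ∈ Q')
    (h : InSec v u w d) (h' : InSec v u' w' d) : Q = Q' := by
  by_contra hne
  have := h.overlap (convex_convexHull ℝ (Q : Set Pt)) (convex_convexHull ℝ (Q' : Set Pt))
    (subset_convexHull ℝ _ hv) (subset_convexHull ℝ _ hu) (subset_convexHull ℝ _ hw)
    (subset_convexHull ℝ _ hv') (subset_convexHull ℝ _ hu') (subset_convexHull ℝ _ hw') h'
  rw [hI.disj Q hQ Q' hQ' hne] at this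
  simp at this

lemma PInv.corner_unique (hI : PInv T QQ F) {Q Q' : Finset Pt} (hQ : Q ∈ QQ) (hQ' : Q' ∈ QQ) {p x y x' : Pt}
    (h1 : IsSide Q p x) (h2 : IsSide Q y p) (h3 : IsSide Q' p x') (k1 : 0 < ori p x x') (k2 : 0 < ori p x' y) :
    Q = Q' := by
  obtain ⟨y', hy'⟩ := (hI.poly Q' hQ').pred h3.1
  have c1 := hI.corner hQ h1 h2
  have c2 := hI.corner hQ' h3 hy'
  rw [ori_cr] at c1 c2 k1 k2
  obtain ⟨δ, ⟨e1, e2⟩, hδ⟩ := (((small_ev (cr (x - p) (y' - p)) k1).and (small_ev (cr (y' - p) (y - p)) k2)).and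
    self_mem_nhdsWithin).exists
  have hδ' : (0:ℝ) < δ := hδ
  refine hI.insec_unique hQ hQ' (v := p) (u := x) (w := y) (u' := x') (w' := y') (d := (x' - p) + δ • (y' - p))
    h1.1 h1.2.1 h2.1 h3.1 h3.2.1 hy'.1 ⟨?_, ?_, c1⟩ ⟨?_, ?_, c2⟩
  · convert e1 using 1
    simp only [cr, Prod.fst_sub, Prod.snd_sub, Prod.fst_add, Prod.snd_add, Prod.smul_fst, Prod.smul_snd, smul_eq_mul]; ring
  · convert e2 using 1
    simp only [cr, Prod.fst_sub, Prod.snd_sub, Prod.fst_add, Prod.snd_add, Prod.smul_fst, Prod.smul_snd, smul_eq_mul]; ring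
  · have : cr (x' - p) ((x' - p) + δ • (y' - p)) = δ * cr (x' - p) (y' - p) := by
      simp only [cr, Prod.fst_sub, Prod.snd_sub, Prod.fst_add, Prod.snd_add, Prod.smul_fst, Prod.smul_snd, smul_eq_mul]; ring
    rw [this]; positivity
  · have : cr ((x' - p) + δ • (y' - p)) (y' - p) = cr (x' - p) (y' - p) := by
      simp only [cr, Prod.fst_sub, Prod.snd_sub, Prod.fst_add, Prod.snd_add, Prod.smul_fst, Prod.smul_snd, smul_eq_mul]; ring
    rw [this]; exact c2

/-- `x` to `y` is a corner at `p`. -/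
def Corner (QQ : Finset (Finset Pt)) (p x y : Pt) : Prop := ∃ Q ∈ QQ, IsSide Q p x ∧ IsSide Q y p

lemma Corner.fun_left (hI : PInv T QQ F) {p x y y' : Pt} (h : Corner QQ p x y) (h' : Corner QQ p x y') : y = y' := by
  obtain ⟨Q, hQ, h1, h2⟩ := h
  obtain ⟨Q', hQ', h1', h2'⟩ := h'
  have := hI.side_unique hQ hQ' h1 h1'
  subst this
  exact h2.pred_unique h2'

lemma Corner.fun_right (hI : PInv T QQ F) {p x x' y : Pt} (h : Corner QQ p x y) (h' : Corner QQ p x' y) : x = x' := by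
  obtain ⟨Q, hQ, h1, h2⟩ := h
  obtain ⟨Q', hQ', h1', h2'⟩ := h'
  have := hI.side_unique hQ hQ' h2 h2'
  subst this
  exact h1.succ_unique h1'

lemma Corner.pos (hI : PInv T QQ F) {p x y : Pt} (h : Corner QQ p x y) : 0 < ori p x y := by
  obtain ⟨Q, hQ, h1, h2⟩ := h
  exact hI.corner hQ h1 h2

lemma Corner.mem (hI : PInv T QQ F) {p x y : Pt} (h : Corner QQ p x y) : p ∈ S ∧ x ∈ S ∧ y ∈ S := by
  obtain ⟨Q, hQ, h1, h2⟩ := h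
  exact ⟨hI.sub Q hQ h1.1, hI.sub Q hQ h1.2.1, hI.sub Q hQ h2.1⟩

/-- An outgoing side strictly inside a corner is impossible. -/
lemma Corner.not_inside (hI : PInv T QQ F) {p x y x' y' : Pt} (h : Corner QQ p x y) (h' : Corner QQ p x' y')
    (k1 : 0 < ori p x x') (k2 : 0 < ori p x' y) : False := by
  obtain ⟨Q, hQ, h1, h2⟩ := h
  obtain ⟨Q', hQ', h1', h2'⟩ := h'
  have := hI.corner_unique hQ hQ' h1 h2 h1' k1 k2
  subst this
  rw [h1.succ_unique h1'] at k1
  simp at k1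

lemma rfx_iff (QQ : Finset (Finset Pt)) (p q : Pt) : Rfx QQ p q ↔
    ∃ a b, Corner QQ p q a ∧ Corner QQ p b q ∧ 0 < ori p a b := by
  constructor
  · rintro ⟨Q, hQ, Q', hQ', a, b, h1, h2, h3, h4, h5⟩
    refine ⟨a, b, ⟨Q, hQ, h1, h2⟩, ⟨Q', hQ', h4, h3⟩, ?_⟩
    rw [ori_swap] at h5; linarith
  · rintro ⟨a, b, ⟨Q, hQ, h1, h2⟩, ⟨Q', hQ', h4, h3⟩, h5⟩
    refine ⟨Q, hQ, Q', hQ', a, b, h1, h2, h3, h4, ?_⟩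
    rw [ori_swap]; linarith

lemma plucker {p a b x y : Pt} : ori p a b * ori p x y = ori p x b * ori p a y - ori p a x * ori p y b := by
  unfold ori; ring

lemma rfx_pair (hS : GenPos S) (hI : PInv T QQ F) {p q₁ q₂ : Pt} (h1 : Rfx QQ p q₁) (h2 : Rfx QQ p q₂)
    (hne : q₁ ≠ q₂) : Corner QQ p q₁ q₂ ∨ Corner QQ p q₂ q₁ := by
  rw [rfx_iff] at h1 h2
  obtain ⟨a₁, b₁, c1, c1', n1⟩ := h1
  obtain ⟨a₂, b₂, c2, c2', n2⟩ := h2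
  by_contra hcon
  push Not at hcon
  obtain ⟨m1, m2⟩ := hcon
  have ha1 : q₂ ≠ a₁ := by rintro rfl; exact m1 c1
  have ha2 : q₁ ≠ a₂ := by rintro rfl; exact m2 c2
  have hb1 : q₂ ≠ b₁ := by rintro rfl; exact m2 c1'
  have hb2 : q₁ ≠ b₂ := by rintro rfl; exact m1 c2'
  have p1 := c1.pos hI
  have p1' := c1'.pos hI
  have p2 := c2.pos hI
  have p2' := c2'.pos hI
  obtain ⟨hp, hq1, hA1⟩ := c1.mem hI
  obtain ⟨-, hq2, hA2⟩ := c2.mem hI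
  have hB1 := (c1'.mem hI).2.1
  have hB2 := (c2'.mem hI).2.1
  have hq1p : q₁ ≠ p := (ori_ne_left p1.ne').symm
  have hq2p : q₂ ≠ p := (ori_ne_left p2.ne').symm
  have s1 : 0 < ori p a₁ q₂ ∧ 0 < ori p q₂ b₁ := by
    rcases sector_pt hS hp hq1 hA1 hB1 hq2 p1 n1 p1' hq2p hne.symm ha1 hb1 with h | h | h
    · exact (c1.not_inside hI c2 h.1 h.2).elim
    · exact h
    · exact (c1'.not_inside hI c2 h.1 h.2).elim
  have s2 : 0 < ori p a₂ q₁ ∧ 0 < ori p q₁ b₂ := by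
    rcases sector_pt hS hp hq2 hA2 hB2 hq1 p2 n2 p2' hq1p hne ha2 hb2 with h | h | h
    · exact (c2.not_inside hI c1 h.1 h.2).elim
    · exact h
    · exact (c2'.not_inside hI c1 h.1 h.2).elim
  have t1 : 0 ≤ ori p a₂ b₁ := by
    by_contra hlt
    push Not at hlt
    exact c2.not_inside hI c1' s1.2 (by rw [ori_swap2]; linarith)
  have t2 : 0 ≤ ori p a₁ b₂ := by
    by_contra hlt
    push Not at hlt
    exact c1.not_inside hI c2' s2.2 (by rw [ori_swap2]; linarith)
  -- now contradiction
  have e1 := plucker (p := p) (a := a₁) (b := b₁) (x := b₂) (y := q₂)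
  have e2 := plucker (p := p) (a := a₁) (b := b₁) (x := q₂) (y := a₂)
  have e3 := plucker (p := p) (a := a₁) (b := b₁) (x := b₂) (y := a₂)
  have g1 : 0 < ori p b₂ b₁ * ori p a₁ q₂ - ori p a₁ b₂ * ori p q₂ b₁ := by rw [← e1]; positivity
  have g2 : 0 < ori p q₂ b₁ * ori p a₁ a₂ - ori p a₁ q₂ * ori p a₂ b₁ := by rw [← e2]; positivity
  have g3 : ori p b₂ b₁ * ori p a₁ a₂ - ori p a₁ b₂ * ori p a₂ b₁ < 0 := by
    rw [← e3]
    have : ori p b₂ a₂ < 0 := by rw [ori_swap2]; linarith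
    nlinarith [mul_pos n1 (neg_pos.2 this)]
  obtain ⟨sa, sb⟩ := s1
  have B1 : 0 < ori p b₂ b₁ := by
    have h0 : 0 < ori p b₂ b₁ * ori p a₁ q₂ := by nlinarith [mul_nonneg t2 sb.le]
    exact pos_of_mul_pos_left h0 sa.le
  have A2 : 0 < ori p a₁ a₂ := by
    have h0 : 0 < ori p q₂ b₁ * ori p a₁ a₂ := by nlinarith [mul_nonneg sa.le t1]
    exact pos_of_mul_pos_right h0 sb.le
  -- B1 * Q2 > B2 * Q1, Q1 * A2 > Q2 * A1
  have f1 : 0 < (ori p b₂ b₁ * ori p a₁ q₂ - ori p a₁ b₂ * ori p q₂ b₁) * ori p a₁ a₂ := mul_pos g1 A2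
  have f2 : 0 ≤ (ori p q₂ b₁ * ori p a₁ a₂ - ori p a₁ q₂ * ori p a₂ b₁) * ori p a₁ b₂ := mul_nonneg g2.le t2
  have f3 : 0 < ori p a₁ q₂ * (ori p b₂ b₁ * ori p a₁ a₂ - ori p a₁ b₂ * ori p a₂ b₁) := by nlinarith
  nlinarith [mul_pos sa (neg_pos.2 g3)]

/-- a vertex of degree three inside the triangle of its neighbours -/
def FullAt (QQ : Finset (Finset Pt)) (p a b c : Pt) : Prop :=
  Corner QQ p a b ∧ Corner QQ p b c ∧ Corner QQ p c a

lemma three_rfx (hS : GenPos S) (hI : PInv T QQ F) {p q₁ q₂ q₃ : Pt} (h1 : Rfx QQ p q₁) (h2 : Rfx QQ p q₂)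
    (h3 : Rfx QQ p q₃) (n12 : q₁ ≠ q₂) (n13 : q₁ ≠ q₃) (n23 : q₂ ≠ q₃) : ∃ a b c, FullAt QQ p a b c := by
  rcases rfx_pair hS hI h1 h2 n12 with h12 | h21
  · rcases rfx_pair hS hI h2 h3 n23 with h23 | h32
    · rcases rfx_pair hS hI h1 h3 n13 with h13 | h31
      · exact absurd (h12.fun_left hI h13) n23
      · exact ⟨_, _, _, h12, h23, h31⟩
    · exact absurd (h12.fun_right hI h32) n13
  · rcases rfx_pair hS hI h2 h3 n23 with h23 | h32
    · exact absurd (h21.fun_left hI h23) n13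
    · rcases rfx_pair hS hI h1 h3 n13 with h13 | h31
      · exact ⟨_, _, _, h13, h32, h21⟩
      · exact absurd (h32.fun_left hI h31) (Ne.symm n12)

lemma IE.corner (hI : PInv T QQ F) {p q : Pt} (h : IE QQ p q) : ∃ a b, Corner QQ p q a ∧ Corner QQ p b q := by
  obtain ⟨⟨Q, hQ, h1⟩, Q', hQ', h2⟩ := h
  obtain ⟨a, ha⟩ := (hI.poly Q hQ).pred h1.1
  obtain ⟨b, hb⟩ := (hI.poly Q' hQ').2 p h2.2.1
  exact ⟨a, b, ⟨Q, hQ, h1, ha⟩, ⟨Q', hQ', hb, h2⟩⟩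

lemma IE.symm {p q : Pt} (h : IE QQ p q) : IE QQ q p := ⟨h.2, h.1⟩

lemma full_nbrs (hS : GenPos S) (hI : PInv T QQ F) {p a b c q : Pt} (h : FullAt QQ p a b c) (hq : IE QQ p q) :
    q = a ∨ q = b ∨ q = c := by
  obtain ⟨h1, h2, h3⟩ := h
  obtain ⟨x, y, hx, hy⟩ := hq.corner hI
  by_contra hcon
  push Not at hcon
  have hqp : q ≠ p := (ori_ne_left (hx.pos hI).ne').symm
  rcases sector_pt hS (h1.mem hI).1 (h1.mem hI).2.1 (h1.mem hI).2.2 (h2.mem hI).2.2 (hx.mem hI).2.1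
    (h1.pos hI) (h2.pos hI) (h3.pos hI) hqp hcon.1 hcon.2.1 hcon.2.2 with h | h | h
  · exact h1.not_inside hI hx h.1 h.2
  · exact h2.not_inside hI hx h.1 h.2
  · exact h3.not_inside hI hx h.1 h.2

lemma full_IE {p a b c : Pt} (h : FullAt QQ p a b c) : IE QQ p a ∧ IE QQ p b ∧ IE QQ p c := by
  obtain ⟨⟨Q1, hQ1, x1, y1⟩, ⟨Q2, hQ2, x2, y2⟩, ⟨Q3, hQ3, x3, y3⟩⟩ := h
  exact ⟨⟨⟨Q1, hQ1, x1⟩, Q3, hQ3, y3⟩, ⟨⟨Q2, hQ2, x2⟩, Q1, hQ1, y1⟩, ⟨⟨Q3, hQ3, x3⟩, Q2, hQ2, y2⟩⟩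

end localStructure

/-- The direction `d` is generic for `S`. -/
def GenDir (S : Finset Pt) (d : Pt) : Prop := ∀ p ∈ S, ∀ q ∈ S, p ≠ q → cr (q - p) d ≠ 0

lemma cr_neg (a d : Pt) : cr a (-d) = - cr a d := by
  simp only [cr, Prod.fst_neg, Prod.snd_neg]; ring

lemma neg_cr (a d : Pt) : cr (-d) a = - cr d a := by
  simp only [cr, Prod.fst_neg, Prod.snd_neg]; ring

lemma GenDir.neg {S : Finset Pt} {d : Pt} (h : GenDir S d) : GenDir S (-d) := by
  intro p hp q hq hpq
  rw [cr_neg]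
  exact neg_ne_zero.2 (h p hp q hq hpq)

lemma exists_genDir (S : Finset Pt) : ∃ d, GenDir S d ∧ d ≠ 0 := by
  obtain ⟨m, hm⟩ := Infinite.exists_notMem_finset
    ((S ×ˢ S).image (fun x : Pt × Pt => (x.2.2 - x.1.2) / (x.2.1 - x.1.1)))
  refine ⟨(1, m), ?_, by simp [Prod.ext_iff]⟩
  intro p hp q hq hpq h
  simp only [cr, Prod.fst_sub, Prod.snd_sub] at h
  by_cases hx : q.1 = p.1
  · apply hpq
    rw [hx] at h
    exact Prod.ext hx.symm (by linarith)
  · apply hm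
    refine Finset.mem_image.2 ⟨(p, q), Finset.mem_product.2 ⟨hp, hq⟩, ?_⟩
    have : q.1 - p.1 ≠ 0 := sub_ne_zero.2 hx
    simp only
    field_simp
    linarith

/-- The direction `d` at `v` points strictly into the hull of `S`. -/
def Slot (S : Finset Pt) (v d : Pt) : Prop := ∃ u ∈ S, ∃ w ∈ S, InSec v u w d

/-- `p` is interior to the hull. -/
def Intr (S : Finset Pt) (p : Pt) : Prop :=
  ∃ a ∈ S, ∃ b ∈ S, ∃ c ∈ S, 0 < ori p a b ∧ 0 < ori p b c ∧ 0 < ori p c a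

lemma Intr.slot {S : Finset Pt} {p d : Pt} (hd : GenDir S d) (hp : p ∈ S) (h : Intr S p) : Slot S p d := by
  obtain ⟨a, ha, b, hb, c, hc, h1, h2, h3⟩ := h
  rcases sector_tri h1 h2 h3 (hd p hp a ha (ori_ne_left h1.ne')) (hd p hp b hb (ori_ne_left h2.ne'))
    (hd p hp c hc (ori_ne_left h3.ne')) with h | h | h
  · exact ⟨a, ha, b, hb, h⟩
  · exact ⟨b, hb, c, hc, h⟩
  · exact ⟨c, hc, a, ha, h⟩

/-- There is a neighbour on each side. -/
lemma nbr_exists {S : Finset Pt} (hS : GenPos S) {T : PlaneGraph S} (hT : IsTriangulation T) {v u d : Pt}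
    (hv : v ∈ S) (hu : u ∈ S) (huv : 0 < cr (u - v) d) :
    ∃ q, s(v, q) ∈ T.edges ∧ 0 < cr (q - v) d := by
  by_contra hcon
  push Not at hcon
  have e : ∀ z, ori v (v - d) z = cr (z - v) d := by
    intro z; simp only [ori, cr, Prod.fst_sub, Prod.snd_sub]; ring
  obtain ⟨w, hw, hw0, hfree⟩ := visible_exists (T := T) (A := v) (B := v - d) (x := v) (u := u) (by rw [e]; simp [cr])
    (by
      intro g hg hvg z hz
      induction g using Sym2.ind with
      | _ a b =>
        have hab : a ≠ b := by simpa using T.not_isDiag _ hg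
        have hends := hS.mem_seg (T.endpoint_mem _ hg a (by simp)) (T.endpoint_mem _ hg b (by simp)) hv hab hvg
        have hz' : z ∈ segment ℝ a b := hz
        obtain ⟨s, t, hs, ht, hst, rfl⟩ := hz'
        rw [ori_comb _ _ _ _ _ _ hst, e, e]
        rcases hends with rfl | rfl
        · have := hcon b hg
          have e0 : cr (v - v) d = 0 := by simp [cr]
          rw [e0]; nlinarith
        · have := hcon a (by rw [Sym2.eq_swap]; exact hg)
          have e0 : cr (v - v) d = 0 := by simp [cr]
          rw [e0]; nlinarith)
    (by
      intro a ha b hb hab hbv ha0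
      refine hS.ori_ne ha hb hv hab ?_ hbv
      rintro rfl
      simp at ha0)
    hu (by rw [e]; exact huv)
  rw [e] at hw0
  have hvw : v ≠ w := by
    rintro rfl; simp [cr] at hw0
  have := hcon w (add_edge hS hT hv hw hvw (fun g hg _ => hfree g hg))
  linarith

lemma slot_face {S : Finset Pt} (hS : GenPos S) {T : PlaneGraph S} (hT : IsTriangulation T) {v d : Pt}
    (hd : GenDir S d) (hv : v ∈ S) (h : Slot S v d) :
    ∃ Q ∈ faces T, ∃ q r, Q = {v, q, r} ∧ InSec v q r d := by
  obtain ⟨u, hu, w, hw, h1, h2, h3⟩ := h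
  obtain ⟨q0, hq0, hq0d⟩ := nbr_exists hS hT hv hu h1
  let f : Pt → ℝ := fun q => ((q - v).1 * d.1 + (q - v).2 * d.2) / cr (q - v) d
  obtain ⟨q, hq, hmax⟩ := Finset.exists_max_image
    (S.filter (fun q => s(v, q) ∈ T.edges ∧ 0 < cr (q - v) d)) f
    ⟨q0, Finset.mem_filter.2 ⟨T.endpoint_mem _ hq0 q0 (by simp), hq0, hq0d⟩⟩
  obtain ⟨hqS, hqe, hqd⟩ := Finset.mem_filter.1 hq
  have hlt : ∃ z ∈ S, 0 < ori v q z := by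
    by_contra hcon
    push Not at hcon
    have k1 := hcon u hu
    have k2 := hcon w hw
    rw [ori_cr] at k1 k2
    have key : cr (q - v) (u - v) * cr d (w - v) + cr (q - v) (w - v) * cr (u - v) d
        = cr (q - v) d * cr (u - v) (w - v) := by
      unfold cr; ring
    have := mul_pos hqd h3
    nlinarith
  obtain ⟨z, hz, hz0⟩ := hlt
  obtain ⟨r, hr, hface⟩ := apex_face hS hT hqe hz hz0
  refine ⟨_, mem_faces.2 hface, q, r, rfl, hqd, ?_, by rw [ori_cr] at hr; exact hr⟩
  have hrS : r ∈ S := hface.1 (by simp)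
  have hvr : v ≠ r := ori_ne_mid hr.ne'
  rw [cr_swap]
  by_contra hcon
  have hne := hd v hv r hrS hvr
  have hpos : 0 < cr (r - v) d := lt_of_le_of_ne (by linarith) (Ne.symm hne)
  have hre : s(v, r) ∈ T.edges := hface.2.2.1 v (by simp) r (by simp) hvr
  have := hmax r (Finset.mem_filter.2 ⟨hrS, hre, hpos⟩)
  simp only [f] at this
  rw [div_le_div_iff₀ hpos hqd] at this
  rw [ori_cr] at hr
  have key : ((r - v).1 * d.1 + (r - v).2 * d.2) * cr (q - v) d - ((q - v).1 * d.1 + (q - v).2 * d.2) * cr (r - v) d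
     = (d.1 ^ 2 + d.2 ^ 2) * cr (q - v) (r - v) := by
    unfold cr; ring
  have hdpos : 0 < d.1 ^ 2 + d.2 ^ 2 := by
    by_contra hc
    have a1 : d.1 = 0 := by nlinarith [sq_nonneg d.1, sq_nonneg d.2]
    have a2 : d.2 = 0 := by nlinarith [sq_nonneg d.1, sq_nonneg d.2]
    simp [cr, a1, a2] at hqd
  have := mul_pos hdpos hr
  linarith

/-- The set of slots. -/
def slots (S : Finset Pt) (d0 : Pt) : Finset (Pt × Pt) :=
  (S ×ˢ {d0, -d0}).filter (fun x => Slot S x.1 x.2)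

lemma mem_slots {S : Finset Pt} {d0 : Pt} {x : Pt × Pt} :
    x ∈ slots S d0 ↔ x.1 ∈ S ∧ (x.2 = d0 ∨ x.2 = -d0) ∧ Slot S x.1 x.2 := by
  simp [slots, and_assoc]

/-- A triangle has only one slot. -/
lemma insec_tri_unique {v q r v' q' r' d d' d0 : Pt} (hd : d = d0 ∨ d = -d0) (hd' : d' = d0 ∨ d' = -d0)
    (h : InSec v q r d) (h' : InSec v' q' r' d') (he : ({v, q, r} : Finset Pt) = {v', q', r'}) : v = v' ∧ d = d' := by
  obtain ⟨h1, h2, h3⟩ := h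
  obtain ⟨h1', h2', h3'⟩ := h'
  have m1 : v' ∈ ({v, q, r} : Finset Pt) := by rw [he]; simp
  have m2 : q' ∈ ({v, q, r} : Finset Pt) := by rw [he]; simp
  have m3 : r' ∈ ({v, q, r} : Finset Pt) := by rw [he]; simp
  simp only [Finset.mem_insert, Finset.mem_singleton] at m1 m2 m3
  simp only [cr, Prod.fst_sub, Prod.snd_sub] at h1 h2 h3 h1' h2' h3'
  rcases hd with rfl | rfl <;> rcases hd' with rfl | rfl <;>
  rcases m1 with rfl | rfl | rfl <;> rcases m2 with rfl | rfl | rfl <;> rcases m3 with rfl | rfl | rfl <;>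
  (try simp only [Prod.fst_neg, Prod.snd_neg] at h1 h2 h1' h2') <;>
  first
  | exact ⟨rfl, rfl⟩
  | (exfalso; linarith)

lemma slots_le {S : Finset Pt} (hS : GenPos S) {T : PlaneGraph S} (hT : IsTriangulation T) {d0 : Pt}
    (hd : GenDir S d0) : (slots S d0).card ≤ (faces T).card := by
  have H : ∀ x ∈ slots S d0, ∃ Q ∈ faces T, ∃ q r, Q = {x.1, q, r} ∧ InSec x.1 q r x.2 := by
    intro x hx
    obtain ⟨h1, h2, h3⟩ := mem_slots.1 hx
    have : GenDir S x.2 := by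
      rcases h2 with h | h <;> rw [h]
      · exact hd
      · exact hd.neg
    exact slot_face hS hT this h1 h3
  choose! f hf using H
  refine Finset.card_le_card_of_injOn f (fun x hx => (hf x hx).1) ?_
  intro x hx y hy hxy
  obtain ⟨q, r, e, h⟩ := (hf x hx).2
  obtain ⟨q', r', e', h'⟩ := (hf y hy).2
  obtain ⟨a1, a2⟩ := insec_tri_unique (mem_slots.1 hx).2.1 (mem_slots.1 hy).2.1 h h' (by rw [← e, ← e', hxy])
  exact Prod.ext a1 a2

/-- A point with points on both sides has a slot. -/
lemma slot_mid {S : Finset Pt} (hS : GenPos S) {d0 p u w : Pt} (hp : p ∈ S) (hu : u ∈ S) (hw : w ∈ S)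
    (h1 : 0 < cr (u - p) d0) (h2 : cr (w - p) d0 < 0) :
    InSec p u w d0 ∨ InSec p w u (-d0) := by
  have hpu : p ≠ u := by rintro rfl; simp [cr] at h1
  have hpw : p ≠ w := by rintro rfl; simp [cr] at h2
  have huw : u ≠ w := by rintro rfl; linarith
  have := hS.ori_ne hp hu hw hpu hpw huw
  rw [ori_cr] at this
  rcases lt_or_gt_of_ne this with h | h
  · right
    refine ⟨by rw [cr_neg]; linarith, by rw [neg_cr, cr_swap]; linarith, by rw [cr_swap]; linarith⟩
  · left
    exact ⟨h1, by rw [cr_swap]; linarith, h⟩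

lemma slots_ge {S : Finset Pt} (hS : GenPos S) {d0 : Pt} (hd : GenDir S d0) (hd0 : d0 ≠ 0) :
    S.card + (S.filter (Intr S)).card ≤ (slots S d0).card + 2 := by
  rcases S.eq_empty_or_nonempty with rfl | hne
  · simp
  have hdd : d0 ≠ -d0 := by
    intro h
    apply hd0
    have h1 : d0.1 = -d0.1 := congrArg Prod.fst h
    have h2 : d0.2 = -d0.2 := congrArg Prod.snd h
    exact Prod.ext (by simp only [Prod.fst_zero]; linarith) (by simp only [Prod.snd_zero]; linarith)
  obtain ⟨M, hM, hMmax⟩ := Finset.exists_max_image S (fun p => cr p d0) hne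
  obtain ⟨m, hm, hmin⟩ := Finset.exists_min_image S (fun p => cr p d0) hne
  have csub : ∀ a b : Pt, cr (a - b) d0 = cr a d0 - cr b d0 := by
    intro a b; simp only [cr, Prod.fst_sub, Prod.snd_sub]; ring
  have hmid : ∀ p ∈ S, p ≠ M → p ≠ m → ∃ d, (p, d) ∈ slots S d0 := by
    intro p hp h1 h2
    have k1 := hMmax p hp
    have k2 := hmin p hp
    have k3 := hd p hp M hM h1
    have k4 := hd p hp m hm h2
    rw [csub] at k3 k4
    have l3 : 0 < cr (M - p) d0 := by
      rw [csub]; exact lt_of_le_of_ne (by linarith) (Ne.symm k3)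
    have l4 : cr (m - p) d0 < 0 := by
      rw [csub]; exact lt_of_le_of_ne (by linarith) k4
    rcases slot_mid hS hp hM hm l3 l4 with h | h
    · exact ⟨d0, mem_slots.2 ⟨hp, Or.inl rfl, M, hM, m, hm, h⟩⟩
    · exact ⟨-d0, mem_slots.2 ⟨hp, Or.inr rfl, m, hm, M, hM, h⟩⟩
  -- count by fibres
  have hfib : (slots S d0).card = ∑ p ∈ S, ((slots S d0).filter (fun x => x.1 = p)).card :=
    Finset.card_eq_sum_card_fiberwise (fun x hx => (mem_slots.1 hx).1)
  have hpt : ∀ p ∈ S, 1 + (if Intr S p then 1 else 0) ≤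
      ((slots S d0).filter (fun x => x.1 = p)).card + ((if p = M then 1 else 0) + (if p = m then 1 else 0)) := by
    intro p hp
    by_cases hi : Intr S p
    · have : ({(p, d0), (p, -d0)} : Finset (Pt × Pt)) ⊆ (slots S d0).filter (fun x => x.1 = p) := by
        intro x hx
        simp only [Finset.mem_insert, Finset.mem_singleton] at hx
        rcases hx with rfl | rfl
        · exact Finset.mem_filter.2 ⟨mem_slots.2 ⟨hp, Or.inl rfl, hi.slot hd hp⟩, rfl⟩
        · exact Finset.mem_filter.2 ⟨mem_slots.2 ⟨hp, Or.inr rfl, hi.slot hd.neg hp⟩, rfl⟩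
      have := Finset.card_le_card this
      rw [Finset.card_pair (by simpa using hdd)] at this
      simp only [hi, if_true]; omega
    · simp only [hi, if_false]
      by_cases h1 : p = M
      · simp only [h1, if_true]; omega
      by_cases h2 : p = m
      · simp only [h2, if_true]; omega
      obtain ⟨d, hd'⟩ := hmid p hp h1 h2
      have : 0 < ((slots S d0).filter (fun x => x.1 = p)).card :=
        Finset.card_pos.2 ⟨_, Finset.mem_filter.2 ⟨hd', rfl⟩⟩
      omega
  have hsum := Finset.sum_le_sum hpt
  rw [Finset.sum_add_distrib, Finset.sum_add_distrib, Finset.sum_add_distrib, ← hfib, ← Finset.card_filter,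
    Finset.sum_ite_eq', Finset.sum_ite_eq', if_pos hM, if_pos hm] at hsum
  simpa using hsum

section counting
variable {S : Finset Pt} {T : PlaneGraph S} {QQ : Finset (Finset Pt)} {F : Finset (Sym2 Pt)}

/-- An ear of a polygon lies on one side of its base line. -/
lemma ear_line {Q : Finset Pt} (hQ : CPoly Q) {c x y r : Pt} (h1 : IsSide Q y c) (h2 : IsSide Q c x) (hr : r ∈ Q)
    (hrc : r ≠ c) : 0 ≤ ori y x r := by
  by_cases hrx : r = x
  · simp [hrx]
  by_cases hry : r = y
  · simp [hry]
  by_contra hcon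
  have hyx : y ≠ x := by
    rintro rfl; exact hQ.not_both h1 h2
  have hpos : 0 < ori c x y := h2.2.2.2 y h1.1 h1.2.2.1 hyx
  refine hQ.convexPos r hr (mem_tri (convex_convexHull ℝ _) (a := c) (b := x) (c := y) ?_ ?_ ?_ hpos
    (h2.nonneg hr) ?_ (h1.nonneg hr))
  · exact subset_convexHull ℝ _ (by simp [h2.1, Ne.symm hrc])
  · exact subset_convexHull ℝ _ (by simp [h2.2.1, Ne.symm hrx])
  · exact subset_convexHull ℝ _ (by simp [h1.1, Ne.symm hry])
  · rw [ori_swap]; linarith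

/-- The direction `d` at `v` points into the ear `y c x`. -/
def EarAt (c x y v d : Pt) : Prop :=
  v ∈ ({c, x, y} : Finset Pt) ∧ ∃ u ∈ ({c, x, y} : Finset Pt), ∃ w ∈ ({c, x, y} : Finset Pt), InSec v u w d

lemma corner_sub {Q : Finset Pt} {c x y : Pt} (h1 : IsSide Q c x) (h2 : IsSide Q y c) :
    ({c, x, y} : Finset Pt) ⊆ Q := by
  intro z hz
  simp only [Finset.mem_insert, Finset.mem_singleton] at hz
  rcases hz with rfl | rfl | rfl
  · exact h1.1
  · exact h1.2.1
  · exact h2.1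

lemma ear_unique (hI : PInv T QQ F) {c x y c' x' y' v d : Pt} (h : Corner QQ c x y) (h' : Corner QQ c' x' y')
    (e : EarAt c x y v d) (e' : EarAt c' x' y' v d) (hne : c ≠ c') :
    (c' = x ∧ c = y') ∨ (c' = y ∧ c = x') := by
  have hpos := h.pos hI
  obtain ⟨Q, hQ, h1, h2⟩ := h
  obtain ⟨Q', hQ', h1', h2'⟩ := h'
  obtain ⟨hv, u, hu, w, hw, hs⟩ := e
  obtain ⟨hv', u', hu', w', hw', hs'⟩ := e'
  have hs1 := corner_sub h1 h2
  have hs2 := corner_sub h1' h2'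
  have := hI.insec_unique hQ hQ' (hs1 hv) (hs1 hu) (hs1 hw) (hs2 hv') (hs2 hu') (hs2 hw') hs hs'
  subst this
  by_cases k1 : c = x'
  · subst k1
    exact Or.inr ⟨h1'.pred_unique h2, rfl⟩
  by_cases k2 : c = y'
  · subst k2
    exact Or.inl ⟨h2'.succ_unique h1, rfl⟩
  exfalso
  have hP := hI.poly Q hQ
  have hyx : x ≠ y := ori_ne_right hpos.ne'
  have a1 : ∀ z ∈ convexHull ℝ ((({c, x, y} : Finset Pt)) : Set Pt), 0 ≤ ori x y z := by
    intro z hz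
    refine hull_ori ?_ hz
    intro r hr
    simp only [Finset.coe_insert, Finset.coe_singleton, Set.mem_insert_iff, Set.mem_singleton_iff] at hr
    rcases hr with rfl | rfl | rfl
    · rw [ori_cyc]; exact hpos.le
    · simp
    · simp
  have a2 : ∀ z ∈ convexHull ℝ ((({c', x', y'} : Finset Pt)) : Set Pt), 0 ≤ ori y x z := by
    intro z hz
    refine hull_ori ?_ hz
    intro r hr
    refine ear_line hP h2 h1 (hs2 hr) ?_
    simp only [Finset.coe_insert, Finset.coe_singleton, Set.mem_insert_iff, Set.mem_singleton_iff] at hr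
    rcases hr with rfl | rfl | rfl
    · exact Ne.symm hne
    · exact Ne.symm k1
    · exact Ne.symm k2
  obtain ⟨z, hz, hz'⟩ := hs.overlap (convex_convexHull ℝ ((({c, x, y} : Finset Pt)) : Set Pt))
    (convex_convexHull ℝ ((({c', x', y'} : Finset Pt)) : Set Pt))
    (subset_convexHull ℝ _ hv) (subset_convexHull ℝ _ hu) (subset_convexHull ℝ _ hw)
    (subset_convexHull ℝ _ hv') (subset_convexHull ℝ _ hu') (subset_convexHull ℝ _ hw') hs'
  have b1 := interior_half hyx a1 hz
  have b2 := interior_half hyx.symm a2 hz'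
  rw [ori_swap] at b2
  linarith

lemma tri_slot (hS : GenPos S) {d0 a b c : Pt} (hd : GenDir S d0) (ha : a ∈ S) (hb : b ∈ S) (hc : c ∈ S)
    (h : 0 < ori a b c) : ∃ d, (d = d0 ∨ d = -d0) ∧ (InSec a b c d ∨ InSec b c a d ∨ InSec c a b d) := by
  have csub : ∀ a b : Pt, cr (a - b) d0 = cr a d0 - cr b d0 := by
    intro a b; simp only [cr, Prod.fst_sub, Prod.snd_sub]; ring
  have aux : ∀ p u w, p ∈ S → u ∈ S → w ∈ S → 0 < ori p u w →
      ((0 < cr (u - p) d0 ∧ cr (w - p) d0 < 0) ∨ (0 < cr (w - p) d0 ∧ cr (u - p) d0 < 0)) →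
      ∃ d, (d = d0 ∨ d = -d0) ∧ InSec p u w d := by
    intro p u w hp hu hw ho hh
    rw [ori_cr] at ho
    rcases hh with ⟨h1, h2⟩ | ⟨h1, h2⟩
    · exact ⟨d0, Or.inl rfl, h1, by rw [cr_swap]; linarith, ho⟩
    · exact ⟨-d0, Or.inr rfl, by rw [cr_neg]; linarith, by rw [neg_cr, cr_swap]; linarith, ho⟩
  have n1 := hd a ha b hb (ori_ne_left h.ne')
  have n2 := hd b hb c hc (ori_ne_right h.ne')
  have n3 := hd a ha c hc (ori_ne_mid h.ne')
  have A := aux a b c ha hb hc h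
  have B := aux b c a hb hc ha (by rw [ori_cyc]; exact h)
  have C := aux c a b hc ha hb (by rw [ori_cyc2]; exact h)
  simp only [csub] at A B C n1 n2 n3
  by_contra hcon
  push Not at hcon
  have A' := fun hh => (by obtain ⟨d, h1, h2⟩ := A hh; exact (hcon d h1).1 h2 : False)
  have B' := fun hh => (by obtain ⟨d, h1, h2⟩ := B hh; exact (hcon d h1).2.1 h2 : False)
  have C' := fun hh => (by obtain ⟨d, h1, h2⟩ := C hh; exact (hcon d h1).2.2 h2 : False)
  rcases lt_or_gt_of_ne n1 with m1 | m1 <;> rcases lt_or_gt_of_ne n2 with m2 | m2 <;>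
    rcases lt_or_gt_of_ne n3 with m3 | m3 <;>
  first
  | exact A' (Or.inl ⟨by linarith, by linarith⟩)
  | exact A' (Or.inr ⟨by linarith, by linarith⟩)
  | exact B' (Or.inl ⟨by linarith, by linarith⟩)
  | exact B' (Or.inr ⟨by linarith, by linarith⟩)
  | exact C' (Or.inl ⟨by linarith, by linarith⟩)
  | exact C' (Or.inr ⟨by linarith, by linarith⟩)

lemma FullAt.rot {p a b c : Pt} (h : FullAt QQ p a b c) : FullAt QQ p b c a := ⟨h.2.1, h.2.2, h.1⟩

lemma full_ear_aux (hI : PInv T QQ F) {d i a b c : Pt} (hd : GenDir S d) (h : FullAt QQ i a b c) (hs : InSec a b c d) :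
    ∃ x y, Corner QQ i x y ∧ EarAt i x y a d ∧ (x = a ∨ x = b ∨ x = c) ∧ (y = a ∨ y = b ∨ y = c) := by
  obtain ⟨h1, h2, h3⟩ := h
  have p1 := h1.pos hI
  have p3 := h3.pos hI
  have hm := h1.mem hI
  have hne := hd a hm.2.1 i hm.1 (ori_ne_left p1.ne').symm
  rcases lt_or_gt_of_ne hne with hlt | hgt
  · refine ⟨a, b, h1, ⟨by simp, b, by simp, i, by simp, hs.1, by rw [cr_swap]; linarith, ?_⟩, by simp, by simp⟩
    rw [← ori_cr, ori_cyc]; exact p1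
  · refine ⟨c, a, h3, ⟨by simp, i, by simp, c, by simp, hgt, hs.2.1, ?_⟩, by simp, by simp⟩
    rw [← ori_cr, ori_cyc2]; exact p3

/-- Charging relation. -/
def Chg (QQ : Finset (Finset Pt)) (I : Finset Pt) (p q : Pt) : Prop :=
  IE QQ p q ∧ (p ∈ I ∨ (p ∉ I ∧ q ∉ I ∧ Rfx QQ p q ∧ (¬ Rfx QQ q p ∨ toLex p < toLex q)))

/-- independent set of full vertices -/
def Indep (QQ : Finset (Finset Pt)) (I : Finset Pt) : Prop := ∀ p ∈ I, ∀ q ∈ I, ¬ IE QQ p q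

lemma chg_asymm {I : Finset Pt} (hi : Indep QQ I) {p q : Pt} (h : Chg QQ I p q) (h' : Chg QQ I q p) : False := by
  obtain ⟨hpq, h⟩ := h
  obtain ⟨hqp, h'⟩ := h'
  rcases h with h | ⟨a1, a2, a3, a4⟩
  · rcases h' with h' | ⟨b1, b2, b3, b4⟩
    · exact hi p h q h' hpq
    · exact b2 h
  · rcases h' with h' | ⟨b1, b2, b3, b4⟩
    · exact a2 h'
    · rcases a4 with a4 | a4
      · exact a4 b3
      · rcases b4 with b4 | b4
        · exact b4 a3
        · exact lt_asymm a4 b4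

lemma chg_cover {I : Finset Pt} (hmax : ∀ p q, IE QQ p q → Rfx QQ p q ∨ Rfx QQ q p) {p q : Pt} (h : IE QQ p q) :
    Chg QQ I p q ∨ Chg QQ I q p := by
  by_cases hp : p ∈ I
  · exact Or.inl ⟨h, Or.inl hp⟩
  by_cases hq : q ∈ I
  · exact Or.inr ⟨h.symm, Or.inl hq⟩
  have hpq : p ≠ q := by
    obtain ⟨⟨Q, _, h⟩, _⟩ := h; exact h.2.2.1
  by_cases r1 : Rfx QQ p q
  · by_cases r2 : Rfx QQ q p
    · rcases lt_trichotomy (toLex p) (toLex q) with hl | hl | hl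
      · exact Or.inl ⟨h, Or.inr ⟨hp, hq, r1, Or.inr hl⟩⟩
      · exact absurd (toLex.injective hl) hpq
      · exact Or.inr ⟨h.symm, Or.inr ⟨hq, hp, r2, Or.inr hl⟩⟩
    · exact Or.inl ⟨h, Or.inr ⟨hp, hq, r1, Or.inl r2⟩⟩
  · have r2 := (hmax p q h).resolve_left r1
    exact Or.inr ⟨h.symm, Or.inr ⟨hq, hp, r2, Or.inl r1⟩⟩

lemma full_intr (hI : PInv T QQ F) {p a b c : Pt} (h : FullAt QQ p a b c) : Intr S p := by
  obtain ⟨h1, h2, h3⟩ := h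
  exact ⟨a, (h1.mem hI).2.1, b, (h1.mem hI).2.2, c, (h2.mem hI).2.2, h1.pos hI, h2.pos hI, h3.pos hI⟩

lemma rfx_intr (hI : PInv T QQ F) {p q : Pt} (h : Rfx QQ p q) : Intr S p := by
  rw [rfx_iff] at h
  obtain ⟨a, b, h1, h2, h3⟩ := h
  exact ⟨q, (h1.mem hI).2.1, a, (h1.mem hI).2.2, b, (h2.mem hI).2.1, h1.pos hI, h3, h2.pos hI⟩

/-- Every object owns a slot. -/
lemma own_full (hS : GenPos S) (hI : PInv T QQ F) {d0 : Pt} (hd : GenDir S d0) {I : Finset Pt} (hi : Indep QQ I) {p a b c : Pt}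
    (hp : p ∈ I) (h : FullAt QQ p a b c) : ∃ v d x y, (d = d0 ∨ d = -d0) ∧ v ∉ I ∧ Corner QQ p x y ∧ EarAt p x y v d ∧
      Chg QQ I p x ∧ Chg QQ I p y := by
  have hm1 := h.1.mem hI
  have hm2 := h.2.1.mem hI
  have hpos : 0 < ori a b c := by
    have p1 := h.1.pos hI
    have p2 := h.2.1.pos hI
    have p3 := h.2.2.pos hI
    have : ori a b c = ori p a b + ori p b c + ori p c a := by unfold ori; ring
    linarith
  obtain ⟨i1, i2, i3⟩ := full_IE h
  obtain ⟨d, hdd, hs⟩ := tri_slot hS hd hm1.2.1 hm1.2.2 hm2.2.2 hpos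
  have hgd : GenDir S d := by
    rcases hdd with h | h <;> rw [h]
    · exact hd
    · exact hd.neg
  have hIE : ∀ x, (x = a ∨ x = b ∨ x = c) → IE QQ p x := by
    rintro x (rfl | rfl | rfl) <;> assumption
  rcases hs with hs | hs | hs
  · obtain ⟨x, y, hc, he, hx, hy⟩ := full_ear_aux hI hgd h hs
    exact ⟨a, d, x, y, hdd, fun hh => hi p hp a hh i1, hc, he, ⟨hIE x hx, Or.inl hp⟩, ⟨hIE y hy, Or.inl hp⟩⟩
  · obtain ⟨x, y, hc, he, hx, hy⟩ := full_ear_aux hI hgd h.rot hs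
    exact ⟨b, d, x, y, hdd, fun hh => hi p hp b hh i2, hc, he, ⟨hIE x (by tauto), Or.inl hp⟩,
      ⟨hIE y (by tauto), Or.inl hp⟩⟩
  · obtain ⟨x, y, hc, he, hx, hy⟩ := full_ear_aux hI hgd h.rot.rot hs
    exact ⟨c, d, x, y, hdd, fun hh => hi p hp c hh i3, hc, he, ⟨hIE x (by tauto), Or.inl hp⟩,
      ⟨hIE y (by tauto), Or.inl hp⟩⟩

lemma own_pair (hS : GenPos S) (hI : PInv T QQ F) {d0 : Pt} (hd : GenDir S d0) {I : Finset Pt} {p q₁ q₂ : Pt}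
    (hp : p ∉ I) (h1 : Chg QQ I p q₁) (h2 : Chg QQ I p q₂) (hne : q₁ ≠ q₂) :
    ∃ v d x y, (d = d0 ∨ d = -d0) ∧ v ∉ I ∧ Corner QQ p x y ∧ EarAt p x y v d ∧
      Chg QQ I p x ∧ Chg QQ I p y := by
  have main : ∀ x y, Chg QQ I p x → Chg QQ I p y → Corner QQ p x y →
      ∃ v d x y, (d = d0 ∨ d = -d0) ∧ v ∉ I ∧ Corner QQ p x y ∧ EarAt p x y v d ∧
      Chg QQ I p x ∧ Chg QQ I p y := by
    intro x y hx hy hc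
    obtain ⟨m1, m2, m3⟩ := hc.mem hI
    have hxI := (hx.2.resolve_left hp).2.1
    have hyI := (hy.2.resolve_left hp).2.1
    obtain ⟨d, hdd, hs⟩ := tri_slot hS hd m1 m2 m3 (hc.pos hI)
    rcases hs with hs | hs | hs
    · exact ⟨p, d, x, y, hdd, hp, hc, ⟨by simp, x, by simp, y, by simp, hs⟩, hx, hy⟩
    · exact ⟨x, d, x, y, hdd, hxI, hc, ⟨by simp, y, by simp, p, by simp, hs⟩, hx, hy⟩
    · exact ⟨y, d, x, y, hdd, hyI, hc, ⟨by simp, p, by simp, x, by simp, hs⟩, hx, hy⟩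
  rcases rfx_pair hS hI (h1.2.resolve_left hp).2.2.1 (h2.2.resolve_left hp).2.2.1 hne with h | h
  · exact main _ _ h1 h2 h
  · exact main _ _ h2 h1 h

/-- The charged set of a vertex. -/
def chg (S : Finset Pt) (QQ : Finset (Finset Pt)) (I : Finset Pt) (p : Pt) : Finset Pt := S.filter (Chg QQ I p)

lemma slot_count (hS : GenPos S) (hI : PInv T QQ F) {d0 : Pt} (hd : GenDir S d0) (hd0 : d0 ≠ 0) {I : Finset Pt}
    (hIS : I ⊆ S) (hi : Indep QQ I) (hfull : ∀ p ∈ I, ∃ a b c, FullAt QQ p a b c) :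
    3 * I.card + (S.filter (fun p => p ∉ I ∧ 1 < (chg S QQ I p).card)).card ≤ (slots S d0).card := by
  set X := S.filter (fun p => p ∉ I ∧ 1 < (chg S QQ I p).card) with hX
  have hdd : d0 ≠ -d0 := by
    intro h
    apply hd0
    have h1 : d0.1 = -d0.1 := congrArg Prod.fst h
    have h2 : d0.2 = -d0.2 := congrArg Prod.snd h
    exact Prod.ext (by simp only [Prod.fst_zero]; linarith) (by simp only [Prod.snd_zero]; linarith)
  have hown : ∀ p ∈ I ∪ X, ∃ s : Pt × Pt, ∃ x y, (s.2 = d0 ∨ s.2 = -d0) ∧ s.1 ∉ I ∧ Corner QQ p x y ∧ EarAt p x y s.1 s.2 ∧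
      Chg QQ I p x ∧ Chg QQ I p y := by
    intro p hp
    rcases Finset.mem_union.1 hp with hp | hp
    · obtain ⟨a, b, c, h⟩ := hfull p hp
      obtain ⟨v, d, x, y, h⟩ := own_full hS hI hd hi hp h
      exact ⟨(v, d), x, y, h⟩
    · obtain ⟨_, h1, h2⟩ := Finset.mem_filter.1 hp
      obtain ⟨q₁, hq₁, q₂, hq₂, hne⟩ := Finset.one_lt_card.1 h2
      obtain ⟨v, d, x, y, h⟩ := own_pair hS hI hd h1 (Finset.mem_filter.1 hq₁).2 (Finset.mem_filter.1 hq₂).2 hne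
      exact ⟨(v, d), x, y, h⟩
  choose! g gx gy hg using hown
  have hA : (I ∪ X).card ≤ ((slots S d0).filter (fun s => s.1 ∉ I)).card := by
    refine Finset.card_le_card_of_injOn g ?_ ?_
    · intro p hp
      obtain ⟨h1, h2, h3, ⟨h4, u, hu, w, hw, h5⟩, -⟩ := hg p hp
      have hsub : ({p, gx p, gy p} : Finset Pt) ⊆ S := by
        obtain ⟨m1, m2, m3⟩ := h3.mem hI
        intro z hz
        simp only [Finset.mem_insert, Finset.mem_singleton] at hz
        rcases hz with rfl | rfl | rfl <;> assumption
      exact Finset.mem_coe.2 (Finset.mem_filter.2 ⟨mem_slots.2 ⟨hsub h4, h1, u, hsub hu, w, hsub hw, h5⟩, h2⟩)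
    · intro p hp p' hp' heq
      by_contra hne
      obtain ⟨-, -, h3, h4, h5, h6⟩ := hg p hp
      obtain ⟨-, -, h3', h4', h5', h6'⟩ := hg p' hp'
      rw [heq] at h4
      rcases ear_unique hI h3 h3' h4 h4' hne with ⟨e1, e2⟩ | ⟨e1, e2⟩
      · rw [← e1] at h5; rw [← e2] at h6'; exact chg_asymm hi h5 h6'
      · rw [← e1] at h6; rw [← e2] at h5'; exact chg_asymm hi h6 h5'
  have hB : (I ×ˢ ({d0, -d0} : Finset Pt)).card ≤ ((slots S d0).filter (fun s => ¬ (s.1 ∉ I))).card := by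
    apply Finset.card_le_card
    intro s hs
    obtain ⟨h1, h2⟩ := Finset.mem_product.1 hs
    simp only [Finset.mem_insert, Finset.mem_singleton] at h2
    obtain ⟨a, b, c, h⟩ := hfull _ h1
    have hin := full_intr hI h
    refine Finset.mem_filter.2 ⟨mem_slots.2 ⟨hIS h1, h2, ?_⟩, not_not.2 h1⟩
    rcases h2 with h | h <;> rw [h]
    · exact hin.slot hd (hIS h1)
    · exact hin.slot hd.neg (hIS h1)
  rw [Finset.card_product, Finset.card_pair hdd] at hB
  have hC := Finset.card_filter_add_card_filter_not (s := slots S d0) (fun s => s.1 ∉ I)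
  have hD : (I ∪ X).card = I.card + X.card := by
    apply Finset.card_union_of_disjoint
    rw [Finset.disjoint_left]
    intro p hp hp'
    exact (Finset.mem_filter.1 hp').2.1 hp
  omega

/-- A maximal independent set of full vertices. -/
lemma exists_indep (S : Finset Pt) (QQ : Finset (Finset Pt)) : ∃ I ⊆ S, Indep QQ I ∧ (∀ p ∈ I, ∃ a b c, FullAt QQ p a b c) ∧
    ∀ p ∈ S, p ∉ I → (∃ a b c, FullAt QQ p a b c) → ∃ q ∈ I, IE QQ p q := by
  obtain ⟨I, hI, hmax⟩ := Finset.exists_max_image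
    (S.powerset.filter (fun I => Indep QQ I ∧ ∀ p ∈ I, ∃ a b c, FullAt QQ p a b c)) Finset.card
    ⟨∅, Finset.mem_filter.2 ⟨by simp, by intro p hp; simp at hp, by intro p hp; simp at hp⟩⟩
  obtain ⟨h1, h2, h3⟩ := Finset.mem_filter.1 hI
  rw [Finset.mem_powerset] at h1
  refine ⟨I, h1, h2, h3, ?_⟩
  intro p hp hpI hf
  by_contra hcon
  push Not at hcon
  have hno : ¬ IE QQ p p := by
    rintro ⟨⟨Q, _, h⟩, _⟩; exact h.2.2.1 rfl
  have := hmax (insert p I) (Finset.mem_filter.2 ⟨?_, ?_, ?_⟩)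
  · rw [Finset.card_insert_of_notMem hpI] at this
    omega
  · exact Finset.mem_powerset.2 (Finset.insert_subset hp h1)
  · intro a ha b hb hab
    rcases Finset.mem_insert.1 ha with ea | ha'
    · subst ea
      rcases Finset.mem_insert.1 hb with eb | hb'
      · subst eb; exact hno hab
      · exact hcon b hb' hab
    · rcases Finset.mem_insert.1 hb with eb | hb'
      · subst eb; exact hcon a ha' hab.symm
      · exact h2 a ha' b hb' hab
  · intro a ha
    rcases Finset.mem_insert.1 ha with rfl | ha
    · exact hf
    · exact h3 a ha

lemma chg_le_three (hS : GenPos S) (hI : PInv T QQ F) {I : Finset Pt} {p : Pt} (h : ∃ a b c, FullAt QQ p a b c) :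
    (chg S QQ I p).card ≤ 3 := by
  obtain ⟨a, b, c, h⟩ := h
  have : chg S QQ I p ⊆ {a, b, c} := by
    intro q hq
    simpa using full_nbrs hS hI h (Finset.mem_filter.1 hq).2.1
  exact (Finset.card_le_card this).trans Finset.card_le_three

lemma chg_le_two (hS : GenPos S) (hI : PInv T QQ F) {I : Finset Pt} {p : Pt} (hp : p ∉ I)
    (hmax : (∃ a b c, FullAt QQ p a b c) → ∃ q ∈ I, IE QQ p q) :
    (chg S QQ I p).card ≤ 2 := by
  by_contra hcon
  push Not at hcon
  obtain ⟨q₁, h1, q₂, h2, q₃, h3, n12, n13, n23⟩ := Finset.two_lt_card.1 hcon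
  have g1 := (Finset.mem_filter.1 h1).2
  have g2 := (Finset.mem_filter.1 h2).2
  have g3 := (Finset.mem_filter.1 h3).2
  have k1 := g1.2.resolve_left hp
  have k2 := g2.2.resolve_left hp
  have k3 := g3.2.resolve_left hp
  obtain ⟨a, b, c, hf⟩ := three_rfx hS hI k1.2.2.1 k2.2.2.1 k3.2.2.1 n12 n13 n23
  obtain ⟨q, hq, hpq⟩ := hmax ⟨a, b, c, hf⟩
  have m0 := full_nbrs hS hI hf hpq
  have m1 := full_nbrs hS hI hf g1.1
  have m2 := full_nbrs hS hI hf g2.1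
  have m3 := full_nbrs hS hI hf g3.1
  have e1 : q₁ ≠ q := by rintro rfl; exact k1.2.1 hq
  have e2 : q₂ ≠ q := by rintro rfl; exact k2.2.1 hq
  have e3 : q₃ ≠ q := by rintro rfl; exact k3.2.1 hq
  clear * - m0 m1 m2 m3 e1 e2 e3 n12 n13 n23
  grind

lemma chg_sum (hS : GenPos S) (hI : PInv T QQ F) {I : Finset Pt} (hIS : I ⊆ S)
    (hfull : ∀ p ∈ I, ∃ a b c, FullAt QQ p a b c)
    (hmax : ∀ p ∈ S, p ∉ I → (∃ a b c, FullAt QQ p a b c) → ∃ q ∈ I, IE QQ p q) :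
    (∑ p ∈ S, (chg S QQ I p).card) ≤ 2 * I.card + (S.filter (Intr S)).card +
      (S.filter (fun p => p ∉ I ∧ 1 < (chg S QQ I p).card)).card ∧
    I.card + (S.filter (fun p => p ∉ I ∧ 1 < (chg S QQ I p).card)).card ≤ (S.filter (Intr S)).card := by
  have hin : ∀ p, p ∉ I → 0 < (chg S QQ I p).card → Intr S p := by
    intro p hp h
    obtain ⟨q, hq⟩ := Finset.card_pos.1 h
    exact rfx_intr hI ((Finset.mem_filter.1 hq).2.2.resolve_left hp).2.2.1
  constructor
  · have : ∀ p ∈ S, (chg S QQ I p).card ≤ 2 * (if p ∈ I then 1 else 0) + (if Intr S p then 1 else 0) +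
        (if (p ∉ I ∧ 1 < (chg S QQ I p).card) then 1 else 0) := by
      intro p hp
      by_cases hpI : p ∈ I
      · have h3 := chg_le_three (I := I) hS hI (hfull p hpI)
        obtain ⟨a, b, c, h⟩ := hfull p hpI
        have := full_intr hI h
        simp only [hpI, this, if_true]
        omega
      · have h2 := chg_le_two hS hI hpI (hmax p hp hpI)
        by_cases h0 : 0 < (chg S QQ I p).card
        · have := hin p hpI h0
          by_cases h1 : 1 < (chg S QQ I p).card
          · rw [if_neg hpI, if_pos this, if_pos ⟨hpI, h1⟩]; omega
          · rw [if_neg hpI, if_pos this]; omega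
        · omega
    have hsum := Finset.sum_le_sum this
    rw [Finset.sum_add_distrib, Finset.sum_add_distrib, ← Finset.mul_sum, ← Finset.card_filter, ← Finset.card_filter,
      ← Finset.card_filter, Finset.filter_mem_eq_inter, Finset.inter_eq_right.2 hIS] at hsum
    exact hsum
  · rw [← Finset.card_union_of_disjoint]
    · apply Finset.card_le_card
      intro p hp
      rcases Finset.mem_union.1 hp with hp | hp
      · obtain ⟨a, b, c, h⟩ := hfull p hp
        exact Finset.mem_filter.2 ⟨hIS hp, full_intr hI h⟩
      · obtain ⟨h1, h2, h3⟩ := Finset.mem_filter.1 hp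
        exact Finset.mem_filter.2 ⟨h1, hin p h2 (by omega)⟩
    · rw [Finset.disjoint_left]
      intro p hp hp'
      exact (Finset.mem_filter.1 hp').2.1 hp

lemma ie_count (hI : PInv T QQ F) (hrfx : ∀ p q, IE QQ p q → Rfx QQ p q ∨ Rfx QQ q p) (I : Finset Pt) :
    ((S ×ˢ S).filter (fun x => IE QQ x.1 x.2)).card ≤ 2 * ∑ p ∈ S, (chg S QQ I p).card := by
  set Ch := (S ×ˢ S).filter (fun x => Chg QQ I x.1 x.2) with hCh
  have h1 : Ch.card = ∑ p ∈ S, (chg S QQ I p).card := by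
    rw [hCh, Finset.card_filter, Finset.sum_product]
    refine Finset.sum_congr rfl fun p _ => ?_
    rw [chg, Finset.card_filter]
  have h2 : (S ×ˢ S).filter (fun x => IE QQ x.1 x.2) ⊆ Ch ∪ Ch.image Prod.swap := by
    rintro ⟨p, q⟩ hx
    obtain ⟨hm, h⟩ := Finset.mem_filter.1 hx
    obtain ⟨hp, hq⟩ := Finset.mem_product.1 hm
    rcases chg_cover (I := I) hrfx h with h | h
    · exact Finset.mem_union_left _ (Finset.mem_filter.2 ⟨hm, h⟩)
    · exact Finset.mem_union_right _ (Finset.mem_image.2 ⟨(q, p),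
        Finset.mem_filter.2 ⟨Finset.mem_product.2 ⟨hq, hp⟩, h⟩, rfl⟩)
  have h3 := (Finset.card_le_card h2).trans (Finset.card_union_le _ _)
  have h4 : (Ch.image Prod.swap).card ≤ Ch.card := Finset.card_image_le
  omega

lemma side_count (hS : GenPos S) (hI : PInv T QQ F) :
    ∑ Q ∈ QQ, Q.card ≤ ((S ×ˢ S).filter (fun x => IE QQ x.1 x.2)).card + (S.filter (fun p => ¬ Intr S p)).card := by
  set D := (S ×ˢ S).filter (fun x => ∃ Q ∈ QQ, IsSide Q x.1 x.2) with hD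
  have h1 : ∑ Q ∈ QQ, Q.card ≤ D.card := by
    rw [← Finset.card_sigma]
    have H : ∀ x ∈ QQ.sigma (fun Q => Q), ∃ q, IsSide x.1 x.2 q := by
      rintro ⟨Q, p⟩ hx
      obtain ⟨hQ, hp⟩ := Finset.mem_sigma.1 hx
      exact (hI.poly Q hQ).2 p hp
    choose! f hf using H
    refine Finset.card_le_card_of_injOn (fun x => (x.2, f x)) ?_ ?_
    · rintro ⟨Q, p⟩ hx
      have hs := hf _ hx
      obtain ⟨hQ, hp⟩ := Finset.mem_sigma.1 hx
      exact Finset.mem_coe.2 (Finset.mem_filter.2 ⟨Finset.mem_product.2 ⟨hI.sub Q hQ hp, hI.sub Q hQ hs.2.1⟩, Q, hQ, hs⟩)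
    · rintro ⟨Q, p⟩ hx ⟨Q', p'⟩ hx' heq
      have hs := hf _ hx
      have hs' := hf _ hx'
      obtain ⟨hQ, hp⟩ := Finset.mem_sigma.1 hx
      obtain ⟨hQ', hp'⟩ := Finset.mem_sigma.1 hx'
      simp only [Prod.mk.injEq] at heq hs hs'
      obtain ⟨e1, e2⟩ := heq
      subst e1
      rw [e2] at hs
      have := hI.side_unique hQ hQ' hs hs'
      subst this
      rfl
  set E := (S ×ˢ S).filter (fun x => IE QQ x.1 x.2) with hE
  have hleft : ∀ x ∈ D \ E, ∀ r ∈ S, 0 ≤ ori x.1 x.2 r := by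
    rintro ⟨p, q⟩ hx r hr
    obtain ⟨hxD, hxE⟩ := Finset.mem_sdiff.1 hx
    obtain ⟨hm, Q, hQ, hs⟩ := Finset.mem_filter.1 hxD
    by_contra hcon
    apply hxE
    refine Finset.mem_filter.2 ⟨hm, ⟨Q, hQ, hs⟩, hI.rev Q hQ p q hs r hr ?_⟩
    rw [ori_swap]; simp only at hcon; linarith
  have hDm : ∀ x ∈ D \ E, x.1 ∈ S ∧ x.2 ∈ S ∧ x.1 ≠ x.2 := by
    rintro ⟨p, q⟩ hx
    obtain ⟨hm, Q, hQ, hs⟩ := Finset.mem_filter.1 (Finset.mem_sdiff.1 hx).1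
    exact ⟨(Finset.mem_product.1 hm).1, (Finset.mem_product.1 hm).2, hs.2.2.1⟩
  have h2 : (D \ E).card ≤ (S.filter (fun p => ¬ Intr S p)).card := by
    refine Finset.card_le_card_of_injOn Prod.fst ?_ ?_
    · rintro ⟨p, q⟩ hx
      obtain ⟨hp, hq, hpq⟩ := hDm _ hx
      refine Finset.mem_coe.2 (Finset.mem_filter.2 ⟨hp, ?_⟩)
      rintro ⟨a, ha, b, hb, c, hc, k1, k2, k3⟩
      have l1 := hleft _ hx a ha
      have l2 := hleft _ hx b hb
      have l3 := hleft _ hx c hc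
      simp only at l1 l2 l3 hp hq hpq k1 k2 k3
      have key : ori p b c * ori p q a + ori p c a * ori p q b + ori p a b * ori p q c = 0 := by
        unfold ori; ring
      have m1 := mul_nonneg k2.le l1
      have m2 := mul_nonneg k3.le l2
      have m3 := mul_nonneg k1.le l3
      have z1 : ori p q a = 0 := by
        have : ori p b c * ori p q a = 0 := by linarith
        exact (mul_eq_zero.1 this).resolve_left k2.ne'
      have z2 : ori p q b = 0 := by
        have : ori p c a * ori p q b = 0 := by linarith
        exact (mul_eq_zero.1 this).resolve_left k3.ne'
      have q1 : q = a := by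
        by_contra hne
        exact hS.ori_ne hp hq ha hpq (ori_ne_left k1.ne') hne z1
      have q2 : q = b := by
        by_contra hne
        exact hS.ori_ne hp hq hb hpq (ori_ne_left k2.ne') hne z2
      rw [← q1, ← q2] at k1
      simp at k1
    · rintro ⟨p, q⟩ hx ⟨p', q'⟩ hx' heq
      obtain ⟨hp, hq, hpq⟩ := hDm _ hx
      obtain ⟨hp', hq', hpq'⟩ := hDm _ hx'
      have l1 := hleft _ hx q' hq'
      have l2 := hleft _ hx' q hq
      simp only at heq l1 l2 hp hq hpq hp' hq' hpq'
      subst heq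
      rw [ori_swap2] at l2
      have : q = q' := by
        by_contra hne
        exact hS.ori_ne hp hq hq' hpq hpq' hne (by linarith)
      rw [this]
  have h3 : D.card ≤ (D \ E).card + E.card := by
    have := Finset.card_le_card (Finset.subset_union_left (s₁ := D) (s₂ := E))
    rw [← Finset.sdiff_union_self_eq_union] at this
    exact this.trans (Finset.card_union_le _ _)
  omega

end counting

lemma main_bound {S : Finset Pt} (hS : GenPos S) {T : PlaneGraph S} (hT : IsTriangulation T) :
    ∃ F : Finset (Sym2 Pt), IsPsFlippable T F ∧ S.card ≤ 2 * F.card + 4 := by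
  obtain ⟨QQ, F, hI, hrfx⟩ := exists_max hS hT
  refine ⟨F, hI.flippable hS, ?_⟩
  obtain ⟨d0, hd, hd0⟩ := exists_genDir S
  obtain ⟨I, hIS, hi, hfull, hmax⟩ := exists_indep S QQ
  have e1 := slots_le hS hT hd
  have e2 := slots_ge hS hd hd0
  have e3 := slot_count hS hI hd hd0 hIS hi hfull
  obtain ⟨e4, e5⟩ := chg_sum hS hI hIS hfull hmax
  have e6 := ie_count hI hrfx I
  have e7 := side_count hS hI
  have e8 := hI.count
  have e9 := hI.sum
  have e10 := Finset.card_filter_add_card_filter_not (s := S) (Intr S)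
  omega

/-- Every triangulation of `N` points in general position contains
a set of at least `N/2 - 2` ps-flippable edges. -/
theorem statement3 (S : Finset Pt) (hS : GenPos S) (T : PlaneGraph S)
    (hT : IsTriangulation T) :
    ∃ F : Finset (Sym2 Pt), IsPsFlippable T F ∧
      (S.card : ℝ) / 2 - 2 ≤ (F.card : ℝ) := by
  obtain ⟨F, hF, hc⟩ := main_bound hS hT
  refine ⟨F, hF, ?_⟩
  have : (S.card : ℝ) ≤ 2 * (F.card : ℝ) + 4 := by exact_mod_cast hc
  linarith

end
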